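/- Let K be a global function field of characteristic different from 2, i.e. a finite extension of 𝔽_q(t) where q is odd. Then the set {(x, y) ∈ K² : x is not a norm from K(√y) to K, i.e. there do not exist u, v ∈ K with x = u² − y·v²} is diophantine over K. -/

import Mathlib

/-- A subset `S ⊆ K^ι` is diophantine over `K` if there are `m ∈ ℕ` and a polynomial
`f` in the variables `y_i` (`i : ι`) and `x_1, …, x_m` with coefficients in `K` such that
`a ∈ S` iff `f(a, x) = 0` has a solution `x ∈ K^m`. -/
def IsDiophantine {K : Type*} [Field K] {ι : Type*} [Fintype ι] (S : Set (ι → K)) : Prop :=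
  ∃ (m : ℕ) (f : MvPolynomial (ι ⊕ Fin m) K),
    ∀ a : ι → K, a ∈ S ↔ ∃ x : Fin m → K, MvPolynomial.eval (Sum.elim a x) f = 0


set_option linter.unusedSectionVars false
set_option linter.unusedVariables false

namespace NND

/-- A discrete place of `K` trivial on `F`. -/
@[ext]
structure Place (F K : Type*) [Field F] [Field K] [Algebra F K] where
  ord : K → ℤ
  ord_zero : ord 0 = 0
  ord_mul : ∀ x y : K, x ≠ 0 → y ≠ 0 → ord (x * y) = ord x + ord y
  ord_add : ∀ x y : K, x ≠ 0 → y ≠ 0 → x + y ≠ 0 → min (ord x) (ord y) ≤ ord (x + y)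
  ord_surj : ∃ x : K, x ≠ 0 ∧ ord x = 1
  ord_alg : ∀ c : F, ord (algebraMap F K c) = 0

namespace Place

variable {F K : Type*} [Field F] [Field K] [Algebra F K] (v : Place F K)

def ge (n : ℤ) (x : K) : Prop := x = 0 ∨ n ≤ v.ord x

@[simp] lemma ord_one : v.ord 1 = 0 := by
  have := v.ord_mul 1 1 one_ne_zero one_ne_zero
  simp at this; exact this

lemma ord_neg_one : v.ord (-1) = 0 := by
  have := v.ord_mul (-1) (-1) (by simp) (by simp)
  simp at this; omega

@[simp] lemma ord_neg (x : K) : v.ord (-x) = v.ord x := by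
  by_cases hx : x = 0
  · simp [hx]
  · have := v.ord_mul (-1) x (by simp) hx
    simpa [ord_neg_one] using this

lemma ord_inv (x : K) : v.ord x⁻¹ = - v.ord x := by
  by_cases hx : x = 0
  · simp [hx, v.ord_zero]
  · have := v.ord_mul x x⁻¹ hx (inv_ne_zero hx)
    rw [mul_inv_cancel₀ hx, ord_one] at this
    omega

lemma ord_div (x y : K) (hx : x ≠ 0) (hy : y ≠ 0) : v.ord (x / y) = v.ord x - v.ord y := by
  rw [div_eq_mul_inv, v.ord_mul _ _ hx (inv_ne_zero hy), ord_inv]; ring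

lemma ord_pow (x : K) (n : ℕ) : v.ord (x ^ n) = n * v.ord x := by
  by_cases hx : x = 0
  · rcases n with _ | n
    · simp
    · simp [hx, v.ord_zero]
  · induction n with
    | zero => simp
    | succ n ih => rw [pow_succ, v.ord_mul _ _ (pow_ne_zero _ hx) hx, ih]; push_cast; ring

lemma ord_zpow (x : K) (n : ℤ) : v.ord (x ^ n) = n * v.ord x := by
  rcases n with n | n
  · simpa using v.ord_pow x n
  · rw [zpow_negSucc, ord_inv, ord_pow]; push_cast [Int.negSucc_eq]; ring

@[simp] lemma ge_zero (n : ℤ) : v.ge n 0 := Or.inl rfl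

lemma ge_iff {n : ℤ} {x : K} (hx : x ≠ 0) : v.ge n x ↔ n ≤ v.ord x := by simp [ge, hx]

lemma ge_mono {m n : ℤ} {x : K} (h : m ≤ n) (hx : v.ge n x) : v.ge m x := by
  rcases hx with h0 | h1
  · exact Or.inl h0
  · exact Or.inr (h.trans h1)

lemma ge_add {n : ℤ} {x y : K} (hx : v.ge n x) (hy : v.ge n y) : v.ge n (x + y) := by
  by_cases h : x + y = 0
  · exact Or.inl h
  by_cases hx0 : x = 0
  · simpa [hx0] using hy
  by_cases hy0 : y = 0
  · simpa [hy0] using hx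
  rw [ge_iff _ hx0] at hx
  rw [ge_iff _ hy0] at hy
  exact Or.inr ((le_min hx hy).trans (v.ord_add x y hx0 hy0 h))

lemma ge_neg {n : ℤ} {x : K} (hx : v.ge n x) : v.ge n (-x) := by
  rcases hx with h0 | h1
  · simp [h0]
  · right; simpa using h1

lemma ge_neg_iff {n : ℤ} {x : K} : v.ge n (-x) ↔ v.ge n x :=
  ⟨fun h => by simpa using v.ge_neg h, v.ge_neg⟩

lemma ge_sub {n : ℤ} {x y : K} (hx : v.ge n x) (hy : v.ge n y) : v.ge n (x - y) := by
  rw [sub_eq_add_neg]; exact v.ge_add hx (v.ge_neg hy)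

lemma ge_sub_comm {n : ℤ} {x y : K} (h : v.ge n (x - y)) : v.ge n (y - x) := by
  rw [← neg_sub]; exact v.ge_neg h

lemma ge_mul {m n : ℤ} {x y : K} (hx : v.ge m x) (hy : v.ge n y) : v.ge (m + n) (x * y) := by
  by_cases hx0 : x = 0
  · simp [hx0]
  by_cases hy0 : y = 0
  · simp [hy0]
  rw [ge_iff _ hx0] at hx
  rw [ge_iff _ hy0] at hy
  right; rw [v.ord_mul _ _ hx0 hy0]; omega

lemma ge_mul_iff {n : ℤ} {x y : K} (hx : x ≠ 0) : v.ge n (x * y) ↔ v.ge (n - v.ord x) y := by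
  by_cases hy0 : y = 0
  · simp [hy0]
  rw [ge_iff _ (mul_ne_zero hx hy0), ge_iff _ hy0, v.ord_mul _ _ hx hy0]; omega

lemma ge_sum {ι : Type*} (s : Finset ι) (f : ι → K) {n : ℤ} (h : ∀ i ∈ s, v.ge n (f i)) :
    v.ge n (∑ i ∈ s, f i) := by
  classical
  induction s using Finset.induction_on with
  | empty => simp
  | insert a s ha ih =>
    rw [Finset.sum_insert ha]
    exact v.ge_add (h _ (by simp)) (ih fun i hi => h i (by simp [hi]))

lemma ge_one : v.ge 0 1 := by right; simp

lemma ge_alg (c : F) : v.ge 0 (algebraMap F K c) := by right; simp [v.ord_alg]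

lemma ge_smul {n : ℤ} (c : F) {x : K} (hx : v.ge n x) : v.ge n (c • x) := by
  rw [Algebra.smul_def]; simpa using v.ge_mul (v.ge_alg c) hx

lemma ord_smul (c : F) (hc : c ≠ 0) (x : K) : v.ord (c • x) = v.ord x := by
  by_cases hx : x = 0
  · simp [hx]
  rw [Algebra.smul_def, v.ord_mul _ _ (by simpa using hc) hx, v.ord_alg]; simp

lemma not_ge_iff {n : ℤ} {x : K} : ¬ v.ge n x ↔ x ≠ 0 ∧ v.ord x < n := by
  simp [ge]

/-- adding something of larger order does not change the order -/
lemma ord_add_eq {x y : K} (hx : x ≠ 0) (hy : v.ge (v.ord x + 1) y) :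
    x + y ≠ 0 ∧ v.ord (x + y) = v.ord x := by
  by_cases hy0 : y = 0
  · simp [hy0, hx]
  rw [ge_iff _ hy0] at hy
  have hne : x + y ≠ 0 := by
    intro h
    have : x = -y := eq_neg_of_add_eq_zero_left h
    rw [this, ord_neg] at hy; omega
  refine ⟨hne, ?_⟩
  have h1 := v.ord_add x y hx hy0 hne
  have h2 := v.ord_add (x + y) (-y) hne (by simpa using hy0) (by simpa using hx)
  simp at h2 h1
  omega

lemma ord_eq_of_sub {x y : K} (hx : x ≠ 0) (h : v.ge (v.ord x + 1) (y - x)) :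
    y ≠ 0 ∧ v.ord y = v.ord x := by
  have := v.ord_add_eq hx h
  simpa using this

/-- inclusion of rings gives proportionality -/
lemma ord_eq_mul_of_le {L : Type*} [Field L] (i : K →+* L) {W : L → ℤ}
    (hW : ∀ x y : L, x ≠ 0 → y ≠ 0 → W (x * y) = W x + W y)
    (h : ∀ x : K, x ≠ 0 → 0 ≤ v.ord x → 0 ≤ W (i x)) (π : K) (hπ0 : π ≠ 0) (hπ : v.ord π = 1)
    (x : K) (hx : x ≠ 0) : W (i x) = W (i π) * v.ord x := by
  have h1 : W 1 = 0 := by have := hW 1 1 one_ne_zero one_ne_zero; simp at this; exact this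
  have hinv : ∀ x : L, x ≠ 0 → W x⁻¹ = - W x := by
    intro x hx
    have := hW x x⁻¹ hx (inv_ne_zero hx)
    rw [mul_inv_cancel₀ hx, h1] at this; omega
  have hpow : ∀ (x : L), x ≠ 0 → ∀ (n : ℕ), W (x ^ n) = n * W x := by
    intro x hx n
    induction n with
    | zero => simp [h1]
    | succ n ih => rw [pow_succ, hW _ _ (pow_ne_zero _ hx) hx, ih]; push_cast; ring
  have hzpow : ∀ (x : L), x ≠ 0 → ∀ (n : ℤ), W (x ^ n) = n * W x := by
    intro x hx n
    rcases n with n | n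
    · simpa using hpow x hx n
    · rw [zpow_negSucc, hinv _ (pow_ne_zero _ hx), hpow _ hx]; push_cast [Int.negSucc_eq]; ring
  have hu : ∀ x : K, x ≠ 0 → v.ord x = 0 → W (i x) = 0 := by
    intro x hx h0
    have a := h x hx (by omega)
    have b := h x⁻¹ (inv_ne_zero hx) (by rw [ord_inv]; omega)
    rw [map_inv₀, hinv _ (by simpa using hx)] at b
    omega
  have := hu (x * (π ^ (v.ord x))⁻¹) (mul_ne_zero hx (inv_ne_zero (zpow_ne_zero _ hπ0)))
    (by rw [v.ord_mul _ _ hx (inv_ne_zero (zpow_ne_zero _ hπ0)), ord_inv, ord_zpow, hπ]; ring)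
  have hi : i π ≠ 0 := by simpa using hπ0
  rw [map_mul, map_inv₀, map_zpow₀, hW _ _ (by simpa using hx) (inv_ne_zero (zpow_ne_zero _ hi)),
    hinv _ (zpow_ne_zero _ hi), hzpow _ hi] at this
  linarith

lemma eq_of_le {v w : Place F K} (h : ∀ x : K, x ≠ 0 → 0 ≤ v.ord x → 0 ≤ w.ord x) : v = w := by
  obtain ⟨π, hπ0, hπ⟩ := v.ord_surj
  have key := v.ord_eq_mul_of_le (RingHom.id K) w.ord_mul (by simpa using h) π hπ0 hπ
  simp at key
  obtain ⟨y, hy0, hy⟩ := w.ord_surj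
  have hp := h π hπ0 (by omega)
  have := key y hy0
  rw [hy] at this
  have h1 : w.ord π = 1 := by
    rcases Int.eq_one_or_neg_one_of_mul_eq_one this.symm with h | h <;> omega
  ext x
  by_cases hx : x = 0
  · simp [hx, ord_zero]
  · have := key x hx
    rw [h1] at this; omega

lemma exists_sep {v w : Place F K} (h : v ≠ w) : ∃ x : K, x ≠ 0 ∧ 0 < v.ord x ∧ w.ord x < 0 := by
  have h1 : ∃ x : K, x ≠ 0 ∧ 0 ≤ v.ord x ∧ w.ord x < 0 := by
    by_contra! hc; exact h (eq_of_le hc)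
  have h2 : ∃ x : K, x ≠ 0 ∧ 0 ≤ w.ord x ∧ v.ord x < 0 := by
    by_contra! hc; exact h (eq_of_le hc).symm
  obtain ⟨x, hx, a, b⟩ := h1
  obtain ⟨y, hy, c, d⟩ := h2
  refine ⟨x / y, div_ne_zero hx hy, ?_, ?_⟩
  · rw [ord_div _ _ _ hx hy]; omega
  · rw [ord_div _ _ _ hx hy]; omega

lemma exists_sep_finset (v : Place F K) (s : Finset (Place F K)) (hs : v ∉ s) :
    ∃ x : K, x ≠ 0 ∧ 0 < v.ord x ∧ ∀ w ∈ s, w.ord x < 0 := by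
  classical
  induction s using Finset.induction_on with
  | empty =>
    obtain ⟨π, hπ0, hπ⟩ := v.ord_surj
    exact ⟨π, hπ0, by omega, by simp⟩
  | insert w s hw ih =>
    simp only [Finset.mem_insert, not_or] at hs
    obtain ⟨x, hx0, hx, hxs⟩ := ih hs.2
    by_cases hwx : w.ord x < 0
    · exact ⟨x, hx0, hx, by simpa [hwx] using hxs⟩
    obtain ⟨y, hy0, hy, hyw⟩ := exists_sep hs.1
    set r : ℕ := 1 + ∑ u ∈ s, (u.ord x).natAbs with hr
    have hrs : ∀ u ∈ s, (u.ord x).natAbs < r := by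
      intro u hu
      have := Finset.single_le_sum (f := fun u : Place F K => (u.ord x).natAbs)
        (fun _ _ => Nat.zero_le _) hu
      omega
    have hyr : y ^ r ≠ 0 := pow_ne_zero _ hy0
    have hr1 : (1 : ℤ) ≤ r := by omega
    have hw1 : w.ord (y ^ r) < 0 := by rw [ord_pow]; nlinarith
    have hv1 : 0 < v.ord (y ^ r) := by rw [ord_pow]; nlinarith
    have hz := w.ord_add_eq hyr (y := x) (Or.inr (by omega))
    rw [add_comm] at hz
    refine ⟨x + y ^ r, hz.1, ?_, ?_⟩
    · have := v.ord_add x (y ^ r) hx0 hyr hz.1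
      omega
    · intro u hu
      rw [Finset.mem_insert] at hu
      rcases hu with rfl | hu
      · omega
      have hux := hxs u hu
      have hur := hrs u hu
      rcases lt_trichotomy (u.ord x) (u.ord (y ^ r)) with h | h | h
      · rw [(u.ord_add_eq hx0 (y := y ^ r) (Or.inr (by omega))).2]; exact hux
      · exfalso
        rw [ord_pow] at h
        rcases lt_trichotomy (u.ord y) 0 with h' | h' | h'
        · have : (r : ℤ) * u.ord y ≤ - r := by nlinarith
          omega
        · rw [h'] at h; omega
        · have : 0 < (r : ℤ) * u.ord y := by positivity
          omega
      · rw [add_comm, (u.ord_add_eq hyr (y := x) (Or.inr (by omega))).2]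
        omega

lemma exists_idem (v : Place F K) (s : Finset (Place F K)) (hs : v ∉ s) (M : ℕ) :
    ∃ x : K, v.ge M (x - 1) ∧ ∀ w ∈ s, w.ge M x := by
  obtain ⟨x, hx0, hx, hxs⟩ := exists_sep_finset v s hs
  set m := M + 1
  have hxm : x ^ m ≠ 0 := pow_ne_zero _ hx0
  have hv := v.ord_add_eq (x := 1) one_ne_zero (y := x ^ m)
    (Or.inr (by rw [ord_pow, ord_one]; push_cast [m]; nlinarith))
  refine ⟨(1 + x ^ m)⁻¹, ?_, ?_⟩
  · have : (1 + x ^ m)⁻¹ - 1 = - (x ^ m / (1 + x ^ m)) := by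
      have := hv.1
      field_simp
      ring
    rw [this]
    apply ge_neg
    right
    rw [ord_div _ _ _ hxm hv.1, hv.2, ord_one, ord_pow]; push_cast [m]; nlinarith
  · intro w hw
    right
    have h0 := hxs w hw
    have h1 := w.ord_add_eq hxm (y := 1) (Or.inr (by rw [ord_pow, ord_one]; push_cast [m]; nlinarith))
    rw [ord_inv, add_comm, h1.2, ord_pow]; push_cast [m]; nlinarith

lemma weak_approx (s : Finset (Place F K)) (a : Place F K → K) (n : Place F K → ℤ) :
    ∃ x : K, ∀ w ∈ s, w.ge (n w) (x - a w) := by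
  classical
  set M : ℕ := ∑ u ∈ s, (n u).natAbs + ∑ u ∈ s, ∑ w ∈ s, (u.ord (a w)).natAbs with hM
  have hM1 : ∀ u ∈ s, ∀ w ∈ s, n u ≤ M + u.ord (a w) := by
    intro u hu w hw
    have h1 := Finset.single_le_sum (f := fun u : Place F K => (n u).natAbs)
        (fun _ _ => Nat.zero_le _) hu
    have h2 := Finset.single_le_sum (f := fun u : Place F K => ∑ w ∈ s, (u.ord (a w)).natAbs)
        (fun _ _ => Nat.zero_le _) hu
    have h3 := Finset.single_le_sum (f := fun w : Place F K => (u.ord (a w)).natAbs)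
        (fun _ _ => Nat.zero_le _) hw
    omega
  choose e he1 he2 using fun v : Place F K => exists_idem v (s.erase v) (by simp) M
  refine ⟨∑ w ∈ s, e w * a w, fun u hu => ?_⟩
  have : ∑ w ∈ s, e w * a w - a u = (e u - 1) * a u + ∑ w ∈ s.erase u, e w * a w := by
    rw [← Finset.add_sum_erase s _ hu]; ring
  rw [this]
  have hh : ∀ w ∈ s, ∀ z, u.ge M z → u.ge (n u) (z * a w) := by
    intro w hw z hz
    refine u.ge_mono (hM1 u hu w hw) (u.ge_mul hz ?_)
    right; exact le_rfl
  refine u.ge_add (hh u hu _ (he1 u)) (u.ge_sum _ _ ?_)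
  intro w hw
  rw [Finset.mem_erase] at hw
  exact hh w hw.2 _ (he2 w u (by simp [hu, Ne.symm hw.1]))

end Place

end NND


set_option linter.unusedSectionVars false
set_option linter.unusedVariables false

namespace NND

open IntermediateField

/-- `K` is a finitely generated field of transcendence degree one over `F`. -/
class GFF (F K : Type*) [Field F] [Field K] [Algebra F K] : Prop where
  ess : Algebra.EssFiniteType F K
  trd : Algebra.trdeg F K = 1

section
variable {F K : Type*} [Field F] [Field K] [Algebra F K]

lemma GFF.finite_adjoin [h : GFF F K] {x : K} (hx : Transcendental F x) :
    FiniteDimensional F⟮x⟯ K := by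
  have := h.ess
  have hai : AlgebraicIndependent F (fun _ : Unit => x) :=
    algebraicIndependent_unique_type_iff.mpr hx
  have htb : IsTranscendenceBasis F (fun _ : Unit => x) := by
    apply hai.isTranscendenceBasis_of_lift_trdeg_le_of_finite
    rw [h.trd]; simp
  have h1 := htb.isAlgebraic
  have h2 : Algebra.IsAlgebraic F⟮x⟯ K := by
    have := htb.isAlgebraic_field
    rw [Set.range_const] at this
    exact this
  have : Algebra.EssFiniteType F⟮x⟯ K := Algebra.EssFiniteType.of_comp F F⟮x⟯ K
  exact Algebra.finite_of_essFiniteType_of_isAlgebraic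

lemma GFF.exists_transc (F K : Type*) [Field F] [Field K] [Algebra F K] [h : GFF F K] :
    ∃ x : K, Transcendental F x := by
  have : Algebra.Transcendental F K := trdeg_ne_zero_iff.mp (by rw [h.trd]; simp)
  exact this.transcendental

lemma isAlg_pow_eq_one [Finite F] {x : K} (hx : IsAlgebraic F x) (h0 : x ≠ 0) :
    ∃ n : ℕ, 0 < n ∧ x ^ n = 1 := by
  have : FiniteDimensional F F⟮x⟯ := adjoin.finiteDimensional hx.isIntegral
  have : Finite F⟮x⟯ := Module.finite_of_finite F
  let y : F⟮x⟯ˣ := Units.mk0 ⟨x, mem_adjoin_simple_self F x⟩ (by simpa [Subtype.ext_iff] using h0)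
  obtain ⟨n, hn, h⟩ := (isOfFinOrder_of_finite y).exists_pow_eq_one
  refine ⟨n, hn, ?_⟩
  have := congrArg (fun u : F⟮x⟯ˣ => ((u : F⟮x⟯) : K)) h
  simpa [y] using this

lemma Place.ord_isAlg [Finite F] (v : Place F K) {x : K} (hx : IsAlgebraic F x) : v.ord x = 0 := by
  by_cases h0 : x = 0
  · rw [h0, v.ord_zero]
  obtain ⟨n, hn, h⟩ := isAlg_pow_eq_one hx h0
  have := v.ord_pow x n
  rw [h, v.ord_one] at this
  rcases mul_eq_zero.mp this.symm with h | h
  · omega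
  · exact h

/-- elements of a ring that are independent modulo `z` are independent over `F(z)` -/
lemma indep_of_mod (R : Subalgebra F K) {z : K} (hz : z ∈ R) (hzt : Transcendental F z)
    {ι : Type*} (e : ι → K) (he : ∀ i, e i ∈ R)
    (hind : ∀ (s : Finset ι) (c : ι → F), (∃ r ∈ R, ∑ i ∈ s, c i • e i = z * r) → ∀ i ∈ s, c i = 0) :
    LinearIndependent F⟮z⟯ e := by
  open scoped IntermediateField.algebraAdjoinAdjoin in
  rw [← LinearIndependent.iff_fractionRing (R := Algebra.adjoin F {z}), linearIndependent_iff']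
  intro s g hg i hi
  have hp : ∀ i, ∃ p : Polynomial F, Polynomial.aeval z p = (g i : K) := by
    intro i
    have h2 : ∀ y ∈ Algebra.adjoin F {z}, ∃ p : Polynomial F, Polynomial.aeval z p = y := by
      intro y hy
      rwa [Algebra.adjoin_singleton_eq_range_aeval] at hy
    exact h2 _ (g i).2
  choose p hp using hp
  have hrel : ∑ i ∈ s, Polynomial.aeval z (p i) * e i = 0 := by
    rw [← hg]
    refine Finset.sum_congr rfl fun i _ => ?_
    rw [hp, Algebra.smul_def]; rfl
  have hz0 : z ≠ 0 := by
    rintro rfl; exact hzt isAlgebraic_zero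
  have hR : ∀ q : Polynomial F, Polynomial.aeval z q ∈ R := fun q =>
    (Algebra.adjoin_le (by simpa using hz) : Algebra.adjoin F {z} ≤ R)
      (by rw [Algebra.adjoin_singleton_eq_range_aeval]; exact ⟨q, rfl⟩)
  have key : ∀ (k : ℕ) (p : ι → Polynomial F), ∑ i ∈ s, Polynomial.aeval z (p i) * e i = 0 →
      ∀ i ∈ s, Polynomial.X ^ k ∣ p i := by
    intro k
    induction k with
    | zero => intro p _ i _; simp
    | succ k ih =>
      intro p hrel
      have h1 : ∀ i, Polynomial.aeval z (p i) =
          z * Polynomial.aeval z (p i).divX + algebraMap F K ((p i).coeff 0) := by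
        intro i
        have := congrArg (Polynomial.aeval z) (Polynomial.X_mul_divX_add (p i))
        rw [map_add, map_mul, Polynomial.aeval_X, Polynomial.aeval_C] at this
        exact this.symm
      have h2 : ∀ i ∈ s, (p i).coeff 0 = 0 := by
        apply hind s
        refine ⟨-∑ i ∈ s, Polynomial.aeval z (p i).divX * e i,
          neg_mem (sum_mem fun i _ => mul_mem (hR _) (he i)), ?_⟩
        rw [mul_neg, eq_neg_iff_add_eq_zero, Finset.mul_sum, ← Finset.sum_add_distrib, ← hrel]
        refine Finset.sum_congr rfl fun i _ => ?_
        rw [h1 i, Algebra.smul_def]; ring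
      have h3 : ∑ i ∈ s, Polynomial.aeval z (p i).divX * e i = 0 := by
        have : z * ∑ i ∈ s, Polynomial.aeval z (p i).divX * e i = 0 := by
          rw [Finset.mul_sum, ← hrel]
          refine Finset.sum_congr rfl fun i hi => ?_
          rw [h1 i, h2 i hi]; simp; ring
        exact (mul_eq_zero.mp this).resolve_left hz0
      intro i hi
      have h4 := ih _ h3 i hi
      have h5 : p i = Polynomial.X * (p i).divX := by
        conv_lhs => rw [← Polynomial.X_mul_divX_add (p i), h2 i hi]
        simp
      rw [h5, pow_succ']
      exact mul_dvd_mul_left _ h4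
  have hpi : p i = 0 := by
    by_contra hne
    have := Polynomial.natDegree_le_of_dvd (key ((p i).natDegree + 1) p hrel i hi) hne
    simp at this
  have := hp i
  rw [hpi] at this
  ext
  simpa using this.symm

/-- dimension bound for quotients `R / M` with `zR ⊆ M` -/
lemma rank_quot_le [GFF F K] (R : Subalgebra F K) {z : K} (hz : z ∈ R) (hzt : Transcendental F z)
    {Q : Type*} [AddCommGroup Q] [Module F Q] (f : R →ₗ[F] Q) (hf : Function.Surjective f)
    (hker : ∀ r : R, ∀ x : R, (x : K) = z * r → f x = 0) :
    Module.Finite F Q ∧ Module.finrank F Q ≤ Module.finrank F⟮z⟯ K := by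
  have := GFF.finite_adjoin hzt
  have hr : Module.rank F Q ≤ (Module.finrank F⟮z⟯ K : ℕ) := by
    apply rank_le
    intro s hs
    choose g hg using hf
    have := indep_of_mod R hz hzt (fun i : s => (g i : K)) (fun i => (g i).2) (by
      rintro t c ⟨r, hr, h⟩
      have h1 : f (∑ i ∈ t, c i • g i) = 0 := by
        apply hker ⟨r, hr⟩
        rw [← h]; simp
      simp only [map_sum, map_smul, hg] at h1
      exact linearIndependent_iff'.mp hs t c h1)
    have := this.fintype_card_le_finrank
    simpa using this
  refine ⟨?_, ?_⟩
  · have : Module.rank F Q < Cardinal.aleph0 := hr.trans_lt (Cardinal.natCast_lt_aleph0)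
    exact Module.rank_lt_aleph0_iff.mp this
  · exact Module.finrank_le_of_rank_le hr

lemma transc_of_nonunit (R : Subalgebra F K) {z : K} (hz : z ∈ R) (hz1 : z⁻¹ ∉ R) :
    Transcendental F z := by
  intro h
  apply hz1
  have h1 : (⟨z, mem_adjoin_simple_self F z⟩ : F⟮z⟯)⁻¹.1 ∈ F⟮z⟯ := SetLike.coe_mem _
  have : z⁻¹ ∈ F⟮z⟯.toSubalgebra := by exact h1
  rw [adjoin_simple_toSubalgebra_of_isAlgebraic h] at this
  exact (Algebra.adjoin_le (by simpa using hz)) this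

lemma exists_place_of_valuationSubring [GFF F K] (A : ValuationSubring K)
    (hF : ∀ c : F, algebraMap F K c ∈ A) (hA : A ≠ ⊤) :
    ∃ v : Place F K, ∀ x : K, x ≠ 0 → (0 ≤ v.ord x ↔ x ∈ A) := by
  let R : Subalgebra F K := { A.toSubring with algebraMap_mem' := hF }
  have hRA : ∀ x, x ∈ R ↔ x ∈ A := fun x => Iff.rfl
  have : IsNoetherianRing A := by
    rw [isNoetherianRing_iff_ideal_fg]
    intro I
    by_cases hI : I = ⊥
    · rw [hI]; exact Submodule.fg_bot
    by_cases hI' : I = ⊤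
    · rw [hI']; exact Ideal.fg_top A
    obtain ⟨z, hzI, hz0⟩ := Submodule.exists_mem_ne_zero_of_ne_bot hI
    have hz0' : (z : K) ≠ 0 := by simpa using hz0
    have hzu : ((z : K)⁻¹) ∉ R := by
      intro h
      apply hI'
      rw [Ideal.eq_top_iff_one]
      have : (1 : A) = ⟨(z : K)⁻¹, h⟩ * z := by
        ext; simp [hz0']
      rw [this]; exact I.mul_mem_left _ hzI
    have hzt := transc_of_nonunit R z.2 hzu
    let J : Submodule F R :=
      { carrier := {x | ∃ r : R, (x : K) = z * r}
        add_mem' := by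
          rintro a b ⟨r, hr⟩ ⟨s, hs⟩
          exact ⟨r + s, by push_cast; rw [hr, hs]; ring⟩
        zero_mem' := ⟨0, by simp⟩
        smul_mem' := by
          rintro c x ⟨r, hr⟩
          exact ⟨c • r, by simp [hr]⟩ }
    obtain ⟨hfin, -⟩ := rank_quot_le R z.2 hzt J.mkQ J.mkQ_surjective (by
      intro r x h
      simp only [Submodule.mkQ_apply, Submodule.Quotient.mk_eq_zero]
      exact ⟨r, h⟩)
    let I' : Submodule F R :=
      { carrier := {x | (⟨x.1, x.2⟩ : A) ∈ I}
        add_mem' := by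
          intro a b ha hb
          exact I.add_mem ha hb
        zero_mem' := I.zero_mem
        smul_mem' := by
          intro c x hx
          have := I.mul_mem_left (⟨algebraMap F K c, hF c⟩ : A) hx
          have h2 : (⟨(c • x : R).1, (c • x : R).2⟩ : A) =
              (⟨algebraMap F K c, hF c⟩ : A) * (⟨x.1, x.2⟩ : A) := by
            ext
            simp [Algebra.smul_def]
          change (⟨(c • x : R).1, (c • x : R).2⟩ : A) ∈ I
          rw [h2]; exact this }
    obtain ⟨s, hs⟩ := (IsNoetherian.noetherian (I'.map J.mkQ) : (I'.map J.mkQ).FG)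
    have hsI : ∀ q ∈ s, ∃ x : R, x ∈ I' ∧ J.mkQ x = q := by
      intro q hq
      have : q ∈ I'.map J.mkQ := by rw [← hs]; exact Submodule.subset_span hq
      simpa using this
    choose! g hg1 hg2 using hsI
    classical
    refine ⟨insert z (s.image (fun q => (⟨(g q).1, (g q).2⟩ : A))), le_antisymm ?_ ?_⟩
    · rw [Submodule.span_le]
      intro y hy
      simp only [Finset.coe_insert, Finset.coe_image, Set.mem_insert_iff, Set.mem_image,
        Finset.mem_coe] at hy
      rcases hy with rfl | ⟨q, hq, rfl⟩
      · exact hzI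
      · exact hg1 q hq
    · intro y hy
      have hy' : J.mkQ (⟨y.1, y.2⟩ : R) ∈ Submodule.span F (s : Set (R ⧸ J)) := by
        rw [hs]; exact ⟨⟨y.1, y.2⟩, hy, rfl⟩
      obtain ⟨c, hc⟩ := Submodule.mem_span_finset'.mp hy'
      have hd : (⟨y.1, y.2⟩ : R) - ∑ q : s, c q • g q ∈ J := by
        rw [← Submodule.Quotient.mk_eq_zero, ← Submodule.mkQ_apply, map_sub, map_sum, ← hc,
          sub_eq_zero]
        refine Finset.sum_congr rfl fun q _ => ?_
        rw [map_smul, hg2 q q.2]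
      obtain ⟨r, hr⟩ := hd
      have hyy : y = (⟨r.1, r.2⟩ : A) * z + ∑ q : s, (⟨algebraMap F K (c q), hF _⟩ : A) *
          (⟨(g q).1, (g q).2⟩ : A) := by
        ext
        push_cast
        simp [Algebra.smul_def] at hr
        rw [sub_eq_iff_eq_add] at hr
        rw [hr, mul_comm, Finset.univ_eq_attach]
      rw [hyy]
      refine Submodule.add_mem _ ?_ (Submodule.sum_mem _ fun q _ => ?_)
      · exact Ideal.mul_mem_left _ _ (Submodule.subset_span (by simp))
      · refine Ideal.mul_mem_left _ _ (Submodule.subset_span ?_)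
        simp only [Finset.coe_insert, Finset.coe_image, Set.mem_insert_iff, Set.mem_image,
          Finset.mem_coe]
        exact Or.inr ⟨q, q.2, rfl⟩
  have hpid : IsPrincipalIdealRing A := ((IsBezout.TFAE (R := A)).out 0 1).mp this
  have hnf : IsLocalRing.maximalIdeal A ≠ ⊥ := by
    intro h
    apply hA
    rw [eq_top_iff]
    intro x _
    by_contra hx
    have hx0 : x ≠ 0 := by rintro rfl; exact hx A.zero_mem
    have hxi := (A.mem_or_inv_mem x).resolve_left hx
    have h1 : (⟨x⁻¹, hxi⟩ : A) ∈ IsLocalRing.maximalIdeal A := by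
      rw [IsLocalRing.mem_maximalIdeal, mem_nonunits_iff]
      intro hu
      obtain ⟨y, hy⟩ := hu.exists_right_inv
      have : x⁻¹ * (y : K) = 1 := by simpa using congrArg Subtype.val hy
      rw [inv_mul_eq_iff_eq_mul₀ hx0, mul_one] at this
      exact hx (this ▸ y.2)
    rw [h, Ideal.mem_bot] at h1
    exact hx0 (by simpa using congrArg Subtype.val h1)
  have hdvr : IsDiscreteValuationRing A := { not_a_field' := hnf }
  let P := IsDiscreteValuationRing.maximalIdeal A
  let V := P.valuation K
  have hV0 : ∀ x : K, x ≠ 0 → V x ≠ 0 := fun x hx => by simpa using hx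
  have hVA : ∀ x : K, x ≠ 0 → (V x ≤ 1 ↔ x ∈ A) := by
    intro x hx
    constructor
    · intro h
      by_contra hxA
      have hxi := (A.mem_or_inv_mem x).resolve_left hxA
      have h1 : (⟨x⁻¹, hxi⟩ : A) ∈ P.asIdeal := by
        change _ ∈ IsLocalRing.maximalIdeal A
        rw [IsLocalRing.mem_maximalIdeal, mem_nonunits_iff]
        intro hu
        obtain ⟨y, hy⟩ := hu.exists_right_inv
        have : x⁻¹ * (y : K) = 1 := by simpa using congrArg Subtype.val hy
        rw [inv_mul_eq_iff_eq_mul₀ hx, mul_one] at this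
        exact hxA (this ▸ y.2)
      rw [← P.valuation_lt_one_iff_mem (K := K)] at h1
      change V x⁻¹ < 1 at h1
      rw [map_inv₀, inv_lt_one₀ (zero_lt_iff.mpr (hV0 x hx))] at h1
      exact absurd h (not_le.mpr h1)
    · intro h
      exact P.valuation_le_one (K := K) ⟨x, h⟩
  have hord : ∀ x : K, x ≠ 0 → (0 ≤ - WithZero.log (V x) ↔ x ∈ A) := by
    intro x hx
    rw [← hVA x hx, ← WithZero.log_le_log (hV0 x hx) one_ne_zero]
    simp
  refine ⟨{ ord := fun x => - WithZero.log (V x)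
            ord_zero := by simp
            ord_mul := ?_
            ord_add := ?_
            ord_surj := ?_
            ord_alg := ?_ }, hord⟩
  · intro x y hx hy
    rw [map_mul, WithZero.log_mul (hV0 x hx) (hV0 y hy)]; ring
  · intro x y hx hy hxy
    have := V.map_add x y
    rcases le_max_iff.mp this with h | h
    · rw [← WithZero.log_le_log (hV0 _ hxy) (hV0 _ hx)] at h
      exact (min_le_left _ _).trans (by linarith)
    · rw [← WithZero.log_le_log (hV0 _ hxy) (hV0 _ hy)] at h
      exact (min_le_right _ _).trans (by linarith)
  · obtain ⟨π, hπ⟩ := P.valuation_exists_uniformizer K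
    refine ⟨π, ?_, ?_⟩
    · rintro rfl
      rw [map_zero] at hπ
      exact WithZero.exp_ne_zero hπ.symm
    · change - WithZero.log (P.valuation K π) = 1
      rw [hπ]; simp
  · intro c
    by_cases hc : c = 0
    · simp [hc]
    have h1 := (hord (algebraMap F K c) (by simpa using hc)).mpr (hF c)
    have h2 := (hord (algebraMap F K c)⁻¹ (by simpa using hc)).mpr (by
      rw [← map_inv₀]; exact hF _)
    rw [map_inv₀, WithZero.log_inv] at h2
    linarith

/-- Places over a given local condition: a ring `R` in which `z⁻¹` is not integral. -/
lemma exists_place_of_not_integral [GFF F K] (R : Subalgebra F K) {z : K}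
    (hz : z ∉ integralClosure R K) :
    ∃ v : Place F K, (∀ x ∈ R, 0 ≤ v.ord x) ∧ v.ord z < 0 := by
  have h1 : z ∉ (integralClosure R.toSubring K).toSubring := hz
  have hz0 : z ≠ 0 := by rintro rfl; exact hz (zero_mem _)
  have h2 := iInf_valuationSubring_superset (s := (R.toSubring : Set K)) (K := K)
  rw [Subring.closure_eq] at h2
  rw [← h2] at h1
  simp only [Subring.mem_iInf, not_forall] at h1
  obtain ⟨⟨A, hA⟩, hzA⟩ := h1
  obtain ⟨v, hv⟩ := exists_place_of_valuationSubring (F := F) A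
    (fun c => hA (R.algebraMap_mem c)) (by rintro rfl; exact hzA trivial)
  refine ⟨v, ?_, ?_⟩
  · intro x hx
    by_cases hx0 : x = 0
    · simp [hx0, v.ord_zero]
    · exact (hv x hx0).mpr (hA hx)
  · by_contra! h
    exact hzA ((hv z hz0).mp h)

lemma mem_of_integral_of_inv_mem (R : Subalgebra F K) {x : K} (h : IsIntegral R x)
    (hx : x⁻¹ ∈ R) : x ∈ R := by
  by_cases hx0 : x = 0
  · rw [hx0]; exact R.zero_mem
  obtain ⟨p, hm, hp⟩ := h
  rw [hm.as_sum] at hp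
  simp only [Polynomial.eval₂_add, Polynomial.eval₂_pow, Polynomial.eval₂_X,
    Polynomial.eval₂_finsetSum, Polynomial.eval₂_mul, Polynomial.eval₂_C] at hp
  generalize p.natDegree = n at hp
  rcases Nat.eq_zero_or_pos n with h0 | hpos
  · rw [h0] at hp; simp at hp
  have h2 : x = - ∑ i ∈ Finset.range n, (algebraMap R K) (p.coeff i) * x⁻¹ ^ (n - 1 - i) := by
    have h3 : x ^ n * x⁻¹ ^ (n - 1) = x := by
      obtain ⟨m, rfl⟩ : ∃ m, n = m + 1 := ⟨n - 1, by omega⟩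
      simp only [Nat.add_sub_cancel]
      rw [pow_succ, mul_assoc, mul_comm x, ← mul_assoc, ← mul_pow, mul_inv_cancel₀ hx0]; simp
    have h4 : ∀ i ∈ Finset.range n, (algebraMap R K) (p.coeff i) * x ^ i * x⁻¹ ^ (n - 1) =
        (algebraMap R K) (p.coeff i) * x⁻¹ ^ (n - 1 - i) := by
      intro i hi
      rw [Finset.mem_range] at hi
      have : n - 1 = i + (n - 1 - i) := by omega
      conv_lhs => rw [this, pow_add]
      rw [mul_assoc, ← mul_assoc (x ^ i), ← mul_pow, mul_inv_cancel₀ hx0]; simp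
    rw [← Finset.sum_congr rfl h4, ← Finset.sum_mul, eq_neg_iff_add_eq_zero]
    conv_lhs => enter [1]; rw [← h3]
    rw [← add_mul, hp, zero_mul]
  rw [h2]
  exact neg_mem (sum_mem fun i _ => mul_mem (p.coeff i).2 (pow_mem hx _))

/-- every transcendental element has a pole -/
lemma exists_pole [GFF F K] {x : K} (hx : Transcendental F x) :
    ∃ v : Place F K, v.ord x < 0 := by
  have hx0 : x ≠ 0 := by rintro rfl; exact hx isAlgebraic_zero
  have hni : x ∉ integralClosure (Algebra.adjoin F {x⁻¹}) K := by
    intro h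
    rw [mem_integralClosure_iff] at h
    apply hx
    have hy := mem_of_integral_of_inv_mem _ h (Algebra.subset_adjoin rfl)
    rw [Algebra.adjoin_singleton_eq_range_aeval] at hy
    obtain ⟨p, hp⟩ := hy
    have hp' : Polynomial.aeval x⁻¹ p = x := hp
    rw [← inv_inv x]
    apply IsAlgebraic.inv
    refine ⟨Polynomial.X * p - 1, ?_, ?_⟩
    · intro h0
      have := congrArg (Polynomial.eval 0) h0
      simp at this
    · simp [hp', hx0]
  obtain ⟨v, -, hv⟩ := exists_place_of_not_integral (F := F) (Algebra.adjoin F {x⁻¹}) hni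
  exact ⟨v, hv⟩

end
end NND


set_option linter.unusedSectionVars false
set_option linter.unusedVariables false

namespace NND

/-- quadratic character with values in `ZMod 2` -/
noncomputable def qc {k : Type*} [Field k] (a : k) : ZMod 2 :=
  open Classical in if IsSquare a then 0 else 1

section qc
variable {k : Type*} [Field k]

lemma qc_eq_zero {a : k} : qc a = 0 ↔ IsSquare a := by
  unfold qc; split_ifs with h <;> simp [h]

lemma qc_eq_one {a : k} : qc a = 1 ↔ ¬ IsSquare a := by
  unfold qc; split_ifs with h <;> simp [h]

lemma zmod2_cases (a : ZMod 2) : a = 0 ∨ a = 1 := by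
  revert a; decide

lemma zmod2_add_self (a : ZMod 2) : a + a = 0 := by
  revert a; decide

lemma zmod2_mul_self (a : ZMod 2) : a * a = a := by
  revert a; decide

lemma qc_mul [Finite k] {a b : k} (ha : a ≠ 0) (hb : b ≠ 0) : qc (a * b) = qc a + qc b := by
  classical
  have := Fintype.ofFinite k
  have key : ∀ c : k, c ≠ 0 → (quadraticChar k c = 1 ∧ qc c = 0 ∨ quadraticChar k c = -1 ∧ qc c = 1) := by
    intro c hc
    by_cases h : IsSquare c
    · left; exact ⟨(quadraticChar_one_iff_isSquare hc).mpr h, qc_eq_zero.mpr h⟩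
    · right
      refine ⟨?_, qc_eq_one.mpr h⟩
      rcases quadraticChar_dichotomy hc with h' | h'
      · exact absurd ((quadraticChar_one_iff_isSquare hc).mp h') h
      · exact h'
  have hab := key _ (mul_ne_zero ha hb)
  rw [map_mul] at hab
  rcases key a ha with ⟨h1, h2⟩ | ⟨h1, h2⟩ <;> rcases key b hb with ⟨h3, h4⟩ | ⟨h3, h4⟩ <;>
    rw [h1, h3] at hab <;> rw [h2, h4] <;> simp at hab <;> rw [hab] <;> decide

@[simp] lemma qc_one : qc (1 : k) = 0 := qc_eq_zero.mpr IsSquare.one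

lemma qc_norm {F : Type*} [Field F] [Finite F] [Algebra F k] [Finite k] (x : k) (hx : x ≠ 0) :
    qc (Algebra.norm F x) = qc x := by
  classical
  have := Fintype.ofFinite F
  have := Fintype.ofFinite k
  have hN : Algebra.norm F x ≠ 0 := by
    rw [Ne, Algebra.norm_eq_zero_iff]; exact hx
  suffices h : IsSquare (Algebra.norm F x) ↔ IsSquare x by
    rcases zmod2_cases (qc x) with h1 | h1
    · rw [h1, qc_eq_zero, h, ← qc_eq_zero, h1]
    · rw [h1, qc_eq_one, h, ← qc_eq_one, h1]
  constructor
  · rintro ⟨c, hc⟩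
    by_cases hk : ringChar k = 2
    · exact FiniteField.isSquare_of_char_two hk x
    rw [FiniteField.isSquare_iff hk hx]
    have hc0 : c ≠ 0 := by rintro rfl; simp at hc; exact hx hc
    have e1 := FiniteField.algebraMap_norm_eq_pow (K := F) (K' := k) (x := x)
    rw [Nat.card_eq_fintype_card, Nat.card_eq_fintype_card] at e1
    have hodd : Fintype.card F % 2 = 1 := by
      have h1 : ringChar F = ringChar k := (Algebra.ringChar_eq F k)
      exact FiniteField.odd_card_of_char_ne_two (h1 ▸ hk)
    have hkc : Fintype.card k % 2 = 1 := FiniteField.odd_card_of_char_ne_two hk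
    have hdvd : (Fintype.card F - 1) ∣ (Fintype.card k - 1) := by
      rw [Module.card_eq_pow_finrank (K := F) (V := k)]
      simpa using Nat.sub_dvd_pow_sub_pow (Fintype.card F) 1 (Module.finrank F k)
    have h2 : (algebraMap F k (Algebra.norm F x)) ^ (Fintype.card F / 2) = 1 := by
      rw [hc, ← map_pow, ← sq, ← pow_mul]
      have : 2 * (Fintype.card F / 2) = Fintype.card F - 1 := by omega
      rw [this, FiniteField.pow_card_sub_one_eq_one c hc0, map_one]
    rw [e1, ← pow_mul] at h2
    have h1F : 1 < Fintype.card F := Fintype.one_lt_card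
    obtain ⟨m, hm⟩ := hdvd
    have : (Fintype.card k - 1) / (Fintype.card F - 1) * (Fintype.card F / 2) = Fintype.card k / 2 := by
      rw [hm, Nat.mul_div_cancel_left _ (by omega)]
      have e2 : Fintype.card F - 1 = 2 * (Fintype.card F / 2) := by omega
      have e3 : Fintype.card k - 1 = 2 * (Fintype.card k / 2) := by omega
      rw [e2, e3] at hm
      have : Fintype.card k / 2 = Fintype.card F / 2 * m := by
        have := hm; rw [mul_assoc] at this; exact Nat.eq_of_mul_eq_mul_left (by norm_num) this
      rw [this, mul_comm]
    rwa [this] at h2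
  · rintro ⟨y, rfl⟩
    exact ⟨Algebra.norm F y, map_mul _ _ _⟩

end qc

namespace Place

variable {F K : Type*} [Field F] [Field K] [Algebra F K] (v : Place F K)

def ring : ValuationSubring K where
  carrier := {x | v.ge 0 x}
  mul_mem' := by
    intro a b ha hb
    simpa using v.ge_mul ha hb
  one_mem' := v.ge_one
  add_mem' := fun ha hb => v.ge_add ha hb
  zero_mem' := v.ge_zero 0
  neg_mem' := fun ha => v.ge_neg ha
  mem_or_inv_mem' := by
    intro x
    by_cases hx : x = 0
    · left; exact Or.inl hx
    · rcases le_total 0 (v.ord x) with h | h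
      · left; exact Or.inr h
      · right; right; rw [ord_inv]; omega

lemma mem_ring {x : K} : x ∈ v.ring ↔ v.ge 0 x := Iff.rfl

instance : Algebra F v.ring where
  smul c x := ⟨c • (x : K), v.ge_smul c x.2⟩
  algebraMap := (algebraMap F K).codRestrict v.ring.toSubring (fun c => v.ge_alg c)
  commutes' := fun c x => mul_comm _ _
  smul_def' := fun c x => Subtype.ext (Algebra.smul_def c (x : K))

lemma ring_smul_coe (c : F) (x : v.ring) : ((c • x : v.ring) : K) = c • (x : K) := rfl

def kap : Type _ := IsLocalRing.ResidueField v.ring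

noncomputable instance : Field v.kap := inferInstanceAs (Field (IsLocalRing.ResidueField v.ring))
noncomputable instance : Algebra F v.kap :=
  inferInstanceAs (Algebra F (IsLocalRing.ResidueField v.ring))

noncomputable def resHom : v.ring →ₐ[F] v.kap :=
  { IsLocalRing.residue v.ring with
    commutes' := fun c => rfl }

noncomputable def rs (x : K) : v.kap :=
  open Classical in if h : v.ge 0 x then v.resHom ⟨x, h⟩ else 0

lemma rs_of_ge {x : K} (h : v.ge 0 x) : v.rs x = v.resHom ⟨x, h⟩ := by
  unfold rs; rw [dif_pos h]

lemma resHom_surj : Function.Surjective v.resHom := IsLocalRing.residue_surjective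

lemma rs_surj (k : v.kap) : ∃ x : K, v.ge 0 x ∧ v.rs x = k := by
  obtain ⟨⟨x, hx⟩, h⟩ := v.resHom_surj k
  exact ⟨x, hx, by rw [v.rs_of_ge hx]; exact h⟩

lemma rs_zero : v.rs 0 = 0 := by
  rw [v.rs_of_ge (v.ge_zero 0)]; exact map_zero v.resHom

lemma rs_one : v.rs 1 = 1 := by
  rw [v.rs_of_ge v.ge_one]; exact map_one v.resHom

lemma rs_add {x y : K} (hx : v.ge 0 x) (hy : v.ge 0 y) : v.rs (x + y) = v.rs x + v.rs y := by
  rw [v.rs_of_ge hx, v.rs_of_ge hy, v.rs_of_ge (v.ge_add hx hy), ← map_add]; rfl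

lemma rs_mul {x y : K} (hx : v.ge 0 x) (hy : v.ge 0 y) : v.rs (x * y) = v.rs x * v.rs y := by
  have hxy : v.ge 0 (x * y) := by simpa using v.ge_mul hx hy
  rw [v.rs_of_ge hx, v.rs_of_ge hy, v.rs_of_ge hxy, ← map_mul]; rfl

lemma rs_smul (c : F) {x : K} (hx : v.ge 0 x) : v.rs (c • x) = c • v.rs x := by
  rw [v.rs_of_ge hx, v.rs_of_ge (v.ge_smul c hx), ← map_smul]; rfl

lemma rs_neg {x : K} (hx : v.ge 0 x) : v.rs (-x) = - v.rs x := by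
  rw [v.rs_of_ge hx, v.rs_of_ge (v.ge_neg hx), ← map_neg]; rfl

lemma rs_sub {x y : K} (hx : v.ge 0 x) (hy : v.ge 0 y) : v.rs (x - y) = v.rs x - v.rs y := by
  rw [sub_eq_add_neg, v.rs_add hx (v.ge_neg hy), v.rs_neg hy, sub_eq_add_neg]

lemma rs_pow {x : K} (hx : v.ge 0 x) (n : ℕ) : v.ge 0 (x ^ n) ∧ v.rs (x ^ n) = v.rs x ^ n := by
  induction n with
  | zero => simp [ge_one, rs_one]
  | succ n ih =>
    rw [pow_succ, pow_succ]
    exact ⟨by simpa using v.ge_mul ih.1 hx, by rw [v.rs_mul ih.1 hx, ih.2]⟩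

lemma rs_alg (c : F) : v.rs (algebraMap F K c) = algebraMap F v.kap c := by
  rw [Algebra.algebraMap_eq_smul_one, v.rs_smul c v.ge_one, v.rs_one, Algebra.algebraMap_eq_smul_one]

lemma rs_sum {ι : Type*} (s : Finset ι) (f : ι → K) (h : ∀ i ∈ s, v.ge 0 (f i)) :
    v.rs (∑ i ∈ s, f i) = ∑ i ∈ s, v.rs (f i) := by
  classical
  induction s using Finset.induction_on with
  | empty => simp [rs_zero]
  | insert a s ha ih =>
    rw [Finset.sum_insert ha, Finset.sum_insert ha, v.rs_add (h _ (by simp))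
      (v.ge_sum _ _ fun i hi => h i (by simp [hi])), ih fun i hi => h i (by simp [hi])]

lemma rs_eq_zero_iff {x : K} (hx : v.ge 0 x) : v.rs x = 0 ↔ v.ge 1 x := by
  rw [v.rs_of_ge hx]
  change IsLocalRing.residue v.ring ⟨x, hx⟩ = 0 ↔ _
  rw [IsLocalRing.residue_eq_zero_iff, IsLocalRing.mem_maximalIdeal, mem_nonunits_iff]
  by_cases h0 : x = 0
  · subst h0
    simp only [ge_zero, iff_true]
    intro hu
    exact hu.ne_zero rfl
  rw [v.ge_iff h0] at hx ⊢
  constructor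
  · intro h
    by_contra hlt
    apply h
    have : v.ge 0 x⁻¹ := Or.inr (by rw [ord_inv]; omega)
    exact IsUnit.of_mul_eq_one ⟨x⁻¹, this⟩ (Subtype.ext (by simp [h0]))
  · intro h hu
    obtain ⟨⟨y, hy⟩, hxy⟩ := hu.exists_right_inv
    have h1 : x * y = 1 := congrArg Subtype.val hxy
    have hy0 : y ≠ 0 := by rintro rfl; simp at h1
    have := v.ord_mul x y h0 hy0
    have hy' : v.ge 0 y := hy
    rw [v.ge_iff hy0] at hy'
    rw [h1, ord_one] at this
    omega

lemma rs_eq_iff {x y : K} (hx : v.ge 0 x) (hy : v.ge 0 y) : v.rs x = v.rs y ↔ v.ge 1 (x - y) := by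
  rw [← v.rs_eq_zero_iff (v.ge_sub hx hy), v.rs_sub hx hy, sub_eq_zero]

lemma rs_ne_zero {x : K} (h0 : x ≠ 0) (hx : v.ord x = 0) : v.rs x ≠ 0 := by
  rw [Ne, v.rs_eq_zero_iff (Or.inr hx.ge), v.ge_iff h0]; omega

noncomputable def pi : K := v.ord_surj.choose
lemma pi_ne : v.pi ≠ 0 := v.ord_surj.choose_spec.1
@[simp] lemma ord_pi : v.ord v.pi = 1 := v.ord_surj.choose_spec.2

lemma ord_pi_zpow (n : ℤ) : v.ord (v.pi ^ n) = n := by rw [ord_zpow]; simp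
lemma pi_zpow_ne (n : ℤ) : v.pi ^ n ≠ 0 := zpow_ne_zero _ v.pi_ne

/-- the ring as a subalgebra -/
def alg : Subalgebra F K := { v.ring.toSubring with algebraMap_mem' := v.ge_alg }

lemma transc_of_ord_ne [Finite F] {x : K} (h : v.ord x ≠ 0) : Transcendental F x :=
  fun hx => h (v.ord_isAlg hx)

lemma finite_kap_aux [Finite F] [GFF F K] : Module.Finite F v.kap := by
  let f : v.alg →ₗ[F] v.kap :=
    { toFun := fun x => v.rs x
      map_add' := fun x y => v.rs_add x.2 y.2
      map_smul' := fun c x => v.rs_smul c x.2 }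
  refine (rank_quot_le v.alg (z := v.pi) (Or.inr (by simp))
    (v.transc_of_ord_ne (by simp)) f ?_ ?_).1
  · intro k
    obtain ⟨x, hx, h⟩ := v.rs_surj k
    exact ⟨⟨x, hx⟩, h⟩
  · intro r x h
    change v.rs x = 0
    rw [v.rs_eq_zero_iff x.2, h]
    have := v.ge_mul (m := 1) (n := 0) (x := v.pi) (y := r) (Or.inr (by simp)) r.2
    simpa using this

instance [Finite F] [GFF F K] : Module.Finite F v.kap := v.finite_kap_aux
instance [Finite F] [GFF F K] : Finite v.kap := Module.finite_of_finite F

/-- leading coefficient -/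
noncomputable def lead (x : K) : v.kap := v.rs (x * v.pi ^ (- v.ord x))

lemma ord_mul_pi {x : K} (hx : x ≠ 0) : v.ord (x * v.pi ^ (- v.ord x)) = 0 := by
  rw [v.ord_mul _ _ hx (v.pi_zpow_ne _), ord_pi_zpow]; ring

lemma lead_ne {x : K} (hx : x ≠ 0) : v.lead x ≠ 0 :=
  v.rs_ne_zero (mul_ne_zero hx (v.pi_zpow_ne _)) (v.ord_mul_pi hx)

lemma lead_mul {x y : K} (hx : x ≠ 0) (hy : y ≠ 0) : v.lead (x * y) = v.lead x * v.lead y := by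
  unfold lead
  rw [← v.rs_mul (Or.inr (v.ord_mul_pi hx).ge) (Or.inr (v.ord_mul_pi hy).ge)]
  congr 1
  rw [v.ord_mul _ _ hx hy, neg_add, zpow_add₀ v.pi_ne]; ring

lemma lead_congr {x y : K} (hx : x ≠ 0) (h : v.ge (v.ord x + 1) (y - x)) :
    v.lead y = v.lead x := by
  obtain ⟨hy, ho⟩ := v.ord_eq_of_sub hx h
  unfold lead
  rw [v.rs_eq_iff (Or.inr (v.ord_mul_pi hy).ge) (Or.inr (v.ord_mul_pi hx).ge), ho, ← sub_mul]
  have := v.ge_mul h (Or.inr (le_refl _) : v.ge (v.ord (v.pi ^ (- v.ord x))) (v.pi ^ (- v.ord x)))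
  rw [ord_pi_zpow] at this
  exact v.ge_mono (by omega) this

lemma lead_of_ord_zero {x : K} (h : v.ord x = 0) : v.lead x = v.rs x := by
  unfold lead; rw [h]; simp

noncomputable def par (x : K) : ZMod 2 := (v.ord x : ZMod 2)
noncomputable def chr (x : K) : ZMod 2 := qc (v.lead x)
noncomputable def hs (a b : K) : ZMod 2 :=
  v.par a * v.chr b + v.par b * v.chr a + v.chr (-1) * (v.par a * v.par b)

lemma par_mul {x y : K} (hx : x ≠ 0) (hy : y ≠ 0) : v.par (x * y) = v.par x + v.par y := by
  unfold par; rw [v.ord_mul _ _ hx hy]; push_cast; rfl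

lemma par_congr {x y : K} (hx : x ≠ 0) (h : v.ge (v.ord x + 1) (y - x)) : v.par y = v.par x := by
  unfold par; rw [(v.ord_eq_of_sub hx h).2]

lemma chr_congr {x y : K} (hx : x ≠ 0) (h : v.ge (v.ord x + 1) (y - x)) : v.chr y = v.chr x := by
  unfold chr; rw [v.lead_congr hx h]

lemma par_one : v.par 1 = 0 := by simp [par]
lemma chr_one : v.chr 1 = 0 := by simp [chr, v.lead_of_ord_zero v.ord_one, rs_one]
lemma par_neg_one : v.par (-1) = 0 := by simp [par]

section fin
variable [Finite F] [GFF F K]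

lemma chr_mul {x y : K} (hx : x ≠ 0) (hy : y ≠ 0) : v.chr (x * y) = v.chr x + v.chr y := by
  unfold chr; rw [v.lead_mul hx hy, qc_mul (v.lead_ne hx) (v.lead_ne hy)]

lemma par_sq (x : K) : v.par (x ^ 2) = 0 := by
  by_cases hx : x = 0
  · simp [hx, par, v.ord_zero]
  · rw [pow_two, v.par_mul hx hx, zmod2_add_self]

lemma chr_sq {x : K} (hx : x ≠ 0) : v.chr (x ^ 2) = 0 := by
  rw [pow_two, v.chr_mul hx hx, zmod2_add_self]

lemma hs_comm (a b : K) : v.hs a b = v.hs b a := by unfold hs; ring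

lemma hs_mul_left {a a' : K} (b : K) (ha : a ≠ 0) (ha' : a' ≠ 0) :
    v.hs (a * a') b = v.hs a b + v.hs a' b := by
  unfold hs; rw [v.par_mul ha ha', v.chr_mul ha ha']; ring

lemma hs_mul_right {a a' : K} (b : K) (ha : a ≠ 0) (ha' : a' ≠ 0) :
    v.hs b (a * a') = v.hs b a + v.hs b a' := by
  rw [hs_comm, hs_mul_left _ _ ha ha', hs_comm, v.hs_comm b a']

/-- membership in `N_v` : both coordinates vanish -/
def Nn (x : K) : Prop := v.par x = 0 ∧ v.chr x = 0

lemma Nn_sq {x : K} (hx : x ≠ 0) : v.Nn (x ^ 2) := ⟨v.par_sq x, v.chr_sq hx⟩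

lemma hs_of_Nn {a : K} (h : v.Nn a) (b : K) : v.hs a b = 0 := by
  unfold hs; rw [h.1, h.2]; ring

lemma Nn_congr {x y : K} (hx : x ≠ 0) (h : v.ge (v.ord x + 1) (y - x)) : v.Nn y ↔ v.Nn x := by
  unfold Nn; rw [v.par_congr hx h, v.chr_congr hx h]

lemma hs_congr {x y : K} (h1 : v.par x = v.par y) (h2 : v.chr x = v.chr y) (b : K) :
    v.hs x b = v.hs y b := by
  unfold hs; rw [h1, h2]

lemma Nn_mul_iff {x y : K} (hx : x ≠ 0) (hy : y ≠ 0) :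
    v.Nn (x * y) ↔ v.par x = v.par y ∧ v.chr x = v.chr y := by
  unfold Nn; rw [v.par_mul hx hy, v.chr_mul hx hy]
  have : ∀ a b : ZMod 2, a + b = 0 ↔ a = b := by decide
  rw [this, this]

lemma Nn_mul {x y : K} (hx : x ≠ 0) (hy : y ≠ 0) (h1 : v.Nn x) (h2 : v.Nn y) : v.Nn (x * y) := by
  rw [v.Nn_mul_iff hx hy, h1.1, h1.2, h2.1, h2.2]; simp

/-- `N_v` concretely -/
lemma Nn.exists_sq {c : K} (hc : c ≠ 0) (h : v.Nn c) :
    ∃ d : K, d ≠ 0 ∧ v.ge 1 (c / d ^ 2 - 1) := by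
  obtain ⟨h1, h2⟩ := h
  unfold par at h1
  rw [ZMod.intCast_zmod_eq_zero_iff_dvd] at h1
  obtain ⟨m, hm⟩ := h1
  unfold chr at h2
  rw [qc_eq_zero] at h2
  obtain ⟨k, hk⟩ := h2
  obtain ⟨x, hx, hxk⟩ := v.rs_surj k
  have hk0 : k ≠ 0 := by
    rintro rfl
    rw [mul_zero] at hk
    exact v.lead_ne hc hk
  have hx1 : ¬ v.ge 1 x := by rwa [← v.rs_eq_zero_iff hx, hxk]
  have hx0 : x ≠ 0 := by rintro rfl; exact hx1 (v.ge_zero 1)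
  have hox : v.ord x = 0 := by
    rw [v.ge_iff hx0] at hx hx1; omega
  refine ⟨x * v.pi ^ m, mul_ne_zero hx0 (v.pi_zpow_ne _), ?_⟩
  have hu : v.ge 0 (x ^ 2)⁻¹ := Or.inr (by rw [ord_inv, ord_pow, hox]; simp)
  have e1 : c / (x * v.pi ^ m) ^ 2 - 1 = (c * v.pi ^ (- v.ord c) - x ^ 2) * (x ^ 2)⁻¹ := by
    have hp : v.pi ^ (- v.ord c) = ((v.pi ^ m) ^ 2)⁻¹ := by
      rw [zpow_neg, hm, ← zpow_natCast, ← zpow_mul]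
      congr 2
      push_cast; ring
    rw [hp]
    have := v.pi_zpow_ne m
    field_simp
  rw [e1]
  have h3 : v.ge 1 (c * v.pi ^ (- v.ord c) - x ^ 2) := by
    rw [← v.rs_eq_iff (Or.inr (v.ord_mul_pi hc).ge) (v.rs_pow hx 2).1, (v.rs_pow hx 2).2, hxk]
    change v.lead c = _
    rw [hk, pow_two]
  simpa using v.ge_mul h3 hu

lemma Nn_of_sq {c d : K} (hd : d ≠ 0) (h : v.ge 1 (c / d ^ 2 - 1)) : v.Nn c := by
  have h1 := v.Nn_congr (x := 1) (y := c / d ^ 2) one_ne_zero (by simpa using h)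
  have hcd := (v.ord_eq_of_sub (x := 1) (y := c / d ^ 2) one_ne_zero (by simpa using h)).1
  have h2 : v.Nn (c / d ^ 2) := h1.mpr ⟨v.par_one, v.chr_one⟩
  have h3 := v.Nn_mul hcd (pow_ne_zero 2 hd) h2 (v.Nn_sq hd)
  rwa [div_mul_cancel₀ _ (pow_ne_zero 2 hd)] at h3

/-- all coordinates occur -/
lemma exists_coord (h2 : (2 : F) ≠ 0) (p c : ZMod 2) : ∃ x : K, x ≠ 0 ∧ v.par x = p ∧ v.chr x = c := by
  have hch : ringChar v.kap ≠ 2 := by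
    intro h
    have : (2 : v.kap) = 0 := by
      have := ringChar.Nat.cast_ringChar (R := v.kap)
      rw [h] at this; exact_mod_cast this
    apply h2
    apply (algebraMap F v.kap).injective
    rw [map_ofNat, this, map_zero]
  obtain ⟨k, hk⟩ := FiniteField.exists_nonsquare hch
  obtain ⟨x, hx, hxk⟩ := v.rs_surj k
  have hx1 : ¬ v.ge 1 x := by
    rw [← v.rs_eq_zero_iff hx, hxk]; rintro rfl; exact hk IsSquare.zero
  have hx0 : x ≠ 0 := by rintro rfl; exact hx1 (v.ge_zero 1)
  have hox : v.ord x = 0 := by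
    rw [v.ge_iff hx0] at hx hx1; omega
  have hcx : v.chr x = 1 := by unfold chr; rw [v.lead_of_ord_zero hox, hxk]; exact qc_eq_one.mpr hk
  have hpx : v.par x = 0 := by unfold par; rw [hox]; simp
  have hpp : v.par v.pi = 1 := by unfold par; simp
  have hcp : v.chr v.pi = 0 := by
    unfold chr lead; rw [ord_pi]
    simp [v.pi_ne, rs_one]
  have hpxx : v.par (v.pi * x) = 1 := by rw [v.par_mul v.pi_ne hx0, hpp, hpx]; rfl
  have hcxx : v.chr (v.pi * x) = 1 := by rw [v.chr_mul v.pi_ne hx0, hcp, hcx]; rfl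
  rcases zmod2_cases p with rfl | rfl <;> rcases zmod2_cases c with rfl | rfl
  · exact ⟨1, one_ne_zero, v.par_one, v.chr_one⟩
  · exact ⟨x, hx0, hpx, hcx⟩
  · exact ⟨v.pi, v.pi_ne, hpp, hcp⟩
  · exact ⟨v.pi * x, mul_ne_zero v.pi_ne hx0, hpxx, hcxx⟩

/-- norms have trivial symbol -/
lemma hs_norm {a b u s : K} (ha : a ≠ 0) (hb : b ≠ 0) (h : a = u ^ 2 - b * s ^ 2) :
    v.hs a b = 0 := by
  have hneg : ∀ a, a ≠ 0 → v.par a = v.par b → v.chr a = v.chr (-1) + v.chr b → v.hs a b = 0 := by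
    intro a _ h1 h2
    unfold hs; rw [h1, h2]
    generalize v.par b = p; generalize v.chr b = q; generalize v.chr (-1) = r
    revert p q r; decide
  by_cases hs0 : s = 0
  · have hu : u ≠ 0 := by rintro rfl; simp [hs0] at h; exact ha h
    rw [h, hs0]; simp only [ne_eq, OfNat.ofNat_ne_zero, not_false_eq_true, zero_pow, mul_zero, sub_zero]
    exact v.hs_of_Nn (v.Nn_sq hu) b
  have hbs : b * s ^ 2 ≠ 0 := mul_ne_zero hb (pow_ne_zero 2 hs0)
  have hnb : v.hs (- (b * s ^ 2)) b = 0 := by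
    apply hneg _ (neg_ne_zero.mpr hbs)
    · rw [← neg_one_mul, v.par_mul (by simp) hbs, v.par_mul hb (pow_ne_zero 2 hs0), par_sq,
        par_neg_one]; ring
    · rw [← neg_one_mul, v.chr_mul (by simp) hbs, v.chr_mul hb (pow_ne_zero 2 hs0), v.chr_sq hs0]
      ring
  by_cases hu0 : u = 0
  · rw [h, hu0]; simpa using hnb
  have hu2 : u ^ 2 ≠ 0 := pow_ne_zero 2 hu0
  rcases lt_trichotomy (v.ord (u ^ 2)) (v.ord (b * s ^ 2)) with hlt | heq | hlt
  · have h3 : v.ge (v.ord (u ^ 2) + 1) (a - u ^ 2) := by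
      rw [h]; right; simp; omega
    rw [v.hs_congr (v.par_congr hu2 h3) (v.chr_congr hu2 h3)]
    exact v.hs_of_Nn (v.Nn_sq hu0) b
  · have hpb : v.par b = 0 := by
      have h1 := v.par_mul hb (pow_ne_zero 2 hs0)
      rw [par_sq, add_zero] at h1
      rw [← h1]; unfold par; rw [← heq]
      exact v.par_sq u
    rcases zmod2_cases (v.chr b) with hc | hc
    · rw [hs_comm]; exact v.hs_of_Nn ⟨hpb, hc⟩ a
    · set b1 := b * s ^ 2 / u ^ 2 with hb1
      have hb10 : b1 ≠ 0 := div_ne_zero hbs hu2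
      have hob1 : v.ord b1 = 0 := by rw [hb1, v.ord_div _ _ hbs hu2]; omega
      have hcb1 : v.chr b1 = 1 := by
        have : b1 = b * (s / u) ^ 2 := by rw [hb1]; field_simp
        rw [this, v.chr_mul hb (pow_ne_zero 2 (div_ne_zero hs0 hu0)), v.chr_sq (div_ne_zero hs0 hu0), hc]
        rfl
      have hge : v.ge 0 b1 := Or.inr hob1.ge
      have h1 : ¬ v.ge 1 (1 - b1) := by
        rw [← v.rs_eq_iff v.ge_one hge]
        intro he
        unfold chr at hcb1
        rw [v.lead_of_ord_zero hob1, ← he, rs_one, qc_one] at hcb1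
        exact absurd hcb1 (by decide)
      have hab : a = u ^ 2 * (1 - b1) := by rw [h, hb1]; field_simp
      have h10 : 1 - b1 ≠ 0 := by rintro h'; rw [h'] at h1; exact h1 (v.ge_zero 1)
      have ho : v.ord (1 - b1) = 0 := by
        have := v.ge_sub v.ge_one hge
        rw [v.ge_iff h10] at this h1; omega
      have hpa : v.par a = 0 := by
        rw [hab, v.par_mul hu2 h10, par_sq]; unfold par; rw [ho]; simp
      unfold hs; rw [hpa, hpb]; ring
  · have h3 : v.ge (v.ord (-(b * s ^ 2)) + 1) (a - -(b * s ^ 2)) := by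
      rw [h]; right; simp at hlt ⊢; omega
    rw [v.hs_congr (v.par_congr (neg_ne_zero.mpr hbs) h3) (v.chr_congr (neg_ne_zero.mpr hbs) h3)]
    exact hnb

lemma Nn_of_hs (h2 : (2 : F) ≠ 0) {a : K} (h : ∀ b : K, b ≠ 0 → v.hs a b = 0) : v.Nn a := by
  obtain ⟨x, hx, h1, h3⟩ := v.exists_coord h2 0 1
  obtain ⟨y, hy, h4, h5⟩ := v.exists_coord h2 1 0
  have e1 := h x hx
  have e2 := h y hy
  unfold hs at e1 e2
  rw [h1, h3] at e1
  rw [h4, h5] at e2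
  have hp : v.par a = 0 := by linear_combination e1
  refine ⟨hp, ?_⟩
  rw [hp] at e2
  linear_combination e2

lemma exists_hs (h2 : (2 : F) ≠ 0) {a : K} (h : ¬ v.Nn a) : ∃ b : K, b ≠ 0 ∧ v.hs a b = 1 := by
  by_contra! hc
  exact h (v.Nn_of_hs h2 fun b hb => (zmod2_cases _).resolve_right (hc b hb))

lemma hs_unit {a b : K} (ha : v.ord a = 0) (hb : v.ord b = 0) : v.hs a b = 0 := by
  unfold hs par; rw [ha, hb]; simp

end fin
end Place

/-- weak approximation for coordinates -/
lemma approx_coord {F K : Type*} [Field F] [Field K] [Algebra F K] (s : Finset (Place F K))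
    (a : Place F K → K) (ha : ∀ w ∈ s, a w ≠ 0) :
    ∃ x : K, x ≠ 0 ∧ ∀ w ∈ s, w.ord x = w.ord (a w) ∧ w.par x = w.par (a w) ∧ w.chr x = w.chr (a w) := by
  classical
  by_cases hs : s = ∅
  · exact ⟨1, one_ne_zero, by simp [hs]⟩
  obtain ⟨x, hx⟩ := Place.weak_approx s a (fun w => w.ord (a w) + 1)
  refine ⟨x, ?_, fun w hw => ⟨(w.ord_eq_of_sub (ha w hw) (hx w hw)).2,
    w.par_congr (ha w hw) (hx w hw), w.chr_congr (ha w hw) (hx w hw)⟩⟩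
  obtain ⟨w, hw⟩ := Finset.nonempty_iff_ne_empty.mpr hs
  exact (w.ord_eq_of_sub (ha w hw) (hx w hw)).1

end NND


set_option linter.unusedSectionVars false
set_option linter.unusedVariables false

namespace NND
open scoped IntermediateField

variable {F K : Type*} [Field F] [Field K] [Algebra F K]

/-- degree of a place -/
noncomputable def Place.deg (v : Place F K) : ℕ := Module.finrank F v.kap

/-- functions with bounded poles on a set of places -/
def Ms (s : Set (Place F K)) (D : Place F K → ℤ) : Submodule F K where
  carrier := {f | ∀ w ∈ s, w.ge (- D w) f}
  add_mem' := fun ha hb w hw => w.ge_add (ha w hw) (hb w hw)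
  zero_mem' := fun w _ => w.ge_zero _
  smul_mem' := fun c x hx w hw => w.ge_smul c (hx w hw)

lemma mem_Ms {s : Set (Place F K)} {D : Place F K → ℤ} {f : K} :
    f ∈ Ms s D ↔ ∀ w ∈ s, w.ge (- D w) f := Iff.rfl

lemma Ms_mono {s : Set (Place F K)} {D D' : Place F K → ℤ} (h : ∀ w ∈ s, D w ≤ D' w) :
    Ms s D ≤ Ms s D' :=
  fun f hf w hw => w.ge_mono (by have := h w hw; omega) (hf w hw)

lemma Place.ge_mul_pi (w : Place F K) {n : ℤ} {k : ℤ} {f : K} (h : w.ge (-n) f) : w.ge (k - n) (f * w.pi ^ k) := by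
  have := w.ge_mul h (n := k) (y := w.pi ^ k) (Or.inr (by rw [w.ord_pi_zpow]))
  rwa [show - n + k = k - n by ring] at this

lemma Place.ge_of_mul_pi (w : Place F K) {n : ℤ} {k : ℤ} {f : K} (h : w.ge (k - n) (f * w.pi ^ k)) :
    w.ge (-n) f := by
  rw [mul_comm, w.ge_mul_iff (w.pi_zpow_ne k), w.ord_pi_zpow] at h
  rwa [show k - n - k = - n by ring] at h

/-- leading coefficient map -/
noncomputable def stepHom (w : Place F K) (n : ℤ) (A : Submodule F K) (hA : ∀ f ∈ A, w.ge (- n) f) :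
    A →ₗ[F] w.kap where
  toFun f := w.rs (f * w.pi ^ n)
  map_add' f g := by
    have hf : w.ge 0 ((f : K) * w.pi ^ n) := by simpa using w.ge_mul_pi (k := n) (hA f f.2)
    have hg : w.ge 0 ((g : K) * w.pi ^ n) := by simpa using w.ge_mul_pi (k := n) (hA g g.2)
    rw [← w.rs_add hf hg]; push_cast; rw [add_mul]
  map_smul' c f := by
    have hf : w.ge 0 ((f : K) * w.pi ^ n) := by simpa using w.ge_mul_pi (k := n) (hA f f.2)
    simp only [RingHom.id_apply]
    rw [← w.rs_smul c hf]; push_cast; rw [smul_mul_assoc]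

lemma stepHom_eq_zero (w : Place F K) (n : ℤ) (A : Submodule F K) (hA : ∀ f ∈ A, w.ge (- n) f) (f : A) :
    stepHom w n A hA f = 0 ↔ w.ge (- (n - 1)) (f : K) := by
  have hf : w.ge 0 ((f : K) * w.pi ^ n) := by simpa using w.ge_mul_pi (k := n) (hA f f.2)
  change w.rs (f * w.pi ^ n) = 0 ↔ _
  rw [w.rs_eq_zero_iff hf]
  constructor
  · intro h
    exact w.ge_of_mul_pi (k := n) (by rwa [show n - (n - 1) = 1 by ring])
  · intro h
    simpa using w.ge_mul_pi (k := n) h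

section fin
variable [Finite F] [GFF F K]

lemma Place.deg_pos (v : Place F K) : 0 < v.deg := Module.finrank_pos

lemma Place.card_kap (v : Place F K) : Nat.card v.kap = Nat.card F ^ v.deg :=
  Module.natCard_eq_pow_finrank

/-- weak approximation: `stepHom` is onto for finite sets of places -/
lemma stepHom_surj_finset (s : Finset (Place F K)) (D : Place F K → ℤ) (w : Place F K) (hw : w ∈ s) :
    Function.Surjective (stepHom w (D w) (Ms (s : Set (Place F K)) D) (fun f hf => hf w hw)) := by
  classical
  intro k
  obtain ⟨y, hy, hk⟩ := w.rs_surj k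
  obtain ⟨x, hx⟩ := Place.weak_approx s (fun v => if v = w then y * w.pi ^ (- D w) else 0)
    (fun v => if v = w then - D w + 1 else - D v)
  have hxw := hx w hw
  simp only [if_true] at hxw
  have hyw : w.ge (- D w) (y * w.pi ^ (- D w)) := by
    simpa using w.ge_mul_pi (k := - D w) (n := 0) (by simpa using hy)
  refine ⟨⟨x, ?_⟩, ?_⟩
  · intro v hv
    by_cases h : v = w
    · subst h
      have := v.ge_add (v.ge_mono (by omega) hxw) hyw
      simpa using this
    · simpa [h] using hx v hv
  · change w.rs (x * w.pi ^ (D w)) = k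
    have hxw2 : w.ge (- D w) x := by
      have := w.ge_add (w.ge_mono (by omega) hxw) hyw
      simpa using this
    rw [← hk, w.rs_eq_iff (by simpa using w.ge_mul_pi (k := D w) hxw2) hy]
    have : x * w.pi ^ (D w) - y = (x - y * w.pi ^ (- D w)) * w.pi ^ (D w) := by
      rw [sub_mul, mul_assoc, ← zpow_add₀ w.pi_ne]; simp
    rw [this]
    have h3 := w.ge_mul_pi (k := D w) (n := D w - 1) (f := x - y * w.pi ^ (- D w))
      (by rwa [show - (D w - 1) = - D w + 1 by ring])
    rwa [show D w - (D w - 1) = 1 by ring] at h3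

lemma relIndex_step (s : Finset (Place F K)) (D : Place F K → ℤ) (w : Place F K) (hw : w ∈ s) (D' : Place F K → ℤ)
    (h1 : D' w = D w - 1) (h2 : ∀ v, v ≠ w → D' v = D v) :
    (Ms (s : Set (Place F K)) D').toAddSubgroup.relIndex (Ms (s : Set (Place F K)) D).toAddSubgroup
      = Nat.card F ^ w.deg := by
  set φ := stepHom w (D w) (Ms (s : Set (Place F K)) D) (fun f hf => hf w hw) with hφ
  have hk : (Ms (s : Set (Place F K)) D').toAddSubgroup.addSubgroupOf (Ms (s : Set (Place F K)) D).toAddSubgroup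
      = φ.toAddMonoidHom.ker := by
    ext f
    rw [AddSubgroup.mem_addSubgroupOf]
    change (f : K) ∈ Ms (s : Set (Place F K)) D' ↔ φ f = 0
    rw [hφ, stepHom_eq_zero]
    constructor
    · intro h; have := h w hw; rwa [h1] at this
    · intro h v hv
      by_cases hvw : v = w
      · subst hvw; rwa [h1]
      · rw [h2 v hvw]; exact f.2 v hv
  unfold AddSubgroup.relIndex
  rw [hk, AddSubgroup.index_ker, ← w.card_kap]
  have : φ.toAddMonoidHom.range = ⊤ := AddMonoidHom.range_eq_top.mpr (stepHom_surj_finset s D w hw)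
  rw [this]
  exact Nat.card_congr (Equiv.Set.univ _)

lemma relIndex_Ms (s : Finset (Place F K)) (E : Place F K →₀ ℕ) (hE : E.support ⊆ s) :
    (Ms (s : Set (Place F K)) (fun w => - (E w : ℤ))).toAddSubgroup.relIndex
      (Ms (s : Set (Place F K)) 0).toAddSubgroup = Nat.card F ^ (E.sum fun w n => n * w.deg) := by
  classical
  induction h : E.sum (fun w n => n) generalizing E with
  | zero =>
    have : E = 0 := by
      ext w
      by_contra hw
      have h0 := Finset.sum_eq_zero_iff.mp h w (by simpa using hw)
      exact hw h0
    subst this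
    have : (fun w : Place F K => - (((0 : Place F K →₀ ℕ) w : ℕ) : ℤ)) = 0 := by ext; simp
    rw [this]; simp
  | succ n ih =>
    have hne : E ≠ 0 := by rintro rfl; simp at h
    obtain ⟨w, hw⟩ := Finsupp.support_nonempty_iff.mpr hne
    have hw1 : 1 ≤ E w := Nat.one_le_iff_ne_zero.mpr (by simpa using hw)
    set E' := E - Finsupp.single w 1 with hE'
    have hEE : E' + Finsupp.single w 1 = E := tsub_add_cancel_of_le (by simpa using hw1)
    have hsum : E'.sum (fun w n => n) = n := by
      rw [← hEE, Finsupp.sum_add_index' (by simp) (by simp)] at h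
      simpa using h
    have hdeg : E.sum (fun w n => n * w.deg) = E'.sum (fun w n => n * w.deg) + w.deg := by
      rw [← hEE, Finsupp.sum_add_index' (by simp) (by intros; ring)]
      simp
    have hsupp : E'.support ⊆ s := by
      intro v hv
      apply hE
      rw [Finsupp.mem_support_iff] at hv ⊢
      intro h0
      apply hv
      simp [hE', h0]
    rw [hdeg, pow_add, ← ih E' hsupp hsum, mul_comm,
      ← relIndex_step s (fun w => - (E' w : ℤ)) w (hE hw) (fun w => - (E w : ℤ))]
    · symm
      apply AddSubgroup.relIndex_mul_relIndex
      · apply Ms_mono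
        intro v _
        rw [← hEE]; simp
      · apply Ms_mono
        intro v _
        simp
    · rw [← hEE]; simp; ring
    · intro v hv
      rw [← hEE]; simp [Ne.symm hv]

/-- fundamental inequality -/
lemma sum_ord_le (s : Finset (Place F K)) {x : K} (hs : ∀ w ∈ s, 0 < w.ord x) (hxt : Transcendental F x) :
    ∑ w ∈ s, (w.ord x).toNat * w.deg ≤ Module.finrank F⟮x⟯ K := by
  classical
  let R : Subalgebra F K := { Ms (s : Set (Place F K)) 0 with
    mul_mem' := by
      intro a b ha hb w hw
      simpa using w.ge_mul (ha w hw) (hb w hw)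
    algebraMap_mem' := fun c w hw => by simpa using w.ge_alg c }
  let E : Place F K →₀ ℕ := Finsupp.onFinset s (fun w => if w ∈ s then (w.ord x).toNat else 0)
    (by intro w hw; by_contra h; simp [h] at hw)
  have hEs : ∀ w ∈ s, E w = (w.ord x).toNat := by intro w hw; simp [E, hw]
  have hE : E.support ⊆ s := Finsupp.support_onFinset_subset
  let J : Submodule F R := (Ms (s : Set (Place F K)) (fun w => - (E w : ℤ))).comap R.val.toLinearMap
  have h1 := rank_quot_le R (z := x) (fun w hw => by
    right; simpa using (hs w hw).le) hxt J.mkQ J.mkQ_surjective (by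
    intro r y hy
    rw [Submodule.mkQ_apply, Submodule.Quotient.mk_eq_zero]
    change (y : K) ∈ Ms _ _
    rw [hy]
    intro w hw
    have h2 := w.ge_mul (x := x) (Or.inr le_rfl) (r.2 w hw)
    simp only [hEs w hw]
    have := hs w hw
    exact w.ge_mono (by simp; omega) h2)
  have := h1.1
  have hcard : Nat.card (R ⧸ J) = Nat.card F ^ (E.sum fun w n => n * w.deg) := by
    rw [← relIndex_Ms s E hE]
    rfl
  rw [Module.natCard_eq_pow_finrank (K := F)] at hcard
  have h3 := Nat.pow_right_injective (Finite.one_lt_card (α := F)) hcard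
  rw [Finsupp.sum_of_support_subset E hE _ (by simp)] at h3
  rw [h3] at h1
  refine le_trans (le_of_eq ?_) h1.2
  exact Finset.sum_congr rfl fun w hw => by rw [hEs w hw]

end fin
end NND


set_option linter.unusedSectionVars false
set_option linter.unusedVariables false

namespace NND
open scoped IntermediateField

variable {F K : Type*} [Field F] [Field K] [Algebra F K]

abbrev Dv (F K : Type*) [Field F] [Field K] [Algebra F K] := Place F K →₀ ℤ

noncomputable def dg : Dv F K →+ ℤ :=
  Finsupp.liftAddHom fun w => (AddMonoidHom.mulRight (w.deg : ℤ))

lemma dg_single (w : Place F K) (n : ℤ) : dg (Finsupp.single w n) = n * w.deg := by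
  simp [dg]

lemma dg_eq_sum (D : Dv F K) (s : Finset (Place F K)) (h : D.support ⊆ s) : dg D = ∑ w ∈ s, D w * w.deg := by
  rw [dg, Finsupp.liftAddHom_apply]
  rw [Finsupp.sum_of_support_subset D h _ (by simp)]
  rfl

lemma dv_induction (D : Dv F K) {P : Dv F K → Prop} (h0 : P D)
    (hs : ∀ D', D ≤ D' → ∀ w, P D' → P (D' + Finsupp.single w 1)) : ∀ D', D ≤ D' → P D' := by
  classical
  suffices H : ∀ n : ℕ, ∀ D', D ≤ D' → (D' - D).sum (fun w n => n) = n → P D' by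
    intro D' hD
    have : 0 ≤ (D' - D).sum (fun w n => n) := Finset.sum_nonneg fun w _ => by
      have := hD w; simp; omega
    obtain ⟨n, hn⟩ := Int.eq_ofNat_of_zero_le this
    exact H n D' hD hn
  intro n
  induction n with
  | zero =>
    intro D' hD h
    have hz : D' - D = 0 := by
      ext w
      by_contra hw
      have := (Finset.sum_eq_zero_iff_of_nonneg (fun w _ => by have := hD w; simp; omega)).mp h w (by simpa using hw)
      exact hw (by simpa using this)
    rw [sub_eq_zero] at hz
    rwa [hz]
  | succ n ih =>
    intro D' hD h
    have hne : D' - D ≠ 0 := by intro h0; rw [h0] at h; simp at h; omega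
    obtain ⟨w, hw⟩ := Finsupp.support_nonempty_iff.mpr hne
    have hw1 : D w < D' w := by
      have := hD w
      have h2 : D' w - D w ≠ 0 := by simpa using hw
      omega
    have hle : D ≤ D' - Finsupp.single w 1 := by
      intro v
      by_cases hv : w = v
      · subst hv; simp; omega
      · have := hD v; simpa [Finsupp.single_apply, hv] using this
    have := hs (D' - Finsupp.single w 1) hle w (ih _ hle ?_)
    · simpa using this
    · have e : D' - D = (D' - Finsupp.single w 1 - D) + Finsupp.single w 1 := by abel
      rw [e, Finsupp.sum_add_index' (by simp) (by simp)] at h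
      simp at h ⊢; omega

lemma dg_nonneg {D : Dv F K} (h : 0 ≤ D) : 0 ≤ dg D := by
  rw [dg_eq_sum D _ subset_rfl]
  exact Finset.sum_nonneg fun w _ => mul_nonneg (h w) (by simp)

lemma dg_mono {D D' : Dv F K} (h : D ≤ D') : dg D ≤ dg D' := by
  have := dg_nonneg (sub_nonneg.mpr h)
  rw [map_sub] at this; omega

/-- Riemann-Roch space -/
def Lsp (D : Dv F K) : Submodule F K := Ms Set.univ D
noncomputable def ell (D : Dv F K) : ℕ := Module.finrank F (Lsp D)

lemma mem_Lsp {D : Dv F K} {f : K} : f ∈ Lsp D ↔ ∀ w : Place F K, w.ge (- D w) f := by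
  simp [Lsp, mem_Ms]

lemma Lsp_mono {D D' : Dv F K} (h : D ≤ D') : Lsp D ≤ Lsp D' := Ms_mono fun w _ => h w

section fin
variable [Finite F] [GFF F K]

lemma finite_zeros {x : K} (hx : Transcendental F x) : {w : Place F K | 0 < w.ord x}.Finite := by
  by_contra h
  obtain ⟨s, hs, hc⟩ := Set.Infinite.exists_subset_card_eq h (Module.finrank F⟮x⟯ K + 1)
  have h1 := sum_ord_le s (x := x) (fun w hw => hs hw) hx
  have h2 : ∑ w ∈ s, 1 ≤ ∑ w ∈ s, (w.ord x).toNat * w.deg := Finset.sum_le_sum fun w hw => by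
    have : 0 < w.ord x := hs hw
    exact Nat.mul_pos (by omega) w.deg_pos
  simp at h2; omega

lemma transc_inv {x : K} (hx : Transcendental F x) : Transcendental F x⁻¹ := by
  intro h; apply hx; simpa using h.inv

lemma finite_supp (F : Type*) {K : Type*} [Field F] [Field K] [Algebra F K] [Finite F] [GFF F K] (x : K) :
    (Function.support fun w : Place F K => w.ord x).Finite := by
  by_cases hx : Transcendental F x
  · apply ((finite_zeros hx).union (finite_zeros (transc_inv hx))).subset
    intro w hw
    have : w.ord x ≠ 0 := hw
    rcases lt_or_gt_of_ne this with h | h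
    · right; simp [Place.ord_inv]; exact h
    · left; exact h
  · apply Set.Finite.subset Set.finite_empty
    intro w hw
    exact absurd (w.ord_isAlg (not_not.mp hx)) hw

/-- principal divisor -/
noncomputable def dv (F : Type*) {K : Type*} [Field F] [Field K] [Algebra F K] [Finite F] [GFF F K] (x : K) : Dv F K :=
  Finsupp.ofSupportFinite _ (finite_supp F x)

@[simp] lemma dv_apply (x : K) (w : Place F K) : dv F x w = w.ord x := rfl

lemma dv_mul {x y : K} (hx : x ≠ 0) (hy : y ≠ 0) : dv F (x * y) = dv F x + dv F y := by
  ext w; simp [w.ord_mul x y hx hy]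

lemma dv_inv (x : K) : dv F (x⁻¹) = - dv F x := by
  ext w; simp [w.ord_inv]

lemma mem_Lsp_iff {D : Dv F K} {f : K} (hf : f ≠ 0) : f ∈ Lsp D ↔ 0 ≤ D + dv F f := by
  rw [mem_Lsp]
  constructor
  · intro h w
    have := (w.ge_iff hf).mp (h w)
    simp; omega
  · intro h w
    have := h w
    rw [w.ge_iff hf]
    simp at this; omega

lemma isAlg_of_ord_nonneg {x : K} (h : ∀ w : Place F K, 0 ≤ w.ord x) : IsAlgebraic F x := by
  by_contra hx
  obtain ⟨v, hv⟩ := exists_pole hx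
  exact absurd (h v) (by omega)

variable (F K) in
lemma exists_place : Nonempty (Place F K) := by
  obtain ⟨x, hx⟩ := GFF.exists_transc F K
  obtain ⟨v, hv⟩ := exists_pole hx
  exact ⟨v⟩

noncomputable def lstep (D : Dv F K) (w : Place F K) : Lsp (D + Finsupp.single w 1) →ₗ[F] w.kap :=
  stepHom w (D w + 1) _ (fun f hf => by
    have := mem_Lsp.mp hf w
    simpa using this)

lemma lstep_eq_zero (D : Dv F K) (w : Place F K) (f : Lsp (D + Finsupp.single w 1)) :
    lstep D w f = 0 ↔ (f : K) ∈ Lsp D := by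
  classical
  rw [lstep, stepHom_eq_zero, mem_Lsp]
  constructor
  · intro h v
    by_cases hv : w = v
    · subst hv; simpa using h
    · have := mem_Lsp.mp f.2 v
      simpa [Finsupp.single_apply, hv] using this
  · intro h; simpa using h w

lemma le_add_single (D : Dv F K) (w : Place F K) : D ≤ D + Finsupp.single w 1 := by
  classical
  intro v; simp only [Finsupp.add_apply, Finsupp.single_apply]; split_ifs <;> simp

lemma lstep_ker (D : Dv F K) (w : Place F K) :
    LinearMap.ker (lstep D w) = (Lsp D).comap (Lsp (D + Finsupp.single w 1)).subtype := by
  ext f; simp [lstep_eq_zero]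

noncomputable def lstepKerEquiv (D : Dv F K) (w : Place F K) : LinearMap.ker (lstep D w) ≃ₗ[F] Lsp D :=
  (LinearEquiv.ofEq _ _ (lstep_ker D w)).trans
    (Submodule.comapSubtypeEquivOfLe (Lsp_mono (le_add_single D w)))

lemma fin_step (D : Dv F K) (w : Place F K) (h : Module.Finite F (Lsp D)) :
    Module.Finite F (Lsp (D + Finsupp.single w 1)) := by
  have h1 : Module.Finite F (LinearMap.ker (lstep D w)) := Module.Finite.equiv (lstepKerEquiv D w).symm
  have h2 : Module.Finite F (LinearMap.range (lstep D w)) := inferInstance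
  have h3 : Module.Finite F (Lsp (D + Finsupp.single w 1) ⧸ LinearMap.ker (lstep D w)) :=
    Module.Finite.equiv (lstep D w).quotKerEquivRange.symm
  exact Module.Finite.of_submodule_quotient (LinearMap.ker (lstep D w))

instance finite_Lsp (D : Dv F K) : Module.Finite F (Lsp D) := by
  classical
  obtain ⟨w⟩ := exists_place F K
  have h0 : Module.Finite F (Lsp (- Finsupp.single w 1 : Dv F K)) := by
    have : Lsp (- Finsupp.single w 1 : Dv F K) = ⊥ := by
      rw [eq_bot_iff]
      intro f hf
      by_contra hf0
      have hf0 : f ≠ 0 := hf0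
      rw [mem_Lsp_iff hf0] at hf
      have h1 : IsAlgebraic F f := isAlg_of_ord_nonneg fun v => by
        have := hf v
        simp [Finsupp.single_apply] at this
        split_ifs at this <;> omega
      have := hf w
      simp [w.ord_isAlg h1] at this
    rw [this]; infer_instance
  have := dv_induction (- Finsupp.single w 1 : Dv F K) (P := fun D => Module.Finite F (Lsp D)) h0
    (fun D' _ w h => fin_step D' w h) (D ⊔ (- Finsupp.single w 1)) le_sup_right
  exact Submodule.finiteDimensional_of_le (Lsp_mono (le_sup_left (b := (- Finsupp.single w 1 : Dv F K))))

lemma ell_step (D : Dv F K) (w : Place F K) : ell (D + Finsupp.single w 1) ≤ ell D + w.deg := by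
  have h1 := LinearMap.finrank_range_add_finrank_ker (lstep D w)
  have h2 : Module.finrank F (LinearMap.ker (lstep D w)) = ell D := (lstepKerEquiv D w).finrank_eq
  have h3 : Module.finrank F (LinearMap.range (lstep D w)) ≤ w.deg := Submodule.finrank_le _
  unfold ell at *; omega

lemma lstep_surj (D : Dv F K) (w : Place F K) (h : ell (D + Finsupp.single w 1) = ell D + w.deg) :
    Function.Surjective (lstep D w) := by
  have h1 := LinearMap.finrank_range_add_finrank_ker (lstep D w)
  have h2 : Module.finrank F (LinearMap.ker (lstep D w)) = ell D := (lstepKerEquiv D w).finrank_eq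
  rw [← LinearMap.range_eq_top]
  apply Submodule.eq_top_of_finrank_eq
  unfold ell at *
  change _ = w.deg
  omega

lemma ell_le (D D' : Dv F K) (h : D ≤ D') : (ell D' : ℤ) - dg D' ≤ ell D - dg D := by
  refine dv_induction D (P := fun D' => (ell D' : ℤ) - dg D' ≤ ell D - dg D) le_rfl ?_ D' h
  intro D' _ w hD
  have := ell_step D' w
  rw [map_add, dg_single]
  omega

/-- multiplication by a function -/
noncomputable def mulEquiv {f : K} (hf : f ≠ 0) {D D' : Dv F K} (h : D' + dv F f = D) : Lsp D ≃ₗ[F] Lsp D' where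
  toFun x := ⟨f * x, mem_Lsp.mpr fun w => by
    rw [w.ge_mul_iff hf]
    have := mem_Lsp.mp x.2 w
    have h2 := DFunLike.congr_fun h w
    simp only [Finsupp.add_apply, dv_apply] at h2
    rwa [show - D' w - w.ord f = - D w by omega]⟩
  map_add' x y := Subtype.ext (by simp [mul_add])
  map_smul' c x := Subtype.ext (by simp)
  invFun x := ⟨f⁻¹ * x, mem_Lsp.mpr fun w => by
    rw [w.ge_mul_iff (inv_ne_zero hf), w.ord_inv]
    have := mem_Lsp.mp x.2 w
    have h2 := DFunLike.congr_fun h w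
    simp only [Finsupp.add_apply, dv_apply] at h2
    rwa [show - D w - - w.ord f = - D' w by omega]⟩
  left_inv x := Subtype.ext (by simp [hf])
  right_inv x := Subtype.ext (by simp [hf])

@[simp] lemma mulEquiv_coe {f : K} (hf : f ≠ 0) {D D' : Dv F K} (h : D' + dv F f = D) (x : Lsp D) :
    (mulEquiv hf h x : K) = f * x := rfl

lemma ell_add_dv {f : K} (hf : f ≠ 0) (D : Dv F K) : ell (D + dv F f) = ell D :=
  (mulEquiv hf (D := D + dv F f) (D' := D) rfl).finrank_eq

end fin
end NND


set_option linter.unusedSectionVars false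
set_option linter.unusedVariables false

namespace NND
open scoped IntermediateField

variable {F K : Type*} [Field F] [Field K] [Algebra F K]

lemma pow_indep {x : K} (hx : Transcendental F x) : LinearIndependent F (fun j : ℕ => x ^ j) := by
  have h := (Polynomial.basisMonomials F).linearIndependent.map' (Polynomial.aeval x).toLinearMap
    (LinearMap.ker_eq_bot.mpr (transcendental_iff_injective.mp hx))
  have e : (fun j : ℕ => x ^ j) = (Polynomial.aeval x).toLinearMap ∘ (Polynomial.basisMonomials F) := by
    ext j; simp
  rw [e]; exact h

lemma adjoin_inv_eq (x : K) : F⟮x⁻¹⟯ = F⟮x⟯ := by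
  apply le_antisymm
  · rw [IntermediateField.adjoin_simple_le_iff]
    exact inv_mem (IntermediateField.mem_adjoin_simple_self F x)
  · rw [IntermediateField.adjoin_simple_le_iff]
    have := inv_mem (IntermediateField.mem_adjoin_simple_self F x⁻¹)
    rwa [inv_inv] at this

section fin
variable [Finite F] [GFF F K]

noncomputable def zdv (F : Type*) {K : Type*} [Field F] [Field K] [Algebra F K] [Finite F] [GFF F K] (x : K) :
    Dv F K := dv F x ⊔ 0

lemma zdv_apply (x : K) (w : Place F K) : zdv F x w = max (w.ord x) 0 := by simp [zdv]

lemma zdv_nonneg (x : K) : 0 ≤ zdv F x := le_sup_right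

lemma dv_eq (x : K) : dv F x = zdv F x - zdv F x⁻¹ := by
  ext w; simp [zdv_apply, Place.ord_inv]

lemma dg_zdv_le {x : K} (hx : Transcendental F x) : dg (zdv F x) ≤ Module.finrank F⟮x⟯ K := by
  classical
  have h := sum_ord_le ((zdv F x).support) (x := x) (by
    intro w hw
    have : zdv F x w ≠ 0 := by simpa using hw
    rw [zdv_apply] at this
    omega) hx
  rw [dg_eq_sum _ _ subset_rfl]
  calc _ = ((∑ w ∈ (zdv F x).support, (w.ord x).toNat * w.deg : ℕ) : ℤ) := by
        push_cast
        refine Finset.sum_congr rfl fun w hw => ?_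
        rw [zdv_apply]; simp
    _ ≤ _ := by exact_mod_cast h

/-- key count -/
lemma exists_ell_ge {x : K} (hx : Transcendental F x) : ∃ D0 : Dv F K, 0 ≤ D0 ∧
    ∀ m : ℕ, Module.finrank F⟮x⟯ K * (m + 1) ≤ ell (m • zdv F x⁻¹ + D0) := by
  have := GFF.finite_adjoin hx
  let b := Module.finBasis F⟮x⟯ K
  refine ⟨∑ i, zdv F (b i)⁻¹, Finset.sum_nonneg fun i _ => zdv_nonneg _, fun m => ?_⟩
  set D := m • zdv F x⁻¹ + ∑ i, zdv F (b i)⁻¹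
  have hx0 : x ≠ 0 := by rintro rfl; exact hx isAlgebraic_zero
  let g : F⟮x⟯ := ⟨x, IntermediateField.mem_adjoin_simple_self F x⟩
  have hg : Transcendental F g := by
    intro h; exact hx (h.algebraMap (A := K))
  have hli := linearIndependent_smul ((pow_indep hg).comp (fun j : Fin (m + 1) => (j : ℕ)) Fin.val_injective)
    b.linearIndependent
  have hmem : ∀ p : Fin (m + 1) × Fin (Module.finrank F⟮x⟯ K),
      (((fun j : ℕ => g ^ j) ∘ fun j : Fin (m + 1) => (j : ℕ)) p.1 • b p.2 : K) ∈ Lsp D := by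
    rintro ⟨j, i⟩
    have e : (((fun j : ℕ => g ^ j) ∘ fun j : Fin (m + 1) => (j : ℕ)) j • b i : K) = x ^ (j : ℕ) * b i := by
      rw [Algebra.smul_def]; rfl
    rw [e]
    have hb : b i ≠ 0 := b.ne_zero i
    rw [mem_Lsp_iff (mul_ne_zero (pow_ne_zero _ hx0) hb)]
    intro w
    have h1 : zdv F (b i)⁻¹ w ≤ (∑ i, zdv F (b i)⁻¹) w := by
      rw [Finsupp.finsetSum_apply]
      exact Finset.single_le_sum (f := fun i => zdv F (b i)⁻¹ w) (fun i _ => zdv_nonneg _ w) (Finset.mem_univ i)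
    simp only [D, Finsupp.add_apply, dv_apply, Finsupp.smul_apply, Finsupp.zero_apply]
    rw [w.ord_mul _ _ (pow_ne_zero _ hx0) hb, w.ord_pow]
    rw [zdv_apply, w.ord_inv] at h1
    rw [zdv_apply, w.ord_inv]
    have h2 : 0 ≤ (m : ℤ) * max (- w.ord x) 0 + (j : ℕ) * w.ord x := by
      have hj : ((j : ℕ) : ℤ) ≤ m := by have := j.2; omega
      have h3 : - w.ord x ≤ max (- w.ord x) 0 := le_max_left _ _
      have h4 : 0 ≤ max (- w.ord x) 0 := le_max_right _ _
      nlinarith [mul_le_mul_of_nonneg_right hj h4, mul_le_mul_of_nonneg_left h3 (show (0 : ℤ) ≤ ((j : ℕ) : ℤ) by omega)]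
    simp only [nsmul_eq_mul]
    have h5 := le_max_left (- w.ord (b i)) 0
    linarith
  have h2 : LinearIndependent F (fun p => (⟨_, hmem p⟩ : Lsp D)) :=
    LinearIndependent.of_comp (Lsp D).subtype hli
  have := h2.fintype_card_le_finrank
  simp only [Fintype.card_prod, Fintype.card_fin] at this
  rw [mul_comm]; exact this

lemma dg_zdv_inv {x : K} (hx : Transcendental F x) : dg (zdv F x⁻¹) = Module.finrank F⟮x⟯ K := by
  apply le_antisymm
  · have := dg_zdv_le (transc_inv hx)
    rwa [adjoin_inv_eq] at this
  · obtain ⟨D0, hD0, h⟩ := exists_ell_ge hx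
    by_contra hlt
    push Not at hlt
    set n : ℤ := (Module.finrank F⟮x⟯ K : ℤ) with hnn
    have key : ∀ m : ℕ, n * (m + 1) ≤ m * dg (zdv F x⁻¹) + ell D0 := by
      intro m
      have h1 := ell_le D0 (m • zdv F x⁻¹ + D0) (le_add_of_nonneg_left (nsmul_nonneg (zdv_nonneg _) m))
      have h2 : n * (m + 1) ≤ ell (m • zdv F x⁻¹ + D0) := by rw [hnn]; exact_mod_cast h m
      rw [map_add, map_nsmul, nsmul_eq_mul] at h1
      linarith
    have h3 := key (ell D0)
    have hn : 0 < n := by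
      have := GFF.finite_adjoin hx
      have : 0 < Module.finrank F⟮x⟯ K := Module.finrank_pos
      omega
    nlinarith

lemma dg_dv {x : K} (hx0 : x ≠ 0) : dg (dv F x) = 0 := by
  by_cases hx : Transcendental F x
  · have h1 := dg_zdv_inv hx
    have h2 := dg_zdv_inv (transc_inv hx)
    rw [adjoin_inv_eq, inv_inv] at h2
    rw [dv_eq, map_sub, h1, h2]; ring
  · have : dv F x = 0 := by
      ext w; exact w.ord_isAlg (not_not.mp hx)
    rw [this, map_zero]

lemma ell_pos_iff {D : Dv F K} : 0 < ell D ↔ ∃ f : K, f ≠ 0 ∧ 0 ≤ D + dv F f := by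
  unfold ell
  rw [Module.finrank_pos_iff_exists_ne_zero]
  constructor
  · rintro ⟨f, hf⟩
    have hf' : (f : K) ≠ 0 := by simpa using hf
    exact ⟨f, hf', (mem_Lsp_iff hf').mp f.2⟩
  · rintro ⟨f, hf, h⟩
    exact ⟨⟨f, (mem_Lsp_iff hf).mpr h⟩, by simpa using hf⟩

/-- Riemann's inequality -/
lemma riemann_bound (F K : Type*) [Field F] [Field K] [Algebra F K] [Finite F] [GFF F K] :
    ∃ c : ℤ, ∀ G : Dv F K, - c ≤ ell G - dg G := by
  obtain ⟨x, hx⟩ := GFF.exists_transc F K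
  obtain ⟨D0, hD0, h⟩ := exists_ell_ge hx
  have hX := dg_zdv_inv hx
  set n := Module.finrank F⟮x⟯ K
  have hn : 0 < n := by
    have := GFF.finite_adjoin hx
    exact Module.finrank_pos
  refine ⟨dg D0, fun G => ?_⟩
  have hG : 0 ≤ G ⊔ 0 := le_sup_right
  obtain ⟨m, hm⟩ : ∃ m : ℕ, 0 < ell (m • zdv F x⁻¹ + D0 - (G ⊔ 0)) := by
    refine ⟨(dg (G ⊔ 0)).toNat, ?_⟩
    set m := (dg (G ⊔ 0)).toNat
    have h1 := ell_le (m • zdv F x⁻¹ + D0 - (G ⊔ 0)) (m • zdv F x⁻¹ + D0) (sub_le_self _ hG)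
    have h2 : (n : ℤ) * (m + 1) ≤ ell (m • zdv F x⁻¹ + D0) := by exact_mod_cast h m
    have h3 : dg (G ⊔ 0) ≤ m := Int.self_le_toNat _
    rw [map_sub] at h1
    have : (0 : ℤ) < ell (m • zdv F x⁻¹ + D0 - (G ⊔ 0)) := by nlinarith
    exact_mod_cast this
  obtain ⟨f, hf, hfG⟩ := ell_pos_iff.mp hm
  have h1 : G ≤ (m • zdv F x⁻¹ + D0) + dv F f := by
    refine le_trans (le_sup_left (b := 0)) ?_
    rw [← sub_nonneg]
    refine le_of_le_of_eq hfG ?_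
    abel
  have h2 := ell_le _ _ h1
  rw [ell_add_dv hf, map_add, dg_dv hf] at h2
  have h3 : (n : ℤ) * (m + 1) ≤ ell (m • zdv F x⁻¹ + D0) := by exact_mod_cast h m
  rw [map_add, map_nsmul, hX, nsmul_eq_mul] at h2
  nlinarith

/-- Riemann's theorem -/
lemma riemann (F K : Type*) [Field F] [Field K] [Algebra F K] [Finite F] [GFF F K] :
    ∃ N : ℤ, ∀ G : Dv F K, N ≤ dg G → 0 < ell G ∧ ∀ w, Function.Surjective (lstep G w) := by
  obtain ⟨c, hc⟩ := riemann_bound F K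
  obtain ⟨r, ⟨G0, hr⟩, hmin⟩ := Int.exists_least_of_bdd (P := fun r : ℤ => ∃ G : Dv F K, (ell G : ℤ) - dg G = r)
    ⟨- c, by rintro z ⟨G, rfl⟩; exact hc G⟩ ⟨_, 0, rfl⟩
  have hbig : ∀ G : Dv F K, dg G0 + c + 1 ≤ dg G → (ell G : ℤ) - dg G = r := by
    intro G hG
    have h1 : 0 < ell (G - G0) := by
      have := hc (G - G0)
      rw [map_sub] at this
      omega
    obtain ⟨f, hf, hfG⟩ := ell_pos_iff.mp h1
    have h2 := ell_le G0 (G + dv F f) (by rw [← sub_nonneg]; refine le_of_le_of_eq hfG ?_; abel)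
    rw [ell_add_dv hf, map_add, dg_dv hf] at h2
    have := hmin _ ⟨G, rfl⟩
    omega
  refine ⟨max (dg G0 + c + 1) (c + 1), fun G hG => ⟨?_, fun w => ?_⟩⟩
  · have := hc G
    have h2 := le_max_right (dg G0 + c + 1) (c + 1)
    omega
  · have h2 := le_max_left (dg G0 + c + 1) (c + 1)
    apply lstep_surj
    have h3 := hbig G (by omega)
    have h4 := dg_mono (le_add_single G w)
    have h5 := hbig (G + Finsupp.single w 1) (by omega)
    rw [map_add, dg_single] at h5
    omega

/-- finitely many places of bounded degree -/
lemma finite_deg (F K : Type*) [Field F] [Field K] [Algebra F K] [Finite F] [GFF F K] (B : ℕ) :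
    {w : Place F K | w.deg ≤ B}.Finite := by
  obtain ⟨x, hx⟩ := GFF.exists_transc F K
  have hfin : (⋃ d ∈ Finset.range (B + 1), (Function.support fun w : Place F K => w.ord (x ^ (Nat.card F ^ d) - x))).Finite :=
    Set.Finite.biUnion (Finset.finite_toSet _) fun d _ => finite_supp F _
  apply ((finite_supp F x).union hfin).subset
  intro w hw
  by_cases h0 : w.ord x = 0
  · right
    simp only [Set.mem_iUnion]
    refine ⟨w.deg, by have : w.deg ≤ B := hw; simp; omega, ?_⟩
    have hge : w.ge 0 x := Or.inr h0.ge
    have hcard := w.card_kap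
    have := Fintype.ofFinite w.kap
    have h1 : w.ge 1 (x ^ (Nat.card F ^ w.deg) - x) := by
      rw [← w.rs_eq_iff (w.rs_pow hge _).1 hge, (w.rs_pow hge _).2, ← hcard, Nat.card_eq_fintype_card,
        FiniteField.pow_card]
    have h2 : x ^ (Nat.card F ^ w.deg) - x ≠ 0 := by
      intro h
      apply hx
      refine ⟨Polynomial.X ^ (Nat.card F ^ w.deg) - Polynomial.X, ?_, by simpa using h⟩
      apply Polynomial.Monic.ne_zero
      apply Polynomial.monic_X_pow_sub
      rw [Polynomial.degree_X]
      exact_mod_cast Nat.one_lt_pow w.deg_pos.ne' Finite.one_lt_card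
    rw [w.ge_iff h2] at h1
    have : w.ord (x ^ (Nat.card F ^ w.deg) - x) ≠ 0 := by omega
    exact this
  · left; exact h0

/-- S-class group trivial -/
lemma spid (F K : Type*) [Field F] [Field K] [Algebra F K] [Finite F] [GFF F K] :
    ∃ S0 : Finset (Place F K), S0.Nonempty ∧ ∀ S : Finset (Place F K), S0 ⊆ S →
      ∀ D : Dv F K, ∃ r : K, r ≠ 0 ∧ ∀ w, w ∉ S → w.ord r = D w := by
  classical
  obtain ⟨N, hN⟩ := riemann F K
  obtain ⟨v0⟩ := exists_place F K
  refine ⟨(finite_deg F K (N + v0.deg).toNat).toFinset ∪ {v0}, ⟨v0, by simp⟩, fun S hS D => ?_⟩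
  have hd : (0 : ℤ) < v0.deg := by exact_mod_cast v0.deg_pos
  obtain ⟨k, hk1, hk2⟩ : ∃ k : ℤ, N ≤ dg (- D + Finsupp.single v0 k) ∧
      dg (- D + Finsupp.single v0 k) < N + v0.deg := by
    refine ⟨(N + dg D + v0.deg - 1) / v0.deg, ?_, ?_⟩ <;> rw [map_add, map_neg, dg_single]
    · have h1 := Int.emod_add_mul_ediv (N + dg D + v0.deg - 1) v0.deg
      have h2 := Int.emod_lt_of_pos (N + dg D + v0.deg - 1) hd
      linarith
    · have h1 := Int.emod_add_mul_ediv (N + dg D + v0.deg - 1) v0.deg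
      have h2 := Int.emod_nonneg (N + dg D + v0.deg - 1) hd.ne'
      linarith
  obtain ⟨f, hf, hfG⟩ := ell_pos_iff.mp (hN _ hk1).1
  refine ⟨f, hf, fun w hw => ?_⟩
  have hwS : w ∉ (finite_deg F K (N + v0.deg).toNat).toFinset ∪ {v0} := fun h => hw (hS h)
  simp only [Finset.mem_union, Set.Finite.mem_toFinset, Set.mem_ofPred_eq, Finset.mem_singleton, not_or, not_le] at hwS
  have h0 := hfG w
  have e : (- D + Finsupp.single v0 k + dv F f) w = - D w + w.ord f := by
    simp [Ne.symm hwS.2]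
  rw [e] at h0
  by_contra hne
  have h1 : Finsupp.single w 1 ≤ - D + Finsupp.single v0 k + dv F f := by
    intro v
    by_cases hv : w = v
    · subst hv
      rw [e]; simp
      have : (0 : Dv F K) w = 0 := rfl
      omega
    · rw [Finsupp.single_apply, if_neg hv]; exact hfG v
  have h2 := dg_mono h1
  rw [map_add, dg_dv hf, dg_single] at h2
  omega

end fin
end NND


set_option linter.unusedSectionVars false
set_option linter.unusedVariables false

namespace NND
open scoped IntermediateField

variable {F K : Type*} [Field F] [Field K] [Algebra F K]

/-- `S`-units -/
def SU (S : Finset (Place F K)) : Subgroup Kˣ where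
  carrier := {u | ∀ w, w ∉ S → w.ord u = 0}
  mul_mem' := fun {a b} ha hb w hw => by
    push_cast; rw [w.ord_mul _ _ a.ne_zero b.ne_zero, ha w hw, hb w hw]; rfl
  one_mem' := fun w _ => by simp
  inv_mem' := fun {a} ha w hw => by
    push_cast; rw [w.ord_inv, ha w hw]; rfl

lemma mem_SU {S : Finset (Place F K)} {u : Kˣ} : u ∈ SU S ↔ ∀ w, w ∉ S → w.ord (u : K) = 0 := Iff.rfl

lemma SU_mono {S S' : Finset (Place F K)} (h : S ⊆ S') : SU S ≤ SU S' :=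
  fun u hu w hw => hu w fun h' => hw (h h')

/-- squares of `S`-units -/
def SU2 (S : Finset (Place F K)) : Subgroup Kˣ := (SU S).map (powMonoidHom 2)

lemma mem_SU2 {S : Finset (Place F K)} {u : Kˣ} : u ∈ SU2 S ↔ ∃ t ∈ SU S, t ^ 2 = u := Iff.rfl

lemma SU2_le (S : Finset (Place F K)) : SU2 S ≤ SU S := by
  rintro _ ⟨t, ht, rfl⟩
  exact pow_mem ht 2

def ordHom (S : Finset (Place F K)) : Kˣ →* Multiplicative (S → ℤ) where
  toFun u := Multiplicative.ofAdd fun w => w.1.ord (u : K)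
  map_one' := by
    rw [← ofAdd_zero]; congr 1; ext w; simp
  map_mul' a b := by
    rw [← ofAdd_add]; congr 1; ext w
    simp [w.1.ord_mul _ _ a.ne_zero b.ne_zero]

noncomputable def degLin (S : Finset (Place F K)) : (S → ℤ) →ₗ[ℤ] ℤ where
  toFun D := ∑ w : S, D w * w.1.deg
  map_add' a b := by simp [add_mul, Finset.sum_add_distrib]
  map_smul' c a := by simp [Finset.mul_sum, mul_assoc]

section fin
variable [Finite F] [GFF F K]

lemma finite_eff (m : ℤ) : {E : Dv F K | 0 ≤ E ∧ dg E ≤ m}.Finite := by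
  classical
  apply ((finite_deg F K m.toNat).toFinset.finsupp (fun _ => Finset.Icc 0 m)).finite_toSet.subset
  rintro E ⟨hE, hd⟩
  have key : ∀ w, E w * w.deg ≤ m := by
    intro w
    have h1 : Finsupp.single w (E w) ≤ E := by
      intro v
      rw [Finsupp.single_apply]; split_ifs with h
      · rw [h]
      · exact hE v
    have := dg_mono h1
    rw [dg_single] at this
    omega
  rw [Finset.mem_coe, Finset.mem_finsupp_iff]
  constructor
  · intro w hw
    have h1 : E w ≠ 0 := by simpa using hw
    have h2 : 0 ≤ E w := hE w
    have := key w
    simp only [Set.Finite.mem_toFinset, Set.mem_ofPred_eq]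
    have h3 : 1 ≤ E w := by omega
    have : (w.deg : ℤ) ≤ m := by nlinarith
    omega
  · intro w _
    have h2 : 0 ≤ E w := hE w
    have := key w
    have h3 : (0 : ℤ) < w.deg := by exact_mod_cast w.deg_pos
    simp only [Finset.mem_Icc]
    exact ⟨h2, by nlinarith⟩

/-- the lattice of divisors of `S`-units -/
def lat (S : Finset (Place F K)) : AddSubgroup (S → ℤ) := ((SU S).map (ordHom S)).toAddSubgroup'

lemma mem_lat {S : Finset (Place F K)} {D : S → ℤ} : D ∈ lat S ↔ ∃ u ∈ SU S, ∀ w : S, w.1.ord (u : K) = D w := by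
  constructor
  · rintro ⟨u, hu, h⟩
    exact ⟨u, hu, fun w => congrFun h w⟩
  · rintro ⟨u, hu, h⟩
    exact ⟨u, hu, funext h⟩

noncomputable def extD (S : Finset (Place F K)) (D : S → ℤ) : Dv F K := ∑ w : S, Finsupp.single w.1 (D w)

lemma extD_apply_mem (S : Finset (Place F K)) (D : S → ℤ) (w : S) : extD S D w.1 = D w := by
  classical
  rw [extD, Finsupp.finsetSum_apply, Finset.sum_eq_single w]
  · simp
  · intro v _ hv
    rw [Finsupp.single_apply, if_neg]
    intro h; exact hv (Subtype.ext h)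
  · simp

lemma extD_apply_not_mem (S : Finset (Place F K)) (D : S → ℤ) (w : Place F K) (hw : w ∉ S) : extD S D w = 0 := by
  classical
  rw [extD, Finsupp.finsetSum_apply]
  apply Finset.sum_eq_zero
  intro v _
  rw [Finsupp.single_apply, if_neg]
  rintro rfl; exact hw v.2

lemma dg_extD (S : Finset (Place F K)) (D : S → ℤ) : dg (extD S D) = degLin S D := by
  rw [extD, map_sum]
  simp [dg_single, degLin]

lemma lat_le (S : Finset (Place F K)) : lat S ≤ (LinearMap.ker (degLin S)).toAddSubgroup := by
  intro D hD
  obtain ⟨u, hu, h⟩ := mem_lat.mp hD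
  change degLin S D = 0
  rw [← dg_extD, ← dg_dv (F := F) u.ne_zero]
  congr 1
  ext w
  by_cases hw : w ∈ S
  · rw [extD_apply_mem S D ⟨w, hw⟩, dv_apply, h ⟨w, hw⟩]
  · rw [extD_apply_not_mem S D w hw, dv_apply, hu w hw]

lemma lat_finite (S : Finset (Place F K)) :
    (lat S).IsFiniteRelIndex (LinearMap.ker (degLin S)).toAddSubgroup := by
  classical
  obtain ⟨N, hN⟩ := riemann F K
  obtain ⟨v0⟩ := exists_place F K
  have hd : (0 : ℤ) < v0.deg := by exact_mod_cast v0.deg_pos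
  set k : ℤ := |N| with hk
  have hkN : N ≤ k * v0.deg := by
    have : N ≤ |N| := le_abs_self N
    nlinarith [abs_nonneg N]
  have h1 : ∀ D : (LinearMap.ker (degLin S)).toAddSubgroup, ∃ f : K, f ≠ 0 ∧
      0 ≤ extD S D + Finsupp.single v0 k + dv F f := by
    intro D
    apply ell_pos_iff.mp
    apply (hN _ _).1
    rw [map_add, dg_extD, dg_single]
    have : degLin S D = 0 := D.2
    omega
  choose f hf0 hf using h1
  have hE : ∀ D : (LinearMap.ker (degLin S)).toAddSubgroup,
      extD S D + Finsupp.single v0 k + dv F (f D) ∈ {E : Dv F K | 0 ≤ E ∧ dg E ≤ k * v0.deg} := by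
    intro D
    refine ⟨hf D, ?_⟩
    rw [map_add, map_add, dg_extD, dg_single, dg_dv (hf0 D)]
    have : degLin S D = 0 := D.2
    omega
  have hfin := (finite_eff (F := F) (K := K) (k * v0.deg)).to_subtype
  have : Finite ((LinearMap.ker (degLin S)).toAddSubgroup ⧸
      (lat S).addSubgroupOf (LinearMap.ker (degLin S)).toAddSubgroup) := by
    apply Finite.of_injective (β := {E : Dv F K | 0 ≤ E ∧ dg E ≤ k * v0.deg})
      (fun q => ⟨_, hE q.out⟩)
    intro q q' h
    have h2 := congrArg Subtype.val h
    simp only at h2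
    rw [← QuotientAddGroup.out_eq' q, ← QuotientAddGroup.out_eq' q', QuotientAddGroup.eq]
    rw [AddSubgroup.mem_addSubgroupOf, mem_lat]
    set D := q.out
    set D' := q'.out
    have h3 : ∀ w, extD S D w + w.ord (f D) = extD S D' w + w.ord (f D') := by
      intro w
      have := DFunLike.congr_fun h2 w
      simp only [Finsupp.add_apply, dv_apply] at this
      omega
    refine ⟨Units.mk0 _ (hf0 D) * (Units.mk0 _ (hf0 D'))⁻¹, ?_, ?_⟩
    · intro w hw
      have := h3 w
      rw [extD_apply_not_mem S _ w hw, extD_apply_not_mem S _ w hw] at this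
      push_cast
      rw [w.ord_mul _ _ (by simpa using hf0 D) (by simpa using hf0 D'), w.ord_inv]
      simp only [Units.val_mk0]; omega
    · intro w
      have := h3 w
      rw [extD_apply_mem S _ w, extD_apply_mem S _ w] at this
      push_cast
      rw [w.1.ord_mul _ _ (by simpa using hf0 D) (by simpa using hf0 D'), w.1.ord_inv]
      simp only [Units.val_mk0, Pi.add_apply, Pi.neg_apply]; omega
  have h4 := AddSubgroup.finiteIndex_of_finite_quotient (H := (lat S).addSubgroupOf (LinearMap.ker (degLin S)).toAddSubgroup)
  exact ⟨h4.index_ne_zero⟩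

lemma finrank_lat (S : Finset (Place F K)) (hS : S.Nonempty) : Module.finrank ℤ (lat S) + 1 = S.card := by
  have := lat_finite S
  have : Module.Finite ℤ (LinearMap.ker (degLin S)).toAddSubgroup := inferInstanceAs (Module.Finite ℤ (LinearMap.ker (degLin S)))
  have h1 := AddSubgroup.finrank_eq_of_isFiniteRelIndex (lat_le S)
  have h2 := Submodule.finrank_quotient_add_finrank (LinearMap.ker (degLin S))
  rw [(degLin S).quotKerEquivRange.finrank_eq] at h2
  have h3 : Module.finrank ℤ (LinearMap.range (degLin S)) = 1 := by
    apply le_antisymm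
    · have := Submodule.finrank_le (LinearMap.range (degLin S))
      simpa using this
    · rw [Nat.one_le_iff_ne_zero, ← Nat.pos_iff_ne_zero, Module.finrank_pos_iff_exists_ne_zero]
      classical
      obtain ⟨w, hw⟩ := hS
      refine ⟨⟨degLin S (Pi.single ⟨w, hw⟩ 1), LinearMap.mem_range_self _ _⟩, ?_⟩
      intro h
      have h4 := congrArg Subtype.val h
      have h5 : degLin S (Pi.single ⟨w, hw⟩ 1) = w.deg := by
        change ∑ v : S, (Pi.single (⟨w,hw⟩ : S) (1:ℤ) : S → ℤ) v * (v.1.deg:ℤ) = w.deg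
        rw [Finset.sum_eq_single (⟨w, hw⟩ : S)]
        · simp
        · intro v _ hv; simp [hv]
        · simp
      have := w.deg_pos
      simp [h5] at h4
      omega
  have h4 : Module.finrank ℤ (S → ℤ) = S.card := by simp
  have h5 : Module.finrank ℤ (LinearMap.ker (degLin S)).toAddSubgroup = Module.finrank ℤ (LinearMap.ker (degLin S)) := rfl
  omega

instance finite_const : Finite (SU (∅ : Finset (Place F K))) := by
  have h : Finite (Lsp (0 : Dv F K)) := Module.finite_of_finite F
  apply Finite.of_injective (β := Lsp (0 : Dv F K)) (fun u : SU (∅ : Finset (Place F K)) => ⟨((u : Kˣ) : K), mem_Lsp.mpr fun w =>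
    Or.inr (by simpa using (u.2 w (by simp)).ge)⟩)
  intro u v h
  exact Subtype.ext (Units.ext (congrArg Subtype.val h))

lemma const_index (h2 : (2 : F) ≠ 0) : (SU2 (∅ : Finset (Place F K))).relIndex (SU (∅ : Finset (Place F K))) = 2 := by
  classical
  set C := SU (∅ : Finset (Place F K))
  let f : C →* C := powMonoidHom 2
  have hr : (SU2 (∅ : Finset (Place F K))).subgroupOf C = f.range := by
    ext u
    rw [Subgroup.mem_subgroupOf, mem_SU2]
    constructor
    · rintro ⟨t, ht, h⟩; exact ⟨⟨t, ht⟩, Subtype.ext h⟩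
    · rintro ⟨t, h⟩; exact ⟨t, t.2, congrArg Subtype.val h⟩
  have h2K : (2 : K) ≠ 0 := by
    intro h
    apply h2
    apply (algebraMap F K).injective
    rw [map_ofNat, map_zero]; exact h
  have hne : (-1 : Kˣ) ≠ 1 := by
    intro h
    have : (-1 : K) = 1 := by simpa using congrArg Units.val h
    apply h2K
    linear_combination (-1 : K) * this
  have hm1 : (-1 : Kˣ) ∈ C := fun w _ => by simp
  have hker : Nat.card f.ker = 2 := by
    rw [Nat.card_eq_two_iff]
    refine ⟨⟨1, one_mem _⟩, ⟨⟨-1, hm1⟩, ?_⟩, ?_, ?_⟩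
    · rw [MonoidHom.mem_ker]; apply Subtype.ext; simp [f]
    · intro h
      have := congrArg (fun z : f.ker => ((z : C) : Kˣ)) h
      exact hne this.symm
    · ext ⟨⟨u, hu⟩, hk⟩
      have h1 : u ^ 2 = 1 := congrArg Subtype.val (MonoidHom.mem_ker.mp hk)
      have h3 : (u : K) = 1 ∨ (u : K) = -1 := by
        have : ((u : K)) ^ 2 = 1 := by have := congrArg Units.val h1; push_cast at this; exact this
        exact sq_eq_one_iff.mp this
      simp only [Set.mem_insert_iff, Set.mem_singleton_iff, Set.mem_univ, iff_true]
      rcases h3 with h | h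
      · left; apply Subtype.ext; apply Subtype.ext; exact Units.ext h
      · right; apply Subtype.ext; apply Subtype.ext; exact Units.ext (by simpa using h)
  unfold Subgroup.relIndex
  rw [hr]
  have e1 := f.range.card_mul_index
  have e2 := f.ker.card_mul_index
  rw [Subgroup.index_ker, hker, ← e1, mul_comm 2] at e2
  have : 0 < Nat.card f.range := Nat.card_pos
  exact (Nat.eq_of_mul_eq_mul_left this e2).symm

lemma unit_index (h2 : (2 : F) ≠ 0) (S : Finset (Place F K)) (hS : S.Nonempty) :
    (SU2 S).relIndex (SU S) = 2 ^ S.card := by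
  set L2 : AddSubgroup (S → ℤ) := (lat S).map (nsmulAddMonoidHom 2)
  have hidx : L2.relIndex (lat S) = 2 ^ Module.finrank ℤ (lat S) := AddSubgroup.relIndex_map_nsmul 2 (lat S)
  let M : Subgroup Kˣ := SU (∅ : Finset (Place F K)) ⊔ SU2 S
  have hM : M = SU S ⊓ (AddSubgroup.toSubgroup' L2 : Subgroup (Multiplicative (S → ℤ))).comap (ordHom S) := by
    apply le_antisymm
    · apply sup_le
      · intro u hu
        refine ⟨SU_mono (by simp) hu, ?_⟩
        refine ⟨0, zero_mem _, ?_⟩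
        funext w
        exact (hu w (by simp)).symm
      · intro u hu
        refine ⟨SU2_le S hu, ?_⟩
        obtain ⟨t, ht, rfl⟩ := hu
        refine ⟨fun w => w.1.ord t, mem_lat.mpr ⟨t, ht, fun _ => rfl⟩, ?_⟩
        funext w
        change 2 • w.1.ord (t : K) = w.1.ord ((t ^ 2 : Kˣ) : K)
        push_cast
        rw [w.1.ord_pow]; simp
    · rintro u ⟨hu, D, hD, hDu⟩
      obtain ⟨t, ht, htD⟩ := mem_lat.mp hD
      have h1 : u * (t ^ 2)⁻¹ ∈ SU (∅ : Finset (Place F K)) := by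
        intro w _
        push_cast
        rw [w.ord_mul _ _ u.ne_zero (by simp), w.ord_inv, w.ord_pow]
        by_cases hw : w ∈ S
        · have h3 := congrFun hDu ⟨w, hw⟩
          have h4 : 2 • D ⟨w, hw⟩ = w.ord (u : K) := h3
          rw [← h4, ← htD]; simp
        · rw [hu w hw, ht w hw]; simp
      have : u = (u * (t ^ 2)⁻¹) * t ^ 2 := by simp
      rw [this]
      exact Subgroup.mul_mem_sup h1 ⟨t, ht, rfl⟩
  have e1 : M.relIndex (SU S) = 2 ^ Module.finrank ℤ (lat S) := by
    rw [hM, Subgroup.inf_relIndex_left, Subgroup.relIndex_comap, ← hidx]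
    rfl
  have e2 : (SU2 S).relIndex M = 2 := by
    rw [Subgroup.relIndex_sup_right, ← const_index (F := F) (K := K) h2, ← Subgroup.inf_relIndex_right]
    congr 1
    ext u
    constructor
    · rintro ⟨⟨t, ht, rfl⟩, hu⟩
      refine ⟨t, ?_, rfl⟩
      intro w hw
      have : w.ord ((t ^ 2 : Kˣ) : K) = 0 := hu w hw
      push_cast at this
      rw [w.ord_pow] at this
      simpa using this
    · rintro ⟨t, ht, rfl⟩
      exact ⟨⟨t, SU_mono (by simp) ht, rfl⟩, pow_mem ht 2⟩
  have hle : M ≤ SU S := by rw [hM]; exact inf_le_left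
  rw [← Subgroup.relIndex_mul_relIndex (SU2 S) M (SU S) le_sup_right hle, e1, e2, ← finrank_lat S hS, pow_succ, mul_comm]

end fin
end NND

set_option linter.unusedSectionVars false
set_option linter.unusedVariables false
namespace NND
universe u

section LA
variable {F : Type*} [Field F]

lemma det_eq_of_surj {M Q1 Q2 : Type*} [AddCommGroup M] [Module F M] [AddCommGroup Q1] [Module F Q1]
    [AddCommGroup Q2] [Module F Q2] (p1 : M →ₗ[F] Q1) (p2 : M →ₗ[F] Q2) (h1 : Function.Surjective p1)
    (h2 : Function.Surjective p2) (hk : ∀ x, p1 x = 0 ↔ p2 x = 0) (φ : M → M) (D1 : Q1 →ₗ[F] Q1) (D2 : Q2 →ₗ[F] Q2)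
    (hD1 : ∀ x, D1 (p1 x) = p1 (φ x)) (hD2 : ∀ x, D2 (p2 x) = p2 (φ x)) :
    LinearMap.det D1 = LinearMap.det D2 := by
  have hker : LinearMap.ker p1 = LinearMap.ker p2 := by ext x; simpa using hk x
  let e : Q1 ≃ₗ[F] Q2 := (p1.quotKerEquivOfSurjective h1).symm.trans
    ((Submodule.quotEquivOfEq _ _ hker).trans (p2.quotKerEquivOfSurjective h2))
  have he : ∀ x, e (p1 x) = p2 x := by
    intro x
    have : (p1.quotKerEquivOfSurjective h1).symm (p1 x) = Submodule.Quotient.mk x := by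
      rw [LinearEquiv.symm_apply_eq]; rfl
    simp only [e, LinearEquiv.trans_apply, this]
    rfl
  have : D2 = (e : Q1 →ₗ[F] Q2) ∘ₗ D1 ∘ₗ (e.symm : Q2 →ₗ[F] Q1) := by
    ext y
    obtain ⟨x, rfl⟩ := h2 y
    simp only [LinearMap.comp_apply, LinearEquiv.coe_coe]
    rw [← he x, LinearEquiv.symm_apply_apply, hD1, he, he, hD2]
  rw [this, LinearMap.det_conj]

lemma det_block {A Y : Type*} [AddCommGroup A] [Module F A] [AddCommGroup Y] [Module F Y] [Module.Finite F A]
    [Module.Finite F Y] (T : A × Y →ₗ[F] A × Y) (P : A →ₗ[F] A) (D : Y →ₗ[F] Y) (h1 : ∀ a, T (a, 0) = (P a, 0))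
    (h2 : ∀ z, (T z).2 = D z.2) : LinearMap.det T = LinearMap.det P * LinearMap.det D := by
  let W : Submodule F (A × Y) := LinearMap.ker (LinearMap.snd F A Y)
  have hW : ∀ z, z ∈ W ↔ z.2 = 0 := fun z => by simp [W]
  have he : W ≤ W.comap T := by
    intro z hz
    rw [Submodule.mem_comap, hW, h2, (hW z).mp hz, map_zero]
  rw [LinearMap.det_eq_det_mul_det W T he]
  congr 1
  · symm
    refine det_eq_of_surj (M := A) LinearMap.id ((LinearMap.inl F A Y).codRestrict W fun a => by simp [W])
      Function.surjective_id ?_ ?_ P _ _ (fun x => rfl) ?_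
    · rintro ⟨⟨a, y⟩, h⟩
      refine ⟨a, ?_⟩
      apply Subtype.ext
      have := (hW _).mp h
      simp only at this
      subst this
      rfl
    · intro x
      rw [← Subtype.coe_inj]
      change x = 0 ↔ ((x, 0) : A × Y) = 0
      simp
    · intro x; apply Subtype.ext; exact h1 x
  · refine det_eq_of_surj (M := A × Y) W.mkQ (LinearMap.snd F A Y) W.mkQ_surjective LinearMap.snd_surjective ?_ T _ _
      (fun x => by simp) (fun x => by simp [h2])
    intro x; simp [hW]
end LA

variable {F : Type*} {K : Type u} [Field F] [Field K] [Algebra F K]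

/-- weighted sum over a divisor -/
noncomputable def ev (c : Place F K → ZMod 2) : Dv F K →+ ZMod 2 :=
  Finsupp.liftAddHom fun w => (AddMonoidHom.mulRight (c w)).comp (Int.castAddHom (ZMod 2))

lemma ev_single (c : Place F K → ZMod 2) (w : Place F K) (n : ℤ) : ev c (Finsupp.single w n) = n * c w := by
  simp [ev]

lemma ev_eq_sum (c : Place F K → ZMod 2) (D : Dv F K) (s : Finset (Place F K)) (h : ∀ w, w ∉ s → D w = 0) :
    ev c D = ∑ w ∈ s, (D w : ZMod 2) * c w := by
  rw [ev, Finsupp.liftAddHom_apply]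
  rw [Finsupp.sum_of_support_subset D (s := s) (fun w hw => by
    by_contra h'; exact (Finsupp.mem_support_iff.mp hw) (h w h')) _ (by simp)]
  simp

section fin
variable [Finite F] [GFF F K]

/-- multiplication on a local module -/
noncomputable def mulEnd (s : Set (Place F K)) (D : Place F K → ℤ) (f : K) (hf : ∀ w ∈ s, w.ord f = 0) :
    Ms s D →ₗ[F] Ms s D where
  toFun x := ⟨f * x, fun w hw => by
    have := w.ge_mul (x := f) (Or.inr (hf w hw).ge) (x.2 w hw)
    rwa [zero_add] at this⟩
  map_add' x y := Subtype.ext (by simp [mul_add])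
  map_smul' c x := Subtype.ext (by simp)

lemma local_det (s : Finset (Place F K)) (G : Dv F K) {f : K} (hf0 : f ≠ 0) (hf : ∀ w ∈ (s : Set (Place F K)), w.ord f = 0) :
    ∀ B : Dv F K, 0 ≤ B → (∀ w, w ∉ s → B w = 0) → ∀ (Q : Type u) [AddCommGroup Q] [Module F Q] [Module.Finite F Q]
      (p : Ms (s : Set (Place F K)) (G + B : Dv F K) →ₗ[F] Q) (hp : Function.Surjective p)
      (hk : ∀ x, p x = 0 ↔ (x : K) ∈ Ms (s : Set (Place F K)) G) (D : Q →ₗ[F] Q)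
      (hD : ∀ x, D (p x) = p (mulEnd _ _ f hf x)),
      LinearMap.det D ≠ 0 ∧ qc (LinearMap.det D) = ev (fun w => w.chr f) B := by
  classical
  refine dv_induction (0 : Dv F K) ?_ ?_
  · intro _ Q _ _ _ p hp hk D hD
    have : Subsingleton Q := by
      refine ⟨fun a b => ?_⟩
      have h0 : ∀ a : Q, a = 0 := by
        intro a
        obtain ⟨x, rfl⟩ := hp a
        rw [hk]
        have := x.2
        simpa using this
      rw [h0 a, h0 b]
    have : D = LinearMap.id := by ext x; exact Subsingleton.elim _ _
    rw [this, LinearMap.det_id, map_zero, qc_one]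
    exact ⟨one_ne_zero, rfl⟩
  · intro B hB w ih hBs
    have hws : w ∈ s := by
      by_contra h
      have := hBs w h
      have h2 : 0 ≤ B w := hB w
      simp only [Finsupp.add_apply, Finsupp.single_eq_same] at this
      omega
    have hBs' : ∀ v, v ∉ s → B v = 0 := by
      intro v hv
      have := hBs v hv
      have hvw : v ≠ w := by rintro rfl; exact hv hws
      simpa [Finsupp.single_apply, hvw.symm] using this
    set M := Ms (s : Set (Place F K)) (G + (B + Finsupp.single w 1) : Dv F K) with hM
    set M' := Ms (s : Set (Place F K)) (G + B : Dv F K) with hM'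
    intro Q _ _ _ p hp hk D hD
    have hle : M' ≤ M := Ms_mono fun v _ => by
      have := le_add_single B w v
      simp only [Finsupp.add_apply] at this ⊢; omega
    have hle0 : Ms (s : Set (Place F K)) G ≤ M' := Ms_mono fun v _ => by
      have : 0 ≤ B v := hB v
      simp only [Finsupp.add_apply] at this ⊢; omega
    let pi' : M' →ₗ[F] Q := p ∘ₗ Submodule.inclusion hle
    let W := LinearMap.range pi'
    have he : W ≤ W.comap D := by
      rintro _ ⟨x, rfl⟩
      rw [Submodule.mem_comap]
      refine ⟨mulEnd _ _ f hf x, ?_⟩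
      change p _ = D (p _)
      rw [hD]
      congr 1
    have hpW : ∀ x : M, p x ∈ W ↔ (x : K) ∈ M' := by
      intro x
      constructor
      · rintro ⟨y, hy⟩
        have : p (x - Submodule.inclusion hle y) = 0 := by
          rw [map_sub, sub_eq_zero]; exact hy.symm
        rw [hk] at this
        have h3 := M'.add_mem (hle0 this) y.2
        simpa using h3
      · intro hx
        exact ⟨⟨x, hx⟩, rfl⟩
    have i1 := ih hBs' W pi'.rangeRestrict pi'.surjective_rangeRestrict (by
      intro x
      rw [← Subtype.coe_inj]
      change p _ = 0 ↔ _
      rw [hk]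
      rfl) (D.restrict he) (by
      intro x
      apply Subtype.ext
      change D (p _) = p _
      rw [hD]
      congr 1)
    rw [LinearMap.det_eq_det_mul_det W D he]
    have hMw : ∀ g ∈ M, w.ge (-((G + (B + Finsupp.single w 1) : Dv F K) w)) g := fun g hg => hg w hws
    have hf1 : w.rs f ≠ 0 := w.rs_ne_zero hf0 (hf w hws)
    have hnw : -((G + B : Dv F K) w) = -((G + (B + Finsupp.single w 1) : Dv F K) w - 1) := by
      simp only [Finsupp.add_apply, Finsupp.single_eq_same]; ring
    have i2 : LinearMap.det (W.mapQ W D he) = Algebra.norm F (w.rs f) := by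
      rw [Algebra.norm_apply]
      refine det_eq_of_surj (M := M) (W.mkQ ∘ₗ p) (stepHom w _ M hMw) (W.mkQ_surjective.comp hp)
        (stepHom_surj_finset s _ w hws) ?_ (mulEnd _ _ f hf) _ _ ?_ ?_
      · intro x
        rw [stepHom_eq_zero, LinearMap.comp_apply, Submodule.mkQ_apply, Submodule.Quotient.mk_eq_zero, hpW]
        constructor
        · intro h
          have := h w hws
          rwa [hnw] at this
        · intro h v hv
          by_cases hvw : v = w
          · subst hvw; rw [hnw]; exact h
          · have := x.2 v hv
            simpa [Finsupp.single_apply, Ne.symm hvw] using this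
      · intro x
        rw [LinearMap.comp_apply, Submodule.mkQ_apply, Submodule.mapQ_apply, hD]; rfl
      · intro x
        change w.rs f * w.rs (_ * _) = w.rs (f * x * _)
        rw [mul_assoc f, ← w.rs_mul (x := f)]
        · exact Or.inr (hf w hws).ge
        · have := w.ge_mul_pi (k := (G + (B + Finsupp.single w 1) : Dv F K) w) (hMw x x.2)
          simpa using this
    rw [i2]
    have hn : Algebra.norm F (w.rs f) ≠ 0 := Algebra.norm_ne_zero_iff.mpr hf1
    refine ⟨mul_ne_zero i1.1 hn, ?_⟩
    rw [qc_mul i1.1 hn, i1.2, qc_norm _ hf1, map_add, ev_single]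
    simp [Place.chr, w.lead_of_ord_zero (hf w hws)]

end fin
end NND

set_option linter.unusedSectionVars false
set_option linter.unusedVariables false
namespace NND
universe u
variable {F : Type*} {K : Type u} [Field F] [Field K] [Algebra F K]

/-- a model of the local quotient together with a global section -/
structure Mdl (s : Finset (Place F K)) (G B : Dv F K) (Y : Type u) [AddCommGroup Y] [Module F Y] where
  p : Ms (s : Set (Place F K)) (G + B : Dv F K) →ₗ[F] Y
  t : Y →ₗ[F] K
  ht : ∀ y, t y ∈ Lsp (G + B)
  hpt : ∀ y (h : t y ∈ Ms (s : Set (Place F K)) (G + B : Dv F K)), p ⟨t y, h⟩ = y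
  hk : ∀ x, p x = 0 ↔ (x : K) ∈ Ms (s : Set (Place F K)) G

lemma Lsp_le_Ms (s : Finset (Place F K)) (D : Dv F K) : Lsp D ≤ Ms (s : Set (Place F K)) D :=
  fun f hf w _ => mem_Lsp.mp hf w

section
variable {s : Finset (Place F K)} {G B : Dv F K} {Y : Type u} [AddCommGroup Y] [Module F Y] (m : Mdl s G B Y)

lemma Mdl.surj : Function.Surjective m.p := fun y =>
  ⟨⟨m.t y, Lsp_le_Ms s _ (m.ht y)⟩, m.hpt y _⟩

lemma mem_Lsp_of {z : K} (hBs : ∀ w, w ∉ s → B w = 0) (h1 : z ∈ Lsp (G + B)) (h2 : z ∈ Ms (s : Set (Place F K)) G) : z ∈ Lsp G := by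
  rw [mem_Lsp]
  intro w
  by_cases hw : w ∈ s
  · exact h2 w hw
  · have := mem_Lsp.mp h1 w
    rwa [Finsupp.add_apply, hBs w hw, add_zero] at this

noncomputable def Mdl.lin (hB : 0 ≤ B) : (Lsp G × Y) →ₗ[F] Lsp (G + B) :=
  ((Lsp G).subtype.coprod m.t).codRestrict _ (fun z => by
    rw [LinearMap.coprod_apply]
    exact Submodule.add_mem _ (Lsp_mono (by simpa using hB) z.1.2) (m.ht z.2))

lemma Mdl.lin_coe (hB : 0 ≤ B) (z) : ((m.lin hB z : Lsp (G + B)) : K) = z.1 + m.t z.2 := rfl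

lemma Mdl.p_lin (hB : 0 ≤ B) (e : K) (he : e ∈ Lsp G) (y : Y) (h) : m.p ⟨e + m.t y, h⟩ = y := by
  have h1 : e ∈ Ms (s : Set (Place F K)) (G + B : Dv F K) := Lsp_le_Ms s _ (Lsp_mono (by simpa using hB) he)
  have h2 : m.p ⟨e, h1⟩ = 0 := (m.hk _).mpr (Lsp_le_Ms s _ he)
  have h3 := m.hpt y (Lsp_le_Ms s _ (m.ht y))
  have : (⟨e + m.t y, h⟩ : Ms (s : Set (Place F K)) (G + B : Dv F K)) = ⟨e, h1⟩ + ⟨m.t y, Lsp_le_Ms s _ (m.ht y)⟩ := rfl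
  rw [this, map_add, h2, h3, zero_add]

noncomputable def Mdl.eqv (hB : 0 ≤ B) (hBs : ∀ w, w ∉ s → B w = 0) : (Lsp G × Y) ≃ₗ[F] Lsp (G + B) :=
  LinearEquiv.ofBijective (m.lin hB) (by
    constructor
    · rw [injective_iff_map_eq_zero]
      rintro ⟨e, y⟩ h
      have h1 : (e : K) + m.t y = 0 := congrArg Subtype.val h
      have h2 := m.p_lin hB e e.2 y (by rw [h1]; exact zero_mem _)
      have h3 : y = 0 := by
        rw [← h2, m.hk]; change (e : K) + m.t y ∈ _; rw [h1]; exact zero_mem _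
      subst h3
      rw [map_zero, add_zero] at h1
      ext
      · exact h1
      · rfl
    · intro z
      let y := m.p ⟨z, Lsp_le_Ms s _ z.2⟩
      have h1 : (z : K) - m.t y ∈ Lsp G := by
        apply mem_Lsp_of hBs (Submodule.sub_mem _ z.2 (m.ht y))
        have : m.p (⟨z, Lsp_le_Ms s _ z.2⟩ - ⟨m.t y, Lsp_le_Ms s _ (m.ht y)⟩) = 0 := by
          rw [map_sub, m.hpt, sub_self]
        rwa [m.hk] at this
      refine ⟨(⟨_, h1⟩, y), Subtype.ext ?_⟩
      rw [m.lin_coe]; simp)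

lemma Mdl.eqv_coe (hB : 0 ≤ B) (hBs : ∀ w, w ∉ s → B w = 0) (z) :
    ((m.eqv hB hBs z : Lsp (G + B)) : K) = z.1 + m.t z.2 := rfl

lemma Mdl.p_eq (hB : 0 ≤ B) (hBs : ∀ w, w ∉ s → B w = 0) (x : Lsp (G + B)) (h) :
    m.p ⟨x, h⟩ = ((m.eqv hB hBs).symm x).2 := by
  obtain ⟨z, rfl⟩ := (m.eqv hB hBs).surjective x
  rw [LinearEquiv.symm_apply_apply]
  exact m.p_lin hB z.1 z.1.2 z.2 h

/-- base change -/
noncomputable def Mdl.bc (A : Dv F K) (hA : 0 ≤ A) (hAs : ∀ w ∈ s, A w = 0) : Mdl s (G + A) B Y where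
  p := m.p ∘ₗ Submodule.inclusion (Ms_mono fun w hw => by simp [hAs w hw])
  t := m.t
  ht y := Lsp_mono (by intro w; have : 0 ≤ A w := hA w; simp; omega) (m.ht y)
  hpt y h := m.hpt y _
  hk x := by
    rw [LinearMap.comp_apply, m.hk]
    constructor
    · intro h w hw
      have : w.ge (- G w) (x : K) := h w hw
      simpa [hAs w hw] using this
    · intro h w hw
      have := h w hw
      change w.ge (- G w) (x : K)
      simpa [hAs w hw] using this
/-- transport -/
noncomputable def Mdl.tr {Y' : Type u} [AddCommGroup Y'] [Module F Y'] (e : Y ≃ₗ[F] Y') : Mdl s G B Y' where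
  p := e ∘ₗ m.p
  t := m.t ∘ₗ e.symm
  ht y := m.ht _
  hpt y h := by
    have := m.hpt (e.symm y) h
    change e (m.p _) = y
    rw [← LinearEquiv.eq_symm_apply]
    exact this
  hk x := by rw [← m.hk, LinearMap.comp_apply]; simp
end

section fin
variable [Finite F] [GFF F K]

lemma exists_glob (s : Finset (Place F K)) (G : Dv F K) (hG : ∀ H, G ≤ H → ∀ w, Function.Surjective (lstep H w)) :
    ∀ B : Dv F K, 0 ≤ B → (∀ w, w ∉ s → B w = 0) → ∀ z ∈ Ms (s : Set (Place F K)) (G + B : Dv F K),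
      ∃ y ∈ Lsp (G + B), z - y ∈ Ms (s : Set (Place F K)) G := by
  classical
  refine dv_induction (0 : Dv F K) ?_ ?_
  · intro _ z hz
    refine ⟨0, zero_mem _, ?_⟩
    simpa using hz
  · intro B hB w ih hBs z hz
    have hws : w ∈ s := by
      by_contra h
      have := hBs w h
      have h2 : 0 ≤ B w := hB w
      simp only [Finsupp.add_apply, Finsupp.single_eq_same] at this
      omega
    have hBs' : ∀ v, v ∉ s → B v = 0 := by
      intro v hv
      have := hBs v hv
      have hvw : v ≠ w := by rintro rfl; exact hv hws
      simpa [Finsupp.single_apply, hvw.symm] using this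
    rw [← add_assoc] at hz ⊢
    have hzw : w.ge (-((G + B) w + 1)) z := by
      have := hz w hws
      simpa [Finsupp.add_apply] using this
    obtain ⟨y1, hy1⟩ := hG (G + B) (by simpa using hB) w (w.rs (z * w.pi ^ ((G + B) w + 1)))
    have hy1w : w.ge (-((G + B) w + 1)) (y1 : K) := by
      have := mem_Lsp.mp y1.2 w
      simpa [Finsupp.add_apply] using this
    have hstep := stepHom_eq_zero w ((G + B) w + 1) (Ms {w} (fun v => (G + B) w + 1)) (fun f hf => hf w rfl)
      ⟨z - y1, by intro v hv; rw [Set.mem_singleton_iff.mp hv]; exact w.ge_sub hzw hy1w⟩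
    have h1 : z - y1 ∈ Ms (s : Set (Place F K)) (G + B : Dv F K) := by
      intro v hv
      by_cases hvw : v = w
      · subst hvw
        have : v.ge (-((G + B) v + 1 - 1)) (z - y1) := by
          refine hstep.mp ?_
          change v.rs ((z - y1) * _) = 0
          change v.rs (y1 * _) = _ at hy1
          rw [sub_mul, v.rs_sub, hy1, sub_self]
          · simpa using v.ge_mul_pi (k := (G + B) v + 1) hzw
          · simpa using v.ge_mul_pi (k := (G + B) v + 1) hy1w
        simpa using this
      · have e1 := hz v hv
        have e2 := mem_Lsp.mp y1.2 v
        have := v.ge_sub e1 e2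
        simpa [Finsupp.single_apply, Ne.symm hvw] using this
    obtain ⟨y2, hy2, h2⟩ := ih hBs' _ h1
    refine ⟨y1 + y2, Submodule.add_mem _ y1.2 (Lsp_mono (le_add_single _ _) hy2), ?_⟩
    rwa [← sub_sub]

lemma exists_mdl (s : Finset (Place F K)) (G : Dv F K) (hG : ∀ H, G ≤ H → ∀ w, Function.Surjective (lstep H w))
    (B : Dv F K) (hB : 0 ≤ B) (hBs : ∀ w, w ∉ s → B w = 0) :
    ∃ (Y : Type u) (_ : AddCommGroup Y) (_ : Module F Y) (_ : Module.Finite F Y), Nonempty (Mdl s G B Y) := by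
  let M := Ms (s : Set (Place F K)) (G + B : Dv F K)
  let N : Submodule F M := (Ms (s : Set (Place F K)) G).comap M.subtype
  let r : Lsp (G + B) →ₗ[F] M ⧸ N := N.mkQ ∘ₗ Submodule.inclusion (Lsp_le_Ms s (G + B))
  have hr : Function.Surjective r := by
    intro q
    obtain ⟨z, rfl⟩ := N.mkQ_surjective q
    obtain ⟨y, hy, h⟩ := exists_glob s G hG B hB hBs z z.2
    refine ⟨⟨y, hy⟩, ?_⟩
    change N.mkQ _ = N.mkQ _
    rw [Submodule.mkQ_apply, Submodule.mkQ_apply, eq_comm, Submodule.Quotient.eq]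
    exact h
  obtain ⟨t, ht⟩ := r.exists_rightInverse_of_surjective (LinearMap.range_eq_top.mpr hr)
  refine ⟨M ⧸ N, inferInstance, inferInstance, Module.Finite.of_surjective r hr, ⟨⟨N.mkQ, (Lsp (G + B)).subtype ∘ₗ t, ?_, ?_, ?_⟩⟩⟩
  · intro y; exact (t y).2
  · intro y h
    exact LinearMap.congr_fun ht y
  · intro x
    rw [Submodule.mkQ_apply, Submodule.Quotient.mk_eq_zero]; rfl

/-- coordinates -/
def Vc {G : Dv F K} {X Y : Type u} [AddCommGroup X] [Module F X] [AddCommGroup Y] [Module F Y]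
  (s : X →ₗ[F] K) (t : Y →ₗ[F] K) (z : (Lsp G × X) × Y) : K := z.1.1 + s z.1.2 + t z.2

section block
variable {sA sB : Finset (Place F K)} {G A B : Dv F K} {X Y : Type u} [AddCommGroup X] [Module F X] [AddCommGroup Y] [Module F Y]

noncomputable def bigE (mA : Mdl sA G A X) (mB : Mdl sB G B Y) (hA : 0 ≤ A) (hAs : ∀ w, w ∉ sA → A w = 0)
    (hB : 0 ≤ B) (hBs : ∀ w, w ∉ sB → B w = 0) (hd : ∀ w ∈ sB, w ∉ sA) :
    ((Lsp G × X) × Y) ≃ₗ[F] Lsp (G + A + B) :=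
  ((mA.eqv hA hAs).prodCongr (LinearEquiv.refl F Y)).trans ((mB.bc A hA (fun w hw => hAs w (hd w hw))).eqv hB hBs)

lemma bigE_coe (mA : Mdl sA G A X) (mB : Mdl sB G B Y) (hA : 0 ≤ A) (hAs : ∀ w, w ∉ sA → A w = 0)
    (hB : 0 ≤ B) (hBs : ∀ w, w ∉ sB → B w = 0) (hd : ∀ w ∈ sB, w ∉ sA) (z) :
    ((bigE mA mB hA hAs hB hBs hd z : Lsp (G + A + B)) : K) = Vc mA.t mB.t z := rfl

lemma Vc_inj (mA : Mdl sA G A X) (mB : Mdl sB G B Y) (hA : 0 ≤ A) (hAs : ∀ w, w ∉ sA → A w = 0)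
    (hB : 0 ≤ B) (hBs : ∀ w, w ∉ sB → B w = 0) (hd : ∀ w ∈ sB, w ∉ sA) :
    Function.Injective (Vc (G := G) mA.t mB.t) := by
  intro z z' h
  apply (bigE mA mB hA hAs hB hBs hd).injective
  exact Subtype.ext h
end block

lemma block {sA sB : Finset (Place F K)} {G A0 A1 : Dv F K} {X : Type u} [AddCommGroup X] [Module F X] [Module.Finite F X]
    (m0 : Mdl sA G A0 X) (m1 : Mdl sA G A1 X) (hA0 : 0 ≤ A0) (hA1 : 0 ≤ A1) (hAs0 : ∀ w, w ∉ sA → A0 w = 0)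
    (hAs1 : ∀ w, w ∉ sA → A1 w = 0) {f : K} (hf0 : f ≠ 0) (hf : dv F f = A0 - A1) (hd : ∀ w ∈ sB, w ∉ sA) :
    ∃ c : ZMod 2, ∀ (B : Dv F K) (hB : 0 ≤ B) (hBs : ∀ w, w ∉ sB → B w = 0) (Y : Type u) [AddCommGroup Y] [Module F Y]
      [Module.Finite F Y] (mB : Mdl sB G B Y), ∃ T : ((Lsp G × X) × Y) →ₗ[F] ((Lsp G × X) × Y),
        (∀ z, Vc m1.t mB.t (T z) = f * Vc m0.t mB.t z) ∧ LinearMap.det T ≠ 0 ∧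
        qc (LinearMap.det T) = c + ev (fun w => w.chr f) B := by
  have hfB : ∀ w ∈ (sB : Set (Place F K)), w.ord f = 0 := by
    intro w hw
    have := DFunLike.congr_fun hf w
    rw [dv_apply, Finsupp.sub_apply, hAs0 w (hd w hw), hAs1 w (hd w hw)] at this
    simpa using this
  let P : (Lsp G × X) ≃ₗ[F] (Lsp G × X) := (m0.eqv hA0 hAs0).trans
    ((mulEquiv hf0 (D := G + A0) (D' := G + A1) (by rw [hf]; abel)).trans (m1.eqv hA1 hAs1).symm)
  have hP : ∀ a, ((m1.eqv hA1 hAs1 (P a) : Lsp (G + A1)) : K) = f * (m0.eqv hA0 hAs0 a : Lsp (G + A0)) := by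
    intro a
    simp only [P, LinearEquiv.trans_apply, LinearEquiv.apply_symm_apply]
    rfl
  have hP0 : LinearMap.det (P : (Lsp G × X) →ₗ[F] (Lsp G × X)) ≠ 0 := (LinearEquiv.isUnit_det' P).ne_zero
  refine ⟨qc (LinearMap.det (P : (Lsp G × X) →ₗ[F] (Lsp G × X))), ?_⟩
  intro B hB hBs Y _ _ _ mB
  let E0 := bigE m0 mB hA0 hAs0 hB hBs hd
  let E1 := bigE m1 mB hA1 hAs1 hB hBs hd
  let T : ((Lsp G × X) × Y) ≃ₗ[F] ((Lsp G × X) × Y) := E0.trans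
    ((mulEquiv hf0 (D := G + A0 + B) (D' := G + A1 + B) (by rw [hf]; abel)).trans E1.symm)
  have hT : ∀ z, ((E1 (T z) : Lsp (G + A1 + B)) : K) = f * (E0 z : Lsp (G + A0 + B)) := by
    intro a
    simp only [T, LinearEquiv.trans_apply, LinearEquiv.apply_symm_apply]
    rfl
  let tt : Y →ₗ[F] Ms (sB : Set (Place F K)) (G + B : Dv F K) :=
    mB.t.codRestrict _ (fun y => Lsp_le_Ms sB _ (mB.ht y))
  let D : Y →ₗ[F] Y := mB.p ∘ₗ mulEnd _ _ f hfB ∘ₗ tt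
  have hD : ∀ x, D (mB.p x) = mB.p (mulEnd _ _ f hfB x) := by
    intro x
    have h1 : mB.p (x - tt (mB.p x)) = 0 := by
      rw [map_sub, sub_eq_zero]; exact (mB.hpt _ _).symm
    rw [mB.hk] at h1
    have h2 : mB.p (mulEnd _ _ f hfB (x - tt (mB.p x))) = 0 := by
      rw [mB.hk]
      intro w hw
      have := w.ge_mul (x := f) (Or.inr (hfB w hw).ge) (h1 w hw)
      rw [zero_add] at this
      exact this
    rw [map_sub, map_sub, sub_eq_zero] at h2
    exact h2.symm
  have hl := local_det sB G hf0 hfB B hB hBs Y mB.p mB.surj mB.hk D hD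
  refine ⟨T, hT, (LinearEquiv.isUnit_det' T).ne_zero, ?_⟩
  rw [det_block (T : ((Lsp G × X) × Y) →ₗ[F] ((Lsp G × X) × Y)) P D, qc_mul hP0 hl.1, hl.2]
  · intro a
    rw [LinearEquiv.coe_coe, LinearEquiv.coe_coe]
    apply E1.injective
    apply Subtype.ext
    rw [hT]
    have e1 : ((E1 (P a, 0) : Lsp (G + A1 + B)) : K) = (m1.eqv hA1 hAs1 (P a) : Lsp (G + A1)) + mB.t 0 := rfl
    have e0 : ((E0 (a, 0) : Lsp (G + A0 + B)) : K) = (m0.eqv hA0 hAs0 a : Lsp (G + A0)) + mB.t 0 := rfl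
    rw [e1, e0, map_zero, add_zero, add_zero, hP]
  · intro z
    rw [LinearEquiv.coe_coe]
    have hA0' : ∀ w ∈ sB, A0 w = 0 := fun w hw => hAs0 w (hd w hw)
    have hA1' : ∀ w ∈ sB, A1 w = 0 := fun w hw => hAs1 w (hd w hw)
    have i0 : ∀ x : Lsp (G + A0 + B), (x : K) ∈ Ms (sB : Set (Place F K)) (G + B : Dv F K) := by
      intro x w hw
      have := mem_Lsp.mp x.2 w
      simpa [hA0' w hw] using this
    have i1 : ∀ x : Lsp (G + A1 + B), (x : K) ∈ Ms (sB : Set (Place F K)) (G + B : Dv F K) := by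
      intro x w hw
      have := mem_Lsp.mp x.2 w
      simpa [hA1' w hw] using this
    have e1 : ∀ z, mB.p ⟨E1 z, i1 _⟩ = z.2 := fun z =>
      (mB.bc A1 hA1 hA1').p_lin hB (m1.eqv hA1 hAs1 z.1 : Lsp (G + A1)) (m1.eqv hA1 hAs1 z.1 : Lsp (G + A1)).2 z.2
        (Lsp_le_Ms sB _ (E1 z).2)
    have e0 : ∀ z, mB.p ⟨E0 z, i0 _⟩ = z.2 := fun z =>
      (mB.bc A0 hA0 hA0').p_lin hB (m0.eqv hA0 hAs0 z.1 : Lsp (G + A0)) (m0.eqv hA0 hAs0 z.1 : Lsp (G + A0)).2 z.2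
        (Lsp_le_Ms sB _ (E0 z).2)
    rw [← e1, ← e0 z, hD]
    congr 1
    exact Subtype.ext (hT z)

end fin
end NND

set_option linter.unusedSectionVars false
set_option linter.unusedVariables false
namespace NND
universe u
variable {F : Type*} {K : Type u} [Field F] [Field K] [Algebra F K]
variable [Finite F] [GFF F K]

lemma exists_mdl_pair (s : Finset (Place F K)) (G : Dv F K) (hG : ∀ H, G ≤ H → ∀ w, Function.Surjective (lstep H w))
    (B0 B1 : Dv F K) (hB0 : 0 ≤ B0) (hBs0 : ∀ w, w ∉ s → B0 w = 0) (hB1 : 0 ≤ B1) (hBs1 : ∀ w, w ∉ s → B1 w = 0)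
    {g : K} (hg0 : g ≠ 0) (hg : dv F g = B0 - B1) :
    ∃ (Y : Type u) (_ : AddCommGroup Y) (_ : Module F Y) (_ : Module.Finite F Y), Nonempty (Mdl s G B0 Y) ∧ Nonempty (Mdl s G B1 Y) := by
  obtain ⟨Y, _, _, _, ⟨m0⟩⟩ := exists_mdl s G hG B0 hB0 hBs0
  obtain ⟨Y', _, _, _, ⟨m1⟩⟩ := exists_mdl s G hG B1 hB1 hBs1
  have e0 := (m0.eqv hB0 hBs0).finrank_eq
  have e1 := (m1.eqv hB1 hBs1).finrank_eq
  have e2 := (mulEquiv hg0 (D := G + B0) (D' := G + B1) (by rw [hg]; abel)).finrank_eq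
  rw [Module.finrank_prod] at e0 e1
  have e3 : Module.finrank F Y' = Module.finrank F Y := by omega
  exact ⟨Y, inferInstance, inferInstance, inferInstance, ⟨m0⟩, ⟨m1.tr (LinearEquiv.ofFinrankEq _ _ e3)⟩⟩

lemma recip_eff {f g : K} (hf0 : f ≠ 0) (hg0 : g ≠ 0) {sA sB : Finset (Place F K)} {A0 A1 B0 B1 : Dv F K}
    (hA0 : 0 ≤ A0) (hA1 : 0 ≤ A1) (hB0 : 0 ≤ B0) (hB1 : 0 ≤ B1)
    (hAs0 : ∀ w, w ∉ sA → A0 w = 0) (hAs1 : ∀ w, w ∉ sA → A1 w = 0)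
    (hBs0 : ∀ w, w ∉ sB → B0 w = 0) (hBs1 : ∀ w, w ∉ sB → B1 w = 0)
    (hf : dv F f = A0 - A1) (hg : dv F g = B0 - B1) (hd : ∀ w ∈ sB, w ∉ sA) :
    ev (fun w => w.chr f) (dv F g) = ev (fun w => w.chr g) (dv F f) := by
  obtain ⟨N, hN⟩ := riemann F K
  obtain ⟨w0⟩ := exists_place F K
  let G : Dv F K := Finsupp.single w0 (max N 0)
  have hGN : N ≤ dg G := by
    rw [dg_single]
    have : 1 ≤ (w0.deg : ℤ) := by exact_mod_cast w0.deg_pos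
    nlinarith [le_max_left N 0, le_max_right N 0]
  have hG : ∀ H, G ≤ H → ∀ w, Function.Surjective (lstep H w) := fun H hH => (hN H (hGN.trans (dg_mono hH))).2
  obtain ⟨X, _, _, _, ⟨a0⟩, ⟨a1⟩⟩ := exists_mdl_pair sA G hG A0 A1 hA0 hAs0 hA1 hAs1 hf0 hf
  obtain ⟨Y, _, _, _, ⟨b0⟩, ⟨b1⟩⟩ := exists_mdl_pair sB G hG B0 B1 hB0 hBs0 hB1 hBs1 hg0 hg
  have hd' : ∀ w ∈ sA, w ∉ sB := fun w h1 h2 => hd w h2 h1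
  obtain ⟨c, hc⟩ := block a0 a1 hA0 hA1 hAs0 hAs1 hf0 hf hd
  obtain ⟨d, hdd⟩ := block b0 b1 hB0 hB1 hBs0 hBs1 hg0 hg hd'
  obtain ⟨S0, hS0, n0, q0⟩ := hc B0 hB0 hBs0 Y b0
  obtain ⟨S1, hS1, n1, q1⟩ := hc B1 hB1 hBs1 Y b1
  obtain ⟨T0, hT0, r0, p0⟩ := hdd A0 hA0 hAs0 X a0
  obtain ⟨T1, hT1, r1, p1⟩ := hdd A1 hA1 hAs1 X a1
  let σ : ((Lsp G × Y) × X) ≃ₗ[F] ((Lsp G × X) × Y) :=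
    { toFun := fun z => ((z.1.1, z.2), z.1.2)
      invFun := fun z => ((z.1.1, z.2), z.1.2)
      left_inv := fun z => rfl
      right_inv := fun z => rfl
      map_add' := fun _ _ => rfl
      map_smul' := fun _ _ => rfl }
  have hσ : ∀ (s : X →ₗ[F] K) (t : Y →ₗ[F] K) z, Vc s t (σ z) = Vc t s z := by
    intro s t z; simp only [Vc, σ, LinearEquiv.coe_mk, LinearMap.coe_mk, AddHom.coe_mk]; ring
  have hcomm : S1 ∘ₗ ((σ : _ →ₗ[F] _) ∘ₗ T0 ∘ₗ (σ.symm : _ →ₗ[F] _)) = ((σ : _ →ₗ[F] _) ∘ₗ T1 ∘ₗ (σ.symm : _ →ₗ[F] _)) ∘ₗ S0 := by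
    apply LinearMap.ext
    intro z
    apply Vc_inj a1 b1 hA1 hAs1 hB1 hBs1 hd
    simp only [LinearMap.comp_apply, LinearEquiv.coe_coe]
    rw [hS1, hσ, hT0, hσ, hT1, ← hσ, ← hσ, σ.apply_symm_apply, σ.apply_symm_apply, hS0]
    ring
  have h := congrArg LinearMap.det hcomm
  rw [LinearMap.det_comp, LinearMap.det_comp, LinearMap.det_conj, LinearMap.det_conj] at h
  have h2 := congrArg qc h
  rw [qc_mul n1 r0, qc_mul r1 n0, q0, q1, p0, p1] at h2
  rw [hf, hg, map_sub, map_sub]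
  have : ∀ a b c d x y : ZMod 2, c + b + (d + x) = d + y + (c + a) → a - b = x - y := by decide
  exact this _ _ _ _ _ _ h2

lemma recip_disj {f g : K} (hf0 : f ≠ 0) (hg0 : g ≠ 0) (hd : ∀ w : Place F K, w.ord f = 0 ∨ w.ord g = 0) :
    ev (fun w => w.chr f) (dv F g) = ev (fun w => w.chr g) (dv F f) := by
  have key : ∀ f : K, ∃ A0 A1 : Dv F K, 0 ≤ A0 ∧ 0 ≤ A1 ∧ (∀ w, w ∉ (dv F f).support → A0 w = 0) ∧
      (∀ w, w ∉ (dv F f).support → A1 w = 0) ∧ dv F f = A0 - A1 := by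
    intro f
    refine ⟨(dv F f).mapRange (fun n => max n 0) (by simp), (dv F f).mapRange (fun n => max (-n) 0) (by simp), ?_, ?_, ?_, ?_, ?_⟩
    · intro w; simp
    · intro w; simp
    · intro w hw; have := Finsupp.notMem_support_iff.mp hw; simp only [Finsupp.mapRange_apply, this]; simp
    · intro w hw; have := Finsupp.notMem_support_iff.mp hw; simp only [Finsupp.mapRange_apply, this]; simp
    · ext w; simp only [Finsupp.sub_apply, Finsupp.mapRange_apply]; omega
  obtain ⟨A0, A1, h1, h2, h3, h4, h5⟩ := key f
  obtain ⟨B0, B1, i1, i2, i3, i4, i5⟩ := key g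
  refine recip_eff hf0 hg0 h1 h2 i1 i2 h3 h4 i3 i4 h5 i5 ?_
  intro w hw hw'
  rw [Finsupp.mem_support_iff, dv_apply] at hw hw'
  rcases hd w with h | h
  · exact hw' h
  · exact hw h

lemma exists_ords (s : Finset (Place F K)) (n : Place F K → ℤ) : ∃ x : K, x ≠ 0 ∧ ∀ w ∈ s, w.ord x = n w := by
  obtain ⟨x, hx, h⟩ := approx_coord s (fun w => w.pi ^ (n w)) (fun w _ => w.pi_zpow_ne _)
  exact ⟨x, hx, fun w hw => by rw [(h w hw).1, w.ord_pi_zpow]⟩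

lemma Place.ord_sub_lt (w : Place F K) {x y : K} (hx : x ≠ 0) (hy : y ≠ 0) (h : w.ord x < w.ord y) :
    x - y ≠ 0 ∧ w.ord (x - y) = w.ord x := by
  have := w.ord_eq_of_sub (x := x) (y := x - y) hx (Or.inr (by
    rw [show x - y - x = - y by ring, w.ord_neg]; omega))
  exact this

theorem recip {a b : K} (ha : a ≠ 0) (hb : b ≠ 0) (s : Finset (Place F K))
    (hs : ∀ w, w ∉ s → w.ord a = 0 ∧ w.ord b = 0) : ∑ w ∈ s, w.hs a b = 0 := by
  classical
  obtain ⟨w0⟩ := exists_place F K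
  obtain ⟨t, ht0, ht⟩ := exists_ords s (fun w => - (w.ord b / 2))
  set b' := b * t ^ 2 with hb'
  have hb'0 : b' ≠ 0 := mul_ne_zero hb (pow_ne_zero _ ht0)
  have hob : ∀ w ∈ s, w.ord b' = 0 ∨ w.ord b' = 1 := by
    intro w hw
    rw [hb', w.ord_mul _ _ hb (pow_ne_zero _ ht0), w.ord_pow, ht w hw]
    push_cast
    omega
  let Q := insert w0 (dv F b').support
  let k : Place F K → ℤ := fun w => if w.ord b' = 0 then 0 else - w.ord a
  have hk : ∀ w, Even (k w) ∨ w.ord b' = 1 := by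
    intro w
    by_cases hw : w ∈ s
    · rcases hob w hw with h | h
      · left; simp [k, h]
      · right; exact h
    · left
      simp [k, (hs w hw).1]
  obtain ⟨x, hx0, hx⟩ := exists_ords Q (fun w => if Even (k w) then k w / 2 else k w)
  obtain ⟨x1, hx10, hx1⟩ := exists_ords Q (fun w => if Even (k w) then k w / 2 else |k w| + 1)
  obtain ⟨y, hy0, hy⟩ := exists_ords Q (fun w => if Even (k w) then |k w| + |w.ord b'| + 1 else k w / 2)
  set n := x1 ^ 2 - b' * y ^ 2 with hn
  have hNw : ∀ w ∈ Q, n ≠ 0 ∧ w.ord n = k w := by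
    intro w hw
    have e1 : w.ord (x1 ^ 2) = 2 * w.ord x1 := by rw [w.ord_pow]; norm_num
    have e2 : w.ord (b' * y ^ 2) = w.ord b' + 2 * w.ord y := by
      rw [w.ord_mul _ _ hb'0 (pow_ne_zero _ hy0), w.ord_pow]; norm_num
    have f1 := hx1 w hw
    have f2 := hy w hw
    have g1 : x1 ^ 2 ≠ 0 := pow_ne_zero _ hx10
    have g2 : b' * y ^ 2 ≠ 0 := mul_ne_zero hb'0 (pow_ne_zero _ hy0)
    have a1 := neg_abs_le (k w)
    have a2 := le_abs_self (k w)
    have a3 := neg_abs_le (w.ord b')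
    have a4 := le_abs_self (w.ord b')
    by_cases hev : Even (k w)
    · simp only [hev, if_true] at f1 f2
      obtain ⟨r, hr⟩ := hev
      have := w.ord_sub_lt g1 g2 (by rw [e1, e2, f1, f2]; omega)
      rw [← hn] at this
      exact ⟨this.1, by rw [this.2, e1, f1]; omega⟩
    · have hb1 := (hk w).resolve_left hev
      simp only [hev, if_false] at f1 f2
      rw [Int.not_even_iff_odd] at hev
      obtain ⟨r, hr⟩ := hev
      have := w.ord_sub_lt g2 g1 (by rw [e1, e2, f1, f2]; omega)
      rw [show b' * y ^ 2 - x1 ^ 2 = - n by rw [hn]; ring, w.ord_neg] at this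
      exact ⟨fun h => this.1 (by rw [h, neg_zero]), by rw [this.2, e2, f2]; omega⟩
  have hn0 : n ≠ 0 := (hNw w0 (by simp [Q])).1
  set a' := a * n with ha'
  have ha'0 : a' ≠ 0 := mul_ne_zero ha hn0
  have hdisj : ∀ w : Place F K, w.ord a' = 0 ∨ w.ord b' = 0 := by
    intro w
    by_cases h : w.ord b' = 0
    · exact Or.inr h
    · left
      have := (hNw w (by simp [Q, h])).2
      rw [ha', w.ord_mul _ _ ha hn0, this]
      simp [k, h]
  have heq : ∀ w : Place F K, w.hs a' b' = w.hs a b := by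
    intro w
    rw [ha', w.hs_mul_left _ ha hn0, w.hs_norm hn0 hb'0 hn, add_zero, hb', w.hs_mul_right _ hb (pow_ne_zero _ ht0),
      w.hs_comm a (t ^ 2), w.hs_of_Nn (w.Nn_sq ht0), add_zero]
  let S := s ∪ (dv F a').support ∪ (dv F b').support
  have h1 : ∑ w ∈ s, w.hs a b = ∑ w ∈ S, w.hs a' b' := by
    rw [Finset.sum_congr rfl fun w (_ : w ∈ S) => heq w]
    apply Finset.sum_subset
    · intro w hw; simp [S, hw]
    · intro w _ hw
      exact w.hs_unit (hs w hw).1 (hs w hw).2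
  rw [h1]
  have h2 := recip_disj ha'0 hb'0 hdisj
  rw [ev_eq_sum _ _ S (fun w hw => by
      by_contra h; apply hw; simp only [S, Finset.mem_union, Finsupp.mem_support_iff]; right; exact h),
    ev_eq_sum _ (dv F a') S (fun w hw => by
      by_contra h; apply hw; simp only [S, Finset.mem_union, Finsupp.mem_support_iff]; left; right; exact h)] at h2
  have h3 : ∀ w ∈ S, w.hs a' b' = ((dv F a' w : ℤ) : ZMod 2) * w.chr b' + ((dv F b' w : ℤ) : ZMod 2) * w.chr a' := by
    intro w _
    unfold Place.hs Place.par
    rw [dv_apply, dv_apply]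
    rcases hdisj w with h | h <;> rw [h] <;> simp
  rw [Finset.sum_congr rfl h3, Finset.sum_add_distrib, h2, zmod2_add_self]

end NND

set_option linter.unusedSectionVars false
set_option linter.unusedVariables false
namespace NND
universe u

/-- `L = K(√c)` with conjugation -/
structure Quad {K L : Type*} [Field K] [Field L] [Algebra K L] (c : K) where
  d : L
  hd : d ^ 2 = algebraMap K L c
  rep : ∀ z : L, ∃ x y : K, z = algebraMap K L x + algebraMap K L y * d
  σ : L ≃ₐ[K] L
  σd : σ d = - d

namespace Quad
section
variable {K L : Type*} [Field K] [Field L] [Algebra K L] {c : K} (Q : Quad (L := L) c)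

lemma d_ne (hc : c ≠ 0) : Q.d ≠ 0 := by
  intro h
  have := Q.hd
  rw [h] at this
  rw [zero_pow two_ne_zero] at this
  exact hc ((map_eq_zero _).mp this.symm)

lemma σσ (z : L) : Q.σ (Q.σ z) = z := by
  obtain ⟨x, y, rfl⟩ := Q.rep z
  simp [Q.σd]

/-- the norm as an element of `K` -/
lemma nrm (z : L) : ∃ x y : K, z * Q.σ z = algebraMap K L (x ^ 2 - c * y ^ 2) ∧ z = algebraMap K L x + algebraMap K L y * Q.d := by
  obtain ⟨x, y, rfl⟩ := Q.rep z
  refine ⟨x, y, ?_, rfl⟩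
  simp only [map_add, map_mul, AlgEquiv.commutes, Q.σd, map_sub, map_pow, ← Q.hd]
  ring

lemma fixed (h2 : (2 : K) ≠ 0) (hc : c ≠ 0) {z : L} (h : Q.σ z = z) : ∃ x : K, z = algebraMap K L x := by
  obtain ⟨x, y, rfl⟩ := Q.rep z
  simp only [map_add, map_mul, AlgEquiv.commutes, Q.σd] at h
  have : (algebraMap K L 2) * (algebraMap K L y * Q.d) = 0 := by
    rw [map_ofNat]; linear_combination -h
  have h2' : algebraMap K L 2 ≠ 0 := by simpa using h2
  rcases mul_eq_zero.mp this with h | h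
  · exact absurd h h2'
  · exact ⟨x, by rw [h, add_zero]⟩

lemma not_sq (Q : Quad (L := L) c) (h2 : (2 : K) ≠ 0) (hc : c ≠ 0) : ¬ IsSquare c := by
  rintro ⟨r, hr⟩
  have h := Q.hd
  replace h : Q.d ^ 2 = (algebraMap K L r) ^ 2 := by rw [h, hr, map_mul, pow_two]
  have h2' : algebraMap K L 2 ≠ 0 := by simpa using h2
  have e : Q.σ Q.d = Q.d := by
    rcases sq_eq_sq_iff_eq_or_eq_neg.mp h with h | h
    · rw [h]; simp
    · rw [h]; simp
  rw [Q.σd] at e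
  have : (algebraMap K L 2) * Q.d = 0 := by rw [map_ofNat]; linear_combination - e
  rcases mul_eq_zero.mp this with h | h
  · exact absurd h h2'
  · exact Q.d_ne hc h

end

section
variable {F K L : Type*} [Field F] [Field K] [Field L] [Algebra F K] [Algebra F L] [Algebra K L]
  [IsScalarTower F K L] {c : K} (Q : Quad (L := L) c)

def conj (W : Place F L) : Place F L where
  ord z := W.ord (Q.σ z)
  ord_zero := by simp [W.ord_zero]
  ord_mul x y hx hy := by
    rw [map_mul]; exact W.ord_mul _ _ (by simpa using hx) (by simpa using hy)
  ord_add x y hx hy h := by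
    rw [map_add]
    exact W.ord_add _ _ (by simpa using hx) (by simpa using hy) (by rw [← map_add]; exact (map_ne_zero _).mpr h)
  ord_surj := by
    obtain ⟨x, hx, h⟩ := W.ord_surj
    exact ⟨Q.σ x, by simpa using hx, by rw [Q.σσ, h]⟩
  ord_alg a := by
    rw [IsScalarTower.algebraMap_apply F K L, AlgEquiv.commutes, ← IsScalarTower.algebraMap_apply F K L, W.ord_alg]

@[simp] lemma conj_ord (W : Place F L) (z : L) : (Q.conj W).ord z = W.ord (Q.σ z) := rfl

lemma conj_conj (W : Place F L) : Q.conj (Q.conj W) = W := by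
  ext z; simp [Q.σσ]

lemma conj_ge (W : Place F L) (n : ℤ) (z : L) : (Q.conj W).ge n z ↔ W.ge n (Q.σ z) := by
  simp [Place.ge]

end
end Quad

section
variable {F K L : Type*} [Field F] [Field K] [Field L] [Algebra F K] [Algebra F L] [Algebra K L]
  [IsScalarTower F K L]

def Above (W : Place F L) (w : Place F K) : Prop :=
  ∃ e : ℤ, 0 < e ∧ ∀ x : K, W.ord (algebraMap K L x) = e * w.ord x

lemma Above.ge_iff {W : Place F L} {w : Place F K} (h : Above W w) (x : K) :
    W.ge 1 (algebraMap K L x) ↔ w.ge 1 x := by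
  obtain ⟨e, he, h⟩ := h
  unfold Place.ge
  rw [h, map_eq_zero]
  refine or_congr Iff.rfl ⟨fun h => ?_, fun h => ?_⟩ <;> nlinarith

lemma Above.ge0_iff {W : Place F L} {w : Place F K} (h : Above W w) (x : K) :
    W.ge 0 (algebraMap K L x) ↔ w.ge 0 x := by
  obtain ⟨e, he, h⟩ := h
  unfold Place.ge
  rw [h, map_eq_zero]
  refine or_congr Iff.rfl ⟨fun h => ?_, fun h => ?_⟩ <;> nlinarith

lemma Above.unique {W : Place F L} {w w' : Place F K} (h : Above W w) (h' : Above W w') : w = w' := by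
  apply Place.eq_of_le
  intro x hx h0
  exact ((w'.ge_iff hx).mp ((h'.ge0_iff x).mp ((h.ge0_iff x).mpr (Or.inr h0))))

lemma Above.ord_eq_zero_iff {W : Place F L} {w : Place F K} (h : Above W w) (x : K) :
    W.ord (algebraMap K L x) = 0 ↔ w.ord x = 0 := by
  obtain ⟨e, he, h⟩ := h
  rw [h]
  constructor
  · intro h; rcases mul_eq_zero.mp h with h | h
    · omega
    · exact h
  · intro h; rw [h, mul_zero]

lemma exists_above [GFF F L] (w : Place F K) : ∃ W : Place F L, Above W w := by
  obtain ⟨p, hp0, hp⟩ := w.ord_surj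
  let i : K →ₐ[F] L := IsScalarTower.toAlgHom F K L
  have hi : ∀ x, i x = algebraMap K L x := fun x => rfl
  let A : Subalgebra F K := 
    { carrier := {x | w.ge 0 x}
      mul_mem' := fun ha hb => by simpa using w.ge_mul ha hb
      add_mem' := fun ha hb => w.ge_add ha hb
      algebraMap_mem' := w.ge_alg }
  have hA : ∀ x, x ∈ A ↔ w.ge 0 x := fun x => Iff.rfl
  obtain ⟨W, hW, hz⟩ := exists_place_of_not_integral (F := F) (A.map i) (z := i p⁻¹) (by
    intro h
    have := mem_of_integral_of_inv_mem _ h (by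
      rw [← map_inv₀, inv_inv]
      exact ⟨p, (Or.inr (by omega) : w.ge 0 p), rfl⟩)
    obtain ⟨x, hx, hxe⟩ := this
    have : x = p⁻¹ := i.injective hxe
    subst this
    have hx : w.ge 0 p⁻¹ := hx
    rw [w.ge_iff (inv_ne_zero hp0), w.ord_inv] at hx
    omega)
  refine ⟨W, W.ord (i p), ?_, fun x => ?_⟩
  · rw [map_inv₀, W.ord_inv] at hz; omega
  · by_cases hx : x = 0
    · subst hx; simp [W.ord_zero, w.ord_zero]
    · exact w.ord_eq_mul_of_le (algebraMap K L) W.ord_mul (fun x hx h0 => hW _ ⟨x, (hA x).mpr (Or.inr h0), rfl⟩) p hp0 hp x hx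

variable {c : K} (Q : Quad (L := L) c)

lemma exists_below (Q : Quad (L := L) c) (W : Place F L) : ∃ w : Place F K, Above W w := by
  classical
  have hex : ∃ n : ℕ, 0 < n ∧ ∃ x : K, x ≠ 0 ∧ W.ord (algebraMap K L x) = n := by
    by_contra hcon
    push Not at hcon
    have h0 : ∀ x : K, W.ord (algebraMap K L x) = 0 := by
      intro x
      by_cases hx : x = 0
      · subst hx; simp [W.ord_zero]
      by_contra h
      rcases lt_or_gt_of_ne h with h | h
      · apply hcon (W.ord (algebraMap K L x⁻¹)).natAbs (by rw [map_inv₀, W.ord_inv]; omega) x⁻¹ (inv_ne_zero hx)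
        rw [map_inv₀, W.ord_inv]; omega
      · apply hcon (W.ord (algebraMap K L x)).natAbs (by omega) x hx
        omega
    obtain ⟨t, ht0, ht⟩ := W.ord_surj
    obtain ⟨x, y, hn, hr⟩ := Q.nrm t
    have hσ : Q.σ t ≠ 0 := by simpa using ht0
    have e : Q.σ t = algebraMap K L (2 * x) - t := by
      rw [hr]; simp [Q.σd, map_ofNat]; ring
    have g : W.ge 1 (t * Q.σ t) := by
      rw [e, ← add_zero (1:ℤ)]
      apply W.ge_mul (Or.inr (by omega))
      exact W.ge_sub (Or.inr (by rw [h0])) (Or.inr (by omega))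
    rcases g with g | g
    · exact mul_ne_zero ht0 hσ g
    · rw [hn, h0] at g; omega
  obtain ⟨he, p, hp0, hp⟩ := Nat.find_spec hex
  have hmin := fun m => Nat.find_min (m := m) hex
  set e := Nat.find hex
  have hpi : algebraMap K L p ≠ 0 := by simpa using hp0
  have hdvd : ∀ x : K, (e : ℤ) ∣ W.ord (algebraMap K L x) := by
    intro x
    by_cases hx : x = 0
    · subst hx; simp [W.ord_zero]
    have hxi : algebraMap K L x ≠ 0 := by simpa using hx
    by_contra hnd
    set n := W.ord (algebraMap K L x)
    have h1 := Int.emod_nonneg n (b := e) (by omega)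
    have h2 := Int.emod_lt_of_pos n (b := e) (by omega)
    have h3 : n % e ≠ 0 := fun h => hnd (Int.dvd_of_emod_eq_zero h)
    apply hmin (n % e).toNat (by omega)
    refine ⟨by omega, x / p ^ (n / e), div_ne_zero hx (zpow_ne_zero _ hp0), ?_⟩
    rw [map_div₀, map_zpow₀, W.ord_div _ _ hxi (zpow_ne_zero _ hpi), W.ord_zpow, hp]
    have := Int.emod_add_mul_ediv n e
    rw [Int.toNat_of_nonneg h1]
    change n - _ = _
    linarith
  refine ⟨⟨fun x => W.ord (algebraMap K L x) / e, by simp [W.ord_zero], ?_, ?_, ⟨p, hp0, ?_⟩, ?_⟩, e, by omega, fun x => ?_⟩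
  · intro x y hx hy
    rw [map_mul, W.ord_mul _ _ (by simpa using hx) (by simpa using hy), Int.add_ediv_of_dvd_left (hdvd x)]
  · intro x y hx hy hxy
    have := W.ord_add (algebraMap K L x) (algebraMap K L y) (by simpa using hx) (by simpa using hy) (by rw [← map_add]; exact (map_ne_zero _).mpr hxy)
    rw [← map_add] at this
    rcases min_le_iff.mp this with h | h
    · exact min_le_iff.mpr (Or.inl (Int.ediv_le_ediv (by omega) h))
    · exact min_le_iff.mpr (Or.inr (Int.ediv_le_ediv (by omega) h))
  · rw [hp]; exact Int.ediv_self (by omega)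
  · intro a; rw [← IsScalarTower.algebraMap_apply F K L, W.ord_alg]; simp
  · exact (Int.mul_ediv_cancel' (hdvd x)).symm

lemma Quad.gff (Q : Quad (L := L) c) [GFF F K] : GFF F L := by
  classical
  have : Module.Finite K L := by
    refine ⟨⟨{1, Q.d}, ?_⟩⟩
    rw [eq_top_iff]
    rintro z -
    obtain ⟨x, y, rfl⟩ := Q.rep z
    apply add_mem
    · rw [Algebra.algebraMap_eq_smul_one]; exact Submodule.smul_mem _ _ (Submodule.subset_span (by simp))
    · rw [← Algebra.smul_def]; exact Submodule.smul_mem _ _ (Submodule.subset_span (by simp))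
  have h1 : Algebra.EssFiniteType F K := GFF.ess
  refine ⟨Algebra.EssFiniteType.comp F K L, ?_⟩
  have h := lift_trdeg_add_eq F K L
  rw [GFF.trd (F := F) (K := K), trdeg_eq_zero (R := K) (A := L)] at h
  simpa using h.symm

lemma Above.conj {W : Place F L} {w : Place F K} (h : Above W w) : Above (Q.conj W) w := by
  obtain ⟨e, he, h⟩ := h
  exact ⟨e, he, fun x => by rw [Q.conj_ord, AlgEquiv.commutes, h]⟩

lemma Above.eq_or [GFF F K] {W W' : Place F L} {w : Place F K} (h : Above W w) (h' : Above W' w) :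
    W' = W ∨ W' = Q.conj W := by
  classical
  by_contra hcon
  push Not at hcon
  obtain ⟨c1, c2⟩ := hcon
  have c3 : Q.conj W' ≠ W := fun h => c2 (by rw [← h, Q.conj_conj])
  have c4 : Q.conj W' ≠ Q.conj W := fun h => c1 (by rw [← Q.conj_conj W, ← h, Q.conj_conj])
  obtain ⟨z, hz⟩ := Place.weak_approx {W, Q.conj W, W', Q.conj W'} (fun V => if V = W ∨ V = Q.conj W then 1 else 0) (fun _ => 1)
  have z1 := hz W (by simp)
  have z2 := hz (Q.conj W) (by simp)
  have z3 := hz W' (by simp)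
  have z4 := hz (Q.conj W') (by simp)
  simp only [true_or, or_true, if_true, c1, c2, c3, c4, or_false, if_false, sub_zero, Q.conj_ge] at z1 z2 z3 z4
  rw [map_sub, map_one] at z2
  obtain ⟨x, y, hn, hr⟩ := Q.nrm z
  have e1 := W.ord_eq_of_sub one_ne_zero (by simpa using z1)
  have e2 := W.ord_eq_of_sub one_ne_zero (by simpa using z2)
  have g := W'.ge_mul z3 z4
  have e3 := W.ord_mul _ _ e1.1 e2.1
  rw [hn] at g e3
  rw [e1.2, e2.2, W.ord_one, add_zero, h.ord_eq_zero_iff] at e3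
  have g' := (h'.ge_iff _).mp (W'.ge_mono (by omega) g)
  rcases g' with g' | g'
  · rw [g', map_zero] at hn
    exact mul_ne_zero e1.1 e2.1 hn
  · omega

lemma Place.ord_two (h2 : (2 : F) ≠ 0) (w : Place F K) : (2 : K) ≠ 0 ∧ w.ord 2 = 0 := by
  have : (2 : K) = algebraMap F K 2 := (map_ofNat _ 2).symm
  refine ⟨by rw [this]; simpa using h2, by rw [this, w.ord_alg]⟩

lemma Place.ge_of_two (h2 : (2 : F) ≠ 0) (w : Place F K) {n : ℤ} {x : K} (h : w.ge n (2 * x)) : w.ge n x := by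
  obtain ⟨a, b⟩ := w.ord_two h2
  rw [w.ge_mul_iff a, b, sub_zero] at h
  exact h

lemma Above.ord_d {W : Place F L} {w : Place F K} (h : Above W w) (hwc : w.ord c = 0) : W.ord Q.d = 0 := by
  have h1 := (h.ord_eq_zero_iff c).mpr hwc
  rw [← Q.hd, W.ord_pow] at h1
  push_cast at h1; omega

lemma Above.ord_eq (Q : Quad (L := L) c) (h2 : (2 : F) ≠ 0) [Finite F] [GFF F K] {W : Place F L} {w : Place F K} (h : Above W w) (hc : c ≠ 0)
    (hwc : w.ord c = 0) (x : K) : W.ord (algebraMap K L x) = w.ord x := by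
  classical
  have := Q.gff (F := F)
  obtain ⟨e, he, hx⟩ := id h
  suffices e = 1 by rw [hx, this, one_mul]
  have hd := h.ord_d Q hwc
  by_cases hW : Q.conj W = W
  · obtain ⟨z, hz0, hz⟩ := W.ord_surj
    have hz' : W.ord (Q.σ z) = 1 := by rw [← Q.conj_ord, hW, hz]
    obtain ⟨x, y, hr⟩ := Q.rep z
    have hs : Q.σ z = algebraMap K L x - algebraMap K L y * Q.d := by rw [hr]; simp [Q.σd]; ring
    have g1 : W.ge 1 (algebraMap K L x) := by
      apply W.ge_of_two h2
      have := W.ge_add (x := z) (y := Q.σ z) (n := 1) (Or.inr hz.ge) (Or.inr hz'.ge)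
      convert this using 1
      rw [hs]; rw [hr]; ring
    have g2 : W.ge 1 (algebraMap K L y) := by
      have : W.ge 1 (Q.d * algebraMap K L y) := by
        apply W.ge_of_two h2
        have := W.ge_sub (x := z) (y := Q.σ z) (n := 1) (Or.inr hz.ge) (Or.inr hz'.ge)
        convert this using 1
        rw [hs]; rw [hr]; ring
      rw [W.ge_mul_iff (Q.d_ne hc), hd, sub_zero] at this
      exact this
    have up : ∀ x : K, W.ge 1 (algebraMap K L x) → W.ge e (algebraMap K L x) := by
      intro x g
      rw [h.ge_iff] at g
      rcases g with g | g
      · left; simp [g]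
      · right; rw [hx]; nlinarith
    have : W.ge e z := by
      rw [hr]
      apply W.ge_add (up x g1)
      have := W.ge_mul (up y g2) (y := Q.d) (n := 0) (Or.inr hd.ge)
      simpa using this
    rw [W.ge_iff hz0] at this
    omega
  · obtain ⟨z, hz0, hz⟩ := exists_ords (F := F) (K := L) {W, Q.conj W} (fun V => if V = W then 1 else 0)
    have z1 := hz W (by simp)
    have z2 := hz (Q.conj W) (by simp)
    simp only [if_true, hW, if_false, Q.conj_ord] at z1 z2
    obtain ⟨x, y, hn, hr⟩ := Q.nrm z
    have := W.ord_mul z (Q.σ z) hz0 (by simpa using hz0)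
    rw [hn, hx, z1, z2] at this
    have h' : e ∣ 1 := ⟨_, by linarith⟩
    exact Int.eq_one_of_dvd_one he.le h'

lemma Place.ge_or_of_sq (W : Place F L) {u : L} (h : W.ge 1 (u ^ 2 - 1)) : W.ge 1 (u - 1) ∨ W.ge 1 (u + 1) := by
  have hh : W.ge 1 ((u - 1) * (u + 1)) := by convert h using 1; ring
  by_contra hcon
  push Not at hcon
  obtain ⟨a, b⟩ := hcon
  rw [W.not_ge_iff] at a b
  rcases hh with hh | hh
  · exact mul_ne_zero a.1 b.1 hh
  · rw [W.ord_mul _ _ a.1 b.1] at hh; omega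

/-- if `c ∈ N_w` then `√c` is congruent to an element of K -/
lemma Above.d_congr [Finite F] [GFF F K] {W : Place F L} {w : Place F K} (h : Above W w) (hc : c ≠ 0)
    (hN : w.Nn c) : ∃ δ : K, δ ≠ 0 ∧ W.ge 1 (Q.d / algebraMap K L δ - 1) := by
  obtain ⟨δ, hδ, hg⟩ := Place.Nn.exists_sq w hc hN
  rw [← h.ge_iff, map_sub, map_div₀, map_pow, ← Q.hd, ← div_pow, map_one] at hg
  rcases W.ge_or_of_sq hg with h | h
  · exact ⟨δ, hδ, h⟩
  · refine ⟨-δ, neg_ne_zero.mpr hδ, ?_⟩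
    have := W.ge_neg h
    convert this using 1
    rw [map_neg, div_neg]; ring

lemma Above.conj_ne (h2 : (2 : F) ≠ 0) [Finite F] [GFF F K] {W : Place F L} {w : Place F K} (h : Above W w) (hc : c ≠ 0)
    (hN : w.Nn c) : Q.conj W ≠ W := by
  intro he
  obtain ⟨δ, hδ, hg⟩ := h.d_congr Q hc hN
  have hg' := hg
  rw [← he, Q.conj_ge, map_sub, map_div₀, AlgEquiv.commutes, Q.σd, map_one] at hg'
  have g3 : W.ge 1 (2 * (1 : L)) := by
    have := W.ge_neg (W.ge_add hg hg')
    convert this using 1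
    ring
  have := W.ge_of_two h2 g3
  rw [W.ge_iff one_ne_zero, W.ord_one] at this
  omega

lemma Above.res (Q : Quad (L := L) c) (h2 : (2 : F) ≠ 0) [Finite F] [GFF F K] {W : Place F L} {w : Place F K} (h : Above W w) (hc : c ≠ 0)
    (hN : w.Nn c) {z : L} (hz : W.ge 0 z) : ∃ x : K, W.ge 1 (z - algebraMap K L x) := by
  classical
  have hne := h.conj_ne Q h2 hc hN
  obtain ⟨δ, hδ, hg⟩ := h.d_congr Q hc hN
  have hδ' : algebraMap K L δ ≠ 0 := by simpa using hδ
  obtain ⟨z', hz'⟩ := Place.weak_approx {W, Q.conj W} (fun V => if V = W then z else 0) (fun _ => 1)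
  have z1 := hz' W (by simp)
  have z2 := hz' (Q.conj W) (by simp)
  simp only [if_true, hne, if_false, sub_zero, Q.conj_ge] at z1 z2
  have z3 : W.ge 0 z' := by
    have := W.ge_add (W.ge_mono (by omega) z1) hz
    simpa using this
  obtain ⟨x, y, hr⟩ := Q.rep z'
  have hs : Q.σ z' = algebraMap K L x - algebraMap K L y * Q.d := by rw [hr]; simp [Q.σd]; ring
  obtain ⟨u0, uo⟩ := W.ord_eq_of_sub one_ne_zero (by simpa using hg)
  have g2 : W.ge 0 (algebraMap K L (y * δ)) := by
    have : W.ge 0 ((Q.d / algebraMap K L δ) * algebraMap K L (y * δ)) := by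
      apply W.ge_of_two h2
      have := W.ge_sub (x := z') (y := Q.σ z') (n := 0) z3 (W.ge_mono (by omega) z2)
      convert this using 1
      rw [hs]; nth_rw 1 [hr]; rw [map_mul]; field_simp; ring
    rw [W.ge_mul_iff u0, uo, W.ord_one, sub_zero] at this
    exact this
  refine ⟨x + y * δ, ?_⟩
  have := W.ge_add (W.ge_sub_comm z1) (by simpa using W.ge_mul g2 hg)
  convert this using 1
  nth_rw 1 [hr]
  simp only [map_add, map_mul]; field_simp; ring

lemma Above.Nn_up [Finite F] [GFF F K] [GFF F L] {W : Place F L} {w : Place F K} (h : Above W w) {a : K} (ha : a ≠ 0)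
    (hN : w.Nn a) : W.Nn (algebraMap K L a) := by
  obtain ⟨δ, hδ, hg⟩ := Place.Nn.exists_sq w ha hN
  rw [← h.ge_iff, map_sub, map_div₀, map_pow, map_one] at hg
  exact W.Nn_of_sq (by simpa using hδ) hg

lemma Above.Nn_down (Q : Quad (L := L) c) (h2 : (2 : F) ≠ 0) [Finite F] [GFF F K] [GFF F L] {W : Place F L} {w : Place F K} (h : Above W w) (hc : c ≠ 0)
    (hwc : w.ord c = 0) (hN : w.Nn c) {a : K} (ha : a ≠ 0)
    (hNa : W.Nn (algebraMap K L a)) : w.Nn a := by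
  have ha' : algebraMap K L a ≠ 0 := by simpa using ha
  obtain ⟨D, hD, hg⟩ := Place.Nn.exists_sq W ha' hNa
  obtain ⟨p, hp0, hp⟩ := w.ord_surj
  have hpW : W.ord (algebraMap K L p) = 1 := by rw [h.ord_eq Q h2 hc hwc, hp]
  have hp' : algebraMap K L p ≠ 0 := by simpa using hp0
  set r := p ^ (W.ord D)
  have hr0 : r ≠ 0 := zpow_ne_zero _ hp0
  have hr' : algebraMap K L r ≠ 0 := by simpa using hr0
  have hr : W.ord (algebraMap K L r) = W.ord D := by
    rw [map_zpow₀, W.ord_zpow, hpW, mul_one]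
  have hD'0 : D / algebraMap K L r ≠ 0 := div_ne_zero hD hr'
  have hD' : W.ord (D / algebraMap K L r) = 0 := by rw [W.ord_div _ _ hD hr', hr, sub_self]
  obtain ⟨x, hx⟩ := h.res Q h2 hc hN (z := D / algebraMap K L r) (Or.inr hD'.ge)
  have hx1 := W.ord_eq_of_sub hD'0 (by rw [hD']; exact W.ge_sub_comm hx)
  have hx0 : x ≠ 0 := by simpa using hx1.1
  -- a ~ D^2 ~ (r x)^2
  apply w.Nn_of_sq (d := r * x) (mul_ne_zero hr0 hx0)
  rw [← h.ge_iff]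
  have hu := W.ord_eq_of_sub one_ne_zero (by simpa using hg)
  have e : algebraMap K L (a / (r * x) ^ 2 - 1) =
      (algebraMap K L a / D ^ 2 - 1) * ((D / algebraMap K L r) / algebraMap K L x) ^ 2
      + ((D / algebraMap K L r) / algebraMap K L x - 1) * ((D / algebraMap K L r) / algebraMap K L x + 1) := by
    have := hx1.1
    simp only [map_sub, map_div₀, map_pow, map_mul, map_one]
    field_simp
    ring
  have hv0 : (D / algebraMap K L r) / algebraMap K L x ≠ 0 := div_ne_zero hD'0 hx1.1
  have hv : W.ord ((D / algebraMap K L r) / algebraMap K L x) = 0 := by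
    rw [W.ord_div _ _ hD'0 hx1.1, hx1.2, sub_self]
  have hv1 : W.ge 1 ((D / algebraMap K L r) / algebraMap K L x - 1) := by
    have : W.ge 1 (algebraMap K L x * ((D / algebraMap K L r) / algebraMap K L x - 1)) := by
      convert hx using 1
      have := hx1.1
      field_simp
    rw [W.ge_mul_iff hx1.1, hx1.2, hD'] at this
    simpa using this
  rw [e]
  apply W.ge_add
  · have := W.ge_mul hg (y := ((D / algebraMap K L r) / algebraMap K L x) ^ 2) (n := 0) (Or.inr (by rw [W.ord_pow, hv, mul_zero]))
    simpa using this
  · have := W.ge_mul hv1 (y := ((D / algebraMap K L r) / algebraMap K L x) + 1) (n := 0) (W.ge_add (Or.inr hv.ge) W.ge_one)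
    simpa using this

end

section
variable {F : Type*} {K : Type u} [Field F] [Field K] [Algebra F K]

/-- existence of quadratic extensions -/
lemma exists_quad (h2 : (2 : F) ≠ 0) {c : K} (hc : ¬ IsSquare c) :
    ∃ (L : Type u) (_ : Field L) (_ : Algebra F L) (_ : Algebra K L) (_ : IsScalarTower F K L),
      Nonempty (Quad (L := L) c) := by
  have : Fact (∀ r : K, r ^ 2 ≠ c + 0 * r) := ⟨fun r h => hc ⟨r, by rw [← pow_two, h]; ring⟩⟩
  let σ : QuadraticAlgebra K c 0 ≃ₐ[K] QuadraticAlgebra K c 0 := 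
    { toFun := fun z => ⟨z.re, -z.im⟩
      invFun := fun z => ⟨z.re, -z.im⟩
      left_inv := fun z => by simp
      right_inv := fun z => by simp
      map_mul' := fun x y => by ext <;> simp; ring
      map_add' := fun x y => by ext <;> simp; ring
      commutes' := fun r => by ext <;> simp }
  refine ⟨QuadraticAlgebra K c 0, inferInstance, inferInstance, inferInstance, inferInstance, ⟨⟨⟨0, 1⟩, ?_, ?_, σ, ?_⟩⟩⟩
  · rw [pow_two]; ext <;> simp
  · intro z
    refine ⟨z.re, z.im, ?_⟩
    ext <;> simp
  · ext <;> simp [σ]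

end
end NND

set_option linter.unusedSectionVars false
set_option linter.unusedVariables false
namespace NND
universe u

def Spid {F K : Type*} [Field F] [Field K] [Algebra F K] (S : Finset (Place F K)) : Prop :=
  ∀ D : Dv F K, ∃ r : K, r ≠ 0 ∧ ∀ w, w ∉ S → w.ord r = D w

lemma exists_Spid {F K : Type*} [Field F] [Field K] [Algebra F K] [Finite F] [GFF F K] :
    ∃ S0 : Finset (Place F K), S0.Nonempty ∧ ∀ S : Finset (Place F K), S0 ⊆ S → Spid S := spid F K

section
variable {K L : Type*} [Field K] [Field L] [Algebra K L] {c : K} (Q : Quad (L := L) c)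

noncomputable def Quad.nu : L →* K where
  toFun z := (Q.nrm z).choose ^ 2 - c * (Q.nrm z).choose_spec.choose ^ 2
  map_one' := by
    apply (algebraMap K L).injective
    rw [← (Q.nrm 1).choose_spec.choose_spec.1]
    simp
  map_mul' x y := by
    apply (algebraMap K L).injective
    have h1 := (Q.nrm x).choose_spec.choose_spec.1
    have h2 := (Q.nrm y).choose_spec.choose_spec.1
    have h3 := (Q.nrm (x * y)).choose_spec.choose_spec.1
    refine h3.symm.trans ?_
    refine Eq.trans ?_ (((congrArg₂ (· * ·) h1 h2)).trans (map_mul (algebraMap K L) _ _).symm)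
    simp only [map_mul]; ring

lemma Quad.nu_spec (z : L) : algebraMap K L (Q.nu z) = z * Q.σ z :=
  (Q.nrm z).choose_spec.choose_spec.1.symm

lemma Quad.nu_rep (z : L) : ∃ x y : K, Q.nu z = x ^ 2 - c * y ^ 2 := ⟨_, _, rfl⟩
end

section
variable {F K : Type*} [Field F] [Field K] [Algebra F K]

/-- S-units that are norms from `K(√c)` -/
def NU (S : Finset (Place F K)) (c : K) : Subgroup Kˣ where
  carrier := {u | u ∈ SU S ∧ ∃ x y : K, (u : K) = x ^ 2 - c * y ^ 2}
  one_mem' := ⟨one_mem _, 1, 0, by simp⟩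
  mul_mem' := by
    rintro u v ⟨hu, x, y, h⟩ ⟨hv, x', y', h'⟩
    exact ⟨mul_mem hu hv, x * x' + c * y * y', x * y' + y * x', by rw [Units.val_mul, h, h']; ring⟩
  inv_mem' := by
    rintro u ⟨hu, x, y, h⟩
    refine ⟨inv_mem hu, x / u, y / u, ?_⟩
    have : (u : K) ≠ 0 := u.ne_zero
    rw [Units.val_inv_eq_inv_val, div_pow, div_pow]
    field_simp
    exact h

lemma mem_NU {S : Finset (Place F K)} {c : K} {u : Kˣ} : u ∈ NU S c ↔ u ∈ SU S ∧ ∃ x y : K, (u : K) = x ^ 2 - c * y ^ 2 := Iff.rfl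

end

section
variable {F K L : Type*} [Field F] [Field K] [Field L] [Algebra F K] [Algebra F L] [Algebra K L]
  [IsScalarTower F K L] {c : K} [Finite F] [GFF F K]

/-- the finite set of places above a finite set -/
lemma exists_SL (Q : Quad (L := L) c) (hc : c ≠ 0) (h2 : (2 : F) ≠ 0) (S : Finset (Place F K)) :
    ∃ SL : Finset (Place F L), (∀ W, W ∈ SL ↔ ∃ w ∈ S, Above W w) ∧
      ∀ S' ⊆ S, (∀ s ∈ S, s ∉ S' → s.Nn c) → 2 * S.card ≤ SL.card + S'.card := by
  classical
  have := Q.gff (F := F)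
  choose V hV using fun w : Place F K => exists_above (F := F) (L := L) w
  refine ⟨S.biUnion (fun w => {V w, Q.conj (V w)}), ?_, ?_⟩
  · intro W
    simp only [Finset.mem_biUnion, Finset.mem_insert, Finset.mem_singleton]
    refine exists_congr fun w => and_congr_right fun hw => ?_
    constructor
    · rintro (rfl | rfl)
      · exact hV w
      · exact (hV w).conj Q
    · intro h
      exact (hV w).eq_or Q h
  · intro S' hS' h
    rw [Finset.card_biUnion]
    · have h1 : S'.card = ∑ s ∈ S, if s ∈ S' then 1 else 0 := by
        rw [Finset.sum_ite_mem, Finset.inter_eq_right.mpr hS']; simp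
      rw [h1, ← Finset.sum_add_distrib, mul_comm, ← smul_eq_mul, ← Finset.sum_const]
      apply Finset.sum_le_sum
      intro s hs
      by_cases hs' : s ∈ S'
      · have : 0 < Finset.card {V s, Q.conj (V s)} := Finset.card_pos.mpr (by simp)
        simp only [hs', if_true]; omega
      · have := (hV s).conj_ne Q h2 hc (h s hs hs')
        rw [Finset.card_pair this.symm]
        omega
    · intro s hs s' hs' hne
      rw [Function.onFun, Finset.disjoint_left]
      intro W hW hW'
      apply hne
      simp only [Finset.mem_insert, Finset.mem_singleton] at hW hW'
      have a : Above W s := by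
        rcases hW with rfl | rfl
        · exact hV s
        · exact (hV s).conj Q
      have b : Above W s' := by
        rcases hW' with h | h
        · rw [h]; exact hV s'
        · rw [h]; exact (hV s').conj Q
      exact a.unique b

lemma UC_aux (Q : Quad (L := L) c) (hc : c ≠ 0) (h2 : (2 : F) ≠ 0) (S : Finset (Place F K)) (hSn : S.Nonempty)
    (hS : Spid S) (hcS : ∀ w, w ∉ S → w.ord c = 0) (S' : Finset (Place F K)) (hS' : S' ⊆ S)
    (hN : ∀ s ∈ S, s ∉ S' → s.Nn c) :
    2 ^ (S.card + 1) ≤ 2 ^ S'.card * (SU2 S).relIndex (NU S c) := by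
  classical
  have := Q.gff (F := F)
  obtain ⟨SL, hSL, hcard⟩ := exists_SL Q hc h2 S
  specialize hcard S' hS' hN
  choose V hV using fun w : Place F K => exists_above (F := F) (L := L) w
  let ν : Lˣ →* Kˣ := Units.map Q.nu
  have hν : ∀ z : Lˣ, algebraMap K L (ν z : K) = z * Q.σ z := fun z => Q.nu_spec z
  let ι : Kˣ →* Lˣ := Units.map (algebraMap K L).toMonoidHom
  have hι : ∀ x : Kˣ, (ι x : L) = algebraMap K L x := fun x => rfl
  have hιinj : Function.Injective ι := Units.map_injective (algebraMap K L).injective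
  have hSLn : SL.Nonempty := by
    obtain ⟨s, hs⟩ := hSn
    exact ⟨V s, (hSL _).mpr ⟨s, hs, hV s⟩⟩
  have hVn : ∀ w, w ∉ S → ∀ W, Above W w → W ∉ SL := by
    intro w hw W hW h
    obtain ⟨w', hw', h'⟩ := (hSL W).mp h
    rw [hW.unique h'] at hw; exact hw hw'
  -- norms of S-units
  have hνA : ∀ z ∈ SU SL, ν z ∈ SU S := by
    intro z hz w hw
    rw [← (hV w).ord_eq_zero_iff, hν, (V w).ord_mul _ _ z.ne_zero (by simp)]
    have h1 := hz (V w) (hVn w hw _ (hV w))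
    have h2 := hz (Q.conj (V w)) (hVn w hw _ ((hV w).conj Q))
    rw [Q.conj_ord] at h2
    rw [h1, h2, add_zero]
  have hιU : ∀ x ∈ SU S, ι x ∈ SU SL := by
    intro x hx W hW
    obtain ⟨w, hw⟩ := exists_below Q W
    have : w ∉ S := fun h => hW ((hSL W).mpr ⟨w, h, hw⟩)
    rw [hι, hw.ord_eq_zero_iff]
    exact hx w this
  set A := SU SL with hA
  set A2 := SU2 SL with hA2
  set B := (SU2 S).comap ν ⊓ A with hB
  have hA2B : A2 ≤ B := by
    rintro z ⟨t, ht, rfl⟩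
    refine ⟨?_, ?_⟩
    · exact ⟨ν t, hνA t ht, by simp⟩
    · exact pow_mem ht 2
  -- Hilbert 90
  have hH : B ≤ (SU S).map ι ⊔ A2 := by
    rintro ε ⟨⟨t, ht, hte⟩, hεA⟩
    have hte : t ^ 2 = ν ε := hte
    let η : Lˣ := ε / ι t
    have hη : (η : L) * Q.σ η = 1 := by
      have : (ι t : L) ≠ 0 := (ι t).ne_zero
      rw [Units.val_div_eq_div_val, map_div₀, hι, AlgEquiv.commutes]
      have e := hν ε
      rw [← hte, Units.val_pow_eq_pow_val, map_pow] at e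
      rw [hι] at this
      field_simp
      exact e.symm
    have hηA : η ∈ A := div_mem hεA (hιU t ht)
    obtain ⟨θ, hθ⟩ : ∃ θ : Lˣ, (θ : L) = η * Q.σ θ := by
      by_cases h1 : (1 : L) + η = 0
      · refine ⟨Units.mk0 Q.d (Q.d_ne hc), ?_⟩
        rw [Units.val_mk0, Q.σd]
        linear_combination Q.d * h1
      · refine ⟨Units.mk0 _ h1, ?_⟩
        rw [Units.val_mk0, map_add, map_one, mul_add, hη]; ring
    have hWθ : ∀ W, W ∉ SL → W.ord (Q.σ θ) = W.ord θ := by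
      intro W hW
      have h := congrArg W.ord hθ
      rw [W.ord_mul _ _ η.ne_zero (by simp), hηA W hW, zero_add] at h
      exact h.symm
    have hVinj : Function.Injective V := by
      intro w w' h
      have := hV w
      rw [h] at this
      exact this.unique (hV w')
    have hfin : (Function.support fun w : Place F K => (V w).ord (θ : L)).Finite := by
      refine Set.Finite.of_finite_image (f := V) ((finite_supp F (θ : L)).subset ?_) hVinj.injOn
      rintro _ ⟨w, hw, rfl⟩
      exact hw
    obtain ⟨r, hr0, hr⟩ := hS (Finsupp.ofSupportFinite _ hfin)
    let r' : Kˣ := Units.mk0 r hr0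
    let θ' : Lˣ := θ / ι r'
    have hθ'A : θ' ∈ A := by
      intro W hW
      obtain ⟨w, hw⟩ := exists_below Q W
      have hwS : w ∉ S := fun h => hW ((hSL W).mpr ⟨w, h, hw⟩)
      have e1 := hr w hwS
      rw [Units.val_div_eq_div_val, W.ord_div _ _ θ.ne_zero (ι r').ne_zero, hι, Units.val_mk0, hw.ord_eq Q h2 hc (hcS w hwS), e1,
        Finsupp.ofSupportFinite_coe]
      rcases (hV w).eq_or Q hw with h | h
      · rw [h, sub_self]
      · have e2 := hWθ (V w) (hVn w hwS _ (hV w))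
        rw [h, Q.conj_ord, e2, sub_self]
    have hθ' : (θ' : L) = η * Q.σ θ' := by
      rw [Units.val_div_eq_div_val, map_div₀, hι, AlgEquiv.commutes, hθ]
      conv_rhs => rw [← hθ]
      ring_nf
    have hfinal : ε = ι (t / ν θ') * θ' ^ 2 := by
      apply Units.ext
      rw [map_div, Units.val_mul, Units.val_div_eq_div_val, hι, hι, hν, Units.val_pow_eq_pow_val]
      have e3 : (η : L) = ε / algebraMap K L t := by rw [Units.val_div_eq_div_val, hι]
      have e4 : algebraMap K L (t : K) ≠ 0 := by simp
      have e5 : (θ' : L) ≠ 0 := θ'.ne_zero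
      have e6 : Q.σ (θ' : L) ≠ 0 := by simp
      rw [e3] at hθ'
      field_simp at hθ' ⊢
      linear_combination -hθ'
    rw [hfinal]
    apply Subgroup.mul_mem_sup
    · exact ⟨_, div_mem ht (hνA _ hθ'A), rfl⟩
    · exact ⟨θ', hθ'A, rfl⟩
  have iA : A2.relIndex A = 2 ^ SL.card := unit_index h2 SL hSLn
  have iU : (SU2 S).relIndex (SU S) = 2 ^ S.card := unit_index h2 S hSn
  have mul1 := Subgroup.relIndex_mul_relIndex A2 B A hA2B inf_le_right
  -- [A : B] ≤ [NU : U^2]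
  have hNUle : NU S c ≤ SU S := fun u hu => hu.1
  have hNU0 : (SU2 S).relIndex (NU S c) ≠ 0 := fun h => by
    have := Subgroup.relIndex_eq_zero_of_le_right hNUle h
    rw [iU] at this
    exact absurd this (by positivity)
  have le1 : B.relIndex A ≤ (SU2 S).relIndex (NU S c) := by
    rw [hB, Subgroup.inf_relIndex_right, Subgroup.relIndex_comap]
    apply Subgroup.relIndex_le_of_le_right _ hNU0
    rintro _ ⟨z, hz, rfl⟩
    exact ⟨hνA z hz, Q.nu_rep z⟩
  -- [B : A2]
  set M := A2.comap ι ⊓ SU S with hM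
  have hU2M : SU2 S ≤ M := by
    rintro z ⟨t, ht, rfl⟩
    refine ⟨⟨ι t, hιU t ht, by simp⟩, pow_mem ht 2⟩
  have mul2 := Subgroup.relIndex_mul_relIndex (SU2 S) M (SU S) hU2M inf_le_right
  have hM2 : 2 ≤ (SU2 S).relIndex M := by
    have h0 : (SU2 S).relIndex M ≠ 0 := fun h => by
      rw [h, zero_mul, iU] at mul2
      have : (0:ℕ) < 2 ^ S.card := by positivity
      omega
    have h1 : (SU2 S).relIndex M ≠ 1 := by
      rw [Ne, Subgroup.relIndex_eq_one]
      intro h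
      have hcM : Units.mk0 c hc ∈ M := by
        refine ⟨⟨Units.mk0 Q.d (Q.d_ne hc), ?_, ?_⟩, ?_⟩
        · intro W hW
          obtain ⟨w, hw⟩ := exists_below Q W
          have hwS : w ∉ S := fun h => hW ((hSL W).mpr ⟨w, h, hw⟩)
          exact hw.ord_d Q (hcS w hwS)
        · apply Units.ext
          change Q.d ^ 2 = algebraMap K L c
          exact Q.hd
        · exact hcS
      obtain ⟨t, ht, hte⟩ := h hcM
      have h2K : (2 : K) ≠ 0 := by
        obtain ⟨s, -⟩ := hSn
        exact (s.ord_two h2).1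
      apply Q.not_sq h2K hc
      have := congrArg Units.val hte
      exact ⟨t, by rw [← pow_two]; exact this.symm⟩
    omega
  have le2 : A2.relIndex B ≤ M.relIndex (SU S) := by
    rw [hM, Subgroup.inf_relIndex_right, Subgroup.relIndex_comap]
    rw [← Subgroup.relIndex_sup_right ((SU S).map ι) A2]
    apply Subgroup.relIndex_le_of_le_right hH
    rw [Subgroup.relIndex_sup_right, ← Subgroup.relIndex_comap, ← Subgroup.inf_relIndex_right]
    intro h
    rw [h, mul_zero, iU] at mul2
    have : (0:ℕ) < 2 ^ S.card := by positivity
    omega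
  rw [iA] at mul1
  rw [iU] at mul2
  have fin : 2 ^ (SL.card) * 2 ≤ 2 ^ S.card * (SU2 S).relIndex (NU S c) := by
    calc 2 ^ SL.card * 2 = (2 * A2.relIndex B) * B.relIndex A := by rw [← mul1]; ring
      _ ≤ ((SU2 S).relIndex M * M.relIndex (SU S)) * (SU2 S).relIndex (NU S c) := by gcongr
      _ = _ := by rw [mul2]
  have fin2 : 2 ^ S.card * 2 ^ (S.card + 1) ≤ 2 ^ S.card * (2 ^ S'.card * (SU2 S).relIndex (NU S c)) := by
    calc 2 ^ S.card * 2 ^ (S.card + 1) = 2 ^ (2 * S.card + 1) := by rw [← pow_add]; congr 1; ring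
      _ ≤ 2 ^ (SL.card + S'.card + 1) := Nat.pow_le_pow_right (by norm_num) (by omega)
      _ = 2 ^ S'.card * (2 ^ SL.card * 2) := by rw [pow_succ, pow_add]; ring
      _ ≤ 2 ^ S'.card * (2 ^ S.card * (SU2 S).relIndex (NU S c)) := by gcongr
      _ = _ := by ring
  exact Nat.le_of_mul_le_mul_left fin2 (by positivity)

end

section
variable {F : Type*} {K : Type u} [Field F] [Field K] [Algebra F K] [Finite F] [GFF F K]

lemma UC (h2 : (2 : F) ≠ 0) {c : K} (hc : ¬ IsSquare c) (S : Finset (Place F K)) (hSn : S.Nonempty)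
    (hS : Spid S) (hcS : ∀ w, w ∉ S → w.ord c = 0) (S' : Finset (Place F K)) (hS' : S' ⊆ S)
    (hN : ∀ s ∈ S, s ∉ S' → s.Nn c) :
    2 ^ (S.card + 1) ≤ 2 ^ S'.card * (SU2 S).relIndex (NU S c) := by
  obtain ⟨L, _, _, _, _, ⟨Q⟩⟩ := exists_quad (F := F) h2 hc
  exact UC_aux Q (by rintro rfl; exact hc ⟨0, by simp⟩) h2 S hSn hS hcS S' hS' hN

/-- an element that is everywhere in `N_w` is a square -/
lemma isSquare_of_Nn (h2 : (2 : F) ≠ 0) {c : K} (hc0 : c ≠ 0) (h : ∀ w : Place F K, w.Nn c) : IsSquare c := by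
  classical
  by_contra hc
  obtain ⟨S0, hne, hS0⟩ := exists_Spid (F := F) (K := K)
  let S := S0 ∪ (finite_supp F c).toFinset
  have hSn : S.Nonempty := hne.mono Finset.subset_union_left
  have hcS : ∀ w, w ∉ S → w.ord c = 0 := by
    intro w hw
    by_contra h
    exact hw (Finset.mem_union_right _ (by simpa using h))
  have h4 := UC h2 hc S hSn (hS0 S Finset.subset_union_left) hcS ∅ (by simp) (fun s _ _ => h s)
  have iU : (SU2 S).relIndex (SU S) = 2 ^ S.card := unit_index h2 S hSn
  have hNUle : NU S c ≤ SU S := fun u hu => hu.1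
  have h3 := Subgroup.relIndex_le_of_le_right (H := SU2 S) hNUle (by rw [iU]; positivity)
  rw [iU] at h3
  have : (0:ℕ) < 2 ^ S.card := by positivity
  rw [pow_succ, Finset.card_empty, pow_zero, one_mul] at h4
  omega

end
end NND

set_option linter.unusedSectionVars false
set_option linter.unusedVariables false
namespace NND
universe u

section
variable {K L : Type*} [Field K] [Field L] [Algebra K L] {c : K}

lemma Quad.sq_descent (Q : Quad (L := L) c) (h2 : (2 : K) ≠ 0) (hc : c ≠ 0) {x : K} (h : IsSquare (algebraMap K L x)) :
    IsSquare x ∨ IsSquare (c * x) := by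
  obtain ⟨z, hz⟩ := h
  have h1 : Q.σ z * Q.σ z = z * z := by rw [← map_mul, ← hz, AlgEquiv.commutes]
  rcases mul_self_eq_mul_self_iff.mp h1 with h | h
  · left
    obtain ⟨p, rfl⟩ := Q.fixed h2 hc h
    exact ⟨p, (algebraMap K L).injective (by rw [hz, map_mul])⟩
  · right
    obtain ⟨p, hp⟩ := Q.fixed h2 hc (z := z * Q.d) (by rw [map_mul, h, Q.σd]; ring)
    refine ⟨p, (algebraMap K L).injective ?_⟩
    rw [map_mul, map_mul, hz, ← hp, ← Q.hd]; ring
end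

lemma Place.hs_eq_of {F K : Type*} [Field F] [Field K] [Algebra F K] [Finite F] [GFF F K] (w : Place F K) {a b a' b' : K}
    (h1 : w.par a = w.par a') (h2 : w.chr a = w.chr a') (h3 : w.par b = w.par b') (h4 : w.chr b = w.chr b') :
    w.hs a b = w.hs a' b' := by
  unfold Place.hs; rw [h1, h2, h3, h4]

lemma Place.hs_one {F K : Type*} [Field F] [Field K] [Algebra F K] [Finite F] [GFF F K] (w : Place F K) (a : K) : w.hs a 1 = 0 := by
  unfold Place.hs; rw [w.par_one, w.chr_one]; simp

/-- reciprocity with finite support of `hs` -/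
lemma recip' {F : Type*} {K : Type u} [Field F] [Field K] [Algebra F K] [Finite F] [GFF F K] {a b : K} (ha : a ≠ 0) (hb : b ≠ 0)
    (s : Finset (Place F K)) (hs : ∀ w, w ∉ s → w.hs a b = 0) : ∑ w ∈ s, w.hs a b = 0 := by
  classical
  let s' := s ∪ ((finite_supp F a).toFinset ∪ (finite_supp F b).toFinset)
  have h := recip ha hb s' (by
    intro w hw
    simp only [s', Finset.mem_union, not_or, Set.Finite.mem_toFinset, Function.mem_support, not_not] at hw
    constructor
    · exact hw.2.1
    · exact hw.2.2)
  rw [← h]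
  apply Finset.sum_subset Finset.subset_union_left
  intro w _ hw
  exact hs w hw

section
variable {F : Type*} {K : Type u} [Field F] [Field K] [Algebra F K] [Finite F] [GFF F K]

lemma cheb0 (h2 : (2 : F) ≠ 0) {c : K} (hc0 : c ≠ 0) (hc : ¬ IsSquare c) (T : Finset (Place F K)) :
    ∃ w, w ∉ T ∧ ¬ w.Nn c := by
  classical
  by_contra hcon
  push Not at hcon
  apply hc
  apply isSquare_of_Nn h2 hc0
  intro v
  by_contra hv
  have hvT : v ∈ T := by by_contra h; exact hv (hcon v h)
  obtain ⟨b, hb0, hb⟩ := v.exists_hs h2 hv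
  obtain ⟨x, hx0, hx⟩ := approx_coord T (fun w => if w = v then b else 1) (by
    intro w _; split_ifs
    · exact hb0
    · exact one_ne_zero)
  have h := recip' hc0 hx0 T (fun w hw => w.hs_of_Nn (hcon w hw) x)
  rw [Finset.sum_eq_single_of_mem v hvT] at h
  · have h3 := hx v hvT
    simp only [if_true] at h3
    rw [v.hs_eq_of rfl rfl h3.2.1 h3.2.2, hb] at h
    exact one_ne_zero h
  · intro w hw hwv
    have h3 := hx w hw
    simp only [hwv, if_false] at h3
    rw [w.hs_eq_of rfl rfl h3.2.1 h3.2.2, w.hs_one]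

end

theorem cheb {F : Type*} [Field F] [Finite F] (h2 : (2 : F) ≠ 0) (n : ℕ) :
    ∀ (K : Type u) [Field K] [Algebra F K] [GFF F K] (l : List K), l.length = n → (∀ a ∈ l, a ≠ 0) →
      ∀ (c : K), c ≠ 0 → (∀ l' : List K, l'.Sublist l → ¬ IsSquare (c * l'.prod)) →
      ∀ T : Finset (Place F K), ∃ w, w ∉ T ∧ (∀ a ∈ l, w.Nn a) ∧ ¬ w.Nn c := by
  classical
  induction n with
  | zero =>
    intro K _ _ _ l hl _ c hc0 hc T
    obtain rfl := List.length_eq_zero_iff.mp hl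
    have := hc [] (by simp)
    simp at this
    obtain ⟨w, hw, h⟩ := cheb0 h2 hc0 this T
    exact ⟨w, hw, by simp, h⟩
  | succ n ih =>
    intro K _ _ _ l hl hl0 c hc0 hc T
    obtain ⟨a, l, rfl⟩ := List.exists_cons_of_length_eq_add_one hl
    have ha0 : a ≠ 0 := hl0 a (by simp)
    by_cases ha : IsSquare a
    · obtain ⟨w, hw, h, h'⟩ := ih K l (by simpa using hl) (fun b hb => hl0 b (by simp [hb])) c hc0
        (fun l' hl' => hc l' (hl'.cons a)) T
      refine ⟨w, hw, ?_, h'⟩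
      intro b hb
      rcases List.mem_cons.mp hb with rfl | hb
      · obtain ⟨r, rfl⟩ := ha
        rw [← pow_two]
        exact w.Nn_sq (by rintro rfl; simp at ha0)
      · exact h b hb
    · obtain ⟨L, _, _, _, _, ⟨Q⟩⟩ := exists_quad (F := F) h2 ha
      have := Q.gff (F := F)
      have h2K : (2 : K) ≠ 0 := by
        have : (2 : K) = algebraMap F K 2 := (map_ofNat _ 2).symm
        rw [this]; simpa using h2
      obtain ⟨SL, hSL, -⟩ := exists_SL Q ha0 h2 (T ∪ ((finite_supp F a).toFinset ∪ (finite_supp F c).toFinset))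
      obtain ⟨W, hW, h, h'⟩ := ih L (l.map (algebraMap K L)) (by simpa using hl) (by
          intro b hb
          obtain ⟨b', hb', rfl⟩ := List.mem_map.mp hb
          simpa using hl0 b' (by simp [hb'])) (algebraMap K L c) (by simpa using hc0) (by
          intro l' hl' hsq
          obtain ⟨l'', hl'', rfl⟩ := List.sublist_map_iff.mp hl'
          rw [← map_list_prod, ← map_mul] at hsq
          rcases Q.sq_descent h2K ha0 hsq with h | h
          · exact hc l'' (hl''.cons a) h
          · apply hc (a :: l'') (hl''.cons_cons a)
            rw [List.prod_cons]
            convert h using 1; ring) SL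
      obtain ⟨w, hw⟩ := exists_below Q W
      have hwn : w ∉ T ∧ w.ord a = 0 ∧ w.ord c = 0 := by
        have : w ∉ T ∪ ((finite_supp F a).toFinset ∪ (finite_supp F c).toFinset) := fun h => hW ((hSL W).mpr ⟨w, h, hw⟩)
        simp only [Finset.mem_union, not_or, Set.Finite.mem_toFinset] at this
        refine ⟨this.1, ?_, ?_⟩
        · by_contra h; exact this.2.1 h
        · by_contra h; exact this.2.2 h
      obtain ⟨hwT, hwa, hwc⟩ := hwn
      have hcw : ¬ w.Nn c := fun h => h' (hw.Nn_up hc0 h)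
      have ha' : algebraMap K L a ≠ 0 := by simpa using ha0
      have hc' : algebraMap K L c ≠ 0 := by simpa using hc0
      have hda : W.Nn (algebraMap K L a) := by rw [← Q.hd]; exact W.Nn_sq (Q.d_ne ha0)
      have haw : w.Nn a := by
        by_contra hna
        have pa : w.par a = 0 := by unfold Place.par; rw [hwa]; simp
        have pc : w.par c = 0 := by unfold Place.par; rw [hwc]; simp
        have ca : w.chr a = 1 := by
          rcases zmod2_cases (w.chr a) with h | h
          · exact absurd ⟨pa, h⟩ hna
          · exact h
        have cc : w.chr c = 1 := by
          rcases zmod2_cases (w.chr c) with h | h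
          · exact absurd ⟨pc, h⟩ hcw
          · exact h
        have hN : w.Nn (a * c) := (w.Nn_mul_iff ha0 hc0).mpr ⟨by rw [pa, pc], by rw [ca, cc]⟩
        have hN' := hw.Nn_up (mul_ne_zero ha0 hc0) hN
        rw [map_mul, W.Nn_mul_iff ha' hc', hda.1, hda.2] at hN'
        exact h' ⟨hN'.1.symm, hN'.2.symm⟩
      refine ⟨w, hwT, ?_, hcw⟩
      intro b hb
      rcases List.mem_cons.mp hb with rfl | hb
      · exact haw
      · exact hw.Nn_down Q h2 ha0 hwa haw (hl0 b (by simp [hb])) (h _ (List.mem_map_of_mem hb))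

end NND

set_option linter.unusedSectionVars false
set_option linter.unusedVariables false
namespace NND
universe u

/-- local form in coordinates -/
def hsv (κ : ZMod 2) (p q : ZMod 2 × ZMod 2) : ZMod 2 := p.1 * q.2 + q.1 * p.2 + κ * (p.1 * q.1)

lemma hsv_nondeg : ∀ (κ : ZMod 2) (p : ZMod 2 × ZMod 2), (∀ q, hsv κ p q = 0) → p = 0 := by
  unfold hsv; decide

lemma hsv_comm : ∀ (κ : ZMod 2) (p q : ZMod 2 × ZMod 2), hsv κ p q = hsv κ q p := by
  unfold hsv; intros; ring

lemma hsv_add_left (κ : ZMod 2) (p p' q : ZMod 2 × ZMod 2) : hsv κ (p + p') q = hsv κ p q + hsv κ p' q := by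
  unfold hsv; simp only [Prod.fst_add, Prod.snd_add]; ring

lemma hsv_smul_left (κ c : ZMod 2) (p q : ZMod 2 × ZMod 2) : hsv κ (c • p) q = c * hsv κ p q := by
  unfold hsv; simp only [Prod.smul_fst, Prod.smul_snd, smul_eq_mul]; ring

lemma hsv_zero_left (κ : ZMod 2) (q : ZMod 2 × ZMod 2) : hsv κ 0 q = 0 := by
  unfold hsv; simp

lemma hsv_zero_right (κ : ZMod 2) (q : ZMod 2 × ZMod 2) : hsv κ q 0 = 0 := by
  unfold hsv; simp

lemma hsv_card : ∀ (κ : ZMod 2) (p : ZMod 2 × ZMod 2), p ≠ 0 →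
    Fintype.card {q : ZMod 2 × ZMod 2 // hsv κ p q = 0} = 2 := by
  unfold hsv; decide

section
variable {F : Type*} {K : Type u} [Field F] [Field K] [Algebra F K] [Finite F] [GFF F K]

noncomputable def Place.cv (w : Place F K) (x : K) : ZMod 2 × ZMod 2 := (w.par x, w.chr x)

lemma Place.hs_eq (w : Place F K) (a b : K) : w.hs a b = hsv (w.chr (-1)) (w.cv a) (w.cv b) := rfl

lemma Place.cv_eq_zero (w : Place F K) (a : K) : w.cv a = 0 ↔ w.Nn a := by
  unfold Place.cv Place.Nn; rw [Prod.mk_eq_zero]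

lemma Place.cv_mul (w : Place F K) {a b : K} (ha : a ≠ 0) (hb : b ≠ 0) : w.cv (a * b) = w.cv a + w.cv b := by
  unfold Place.cv; rw [w.par_mul ha hb, w.chr_mul ha hb]; rfl

lemma Place.cv_sq (w : Place F K) {a : K} (ha : a ≠ 0) : w.cv (a ^ 2) = 0 :=
  (w.cv_eq_zero _).mpr (w.Nn_sq ha)

abbrev VS (S : Finset (Place F K)) := (S → ZMod 2 × ZMod 2)

noncomputable def VB (S : Finset (Place F K)) : LinearMap.BilinForm (ZMod 2) (VS S) :=
  LinearMap.mk₂ (ZMod 2) (fun x y => ∑ s : S, hsv (s.1.chr (-1)) (x s) (y s))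
    (by intro x x' y; rw [← Finset.sum_add_distrib]; exact Finset.sum_congr rfl fun s _ => hsv_add_left _ _ _ _)
    (by intro c x y; rw [smul_eq_mul, Finset.mul_sum]; exact Finset.sum_congr rfl fun s _ => hsv_smul_left _ _ _ _)
    (by
      intro x y y'; rw [← Finset.sum_add_distrib]
      refine Finset.sum_congr rfl fun s _ => ?_
      rw [hsv_comm, Pi.add_apply, hsv_add_left, hsv_comm, hsv_comm _ (y' s)])
    (by
      intro c x y; rw [smul_eq_mul, Finset.mul_sum]
      refine Finset.sum_congr rfl fun s _ => ?_
      rw [hsv_comm, Pi.smul_apply, hsv_smul_left, hsv_comm])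

lemma VB_apply (S : Finset (Place F K)) (x y : VS S) : VB S x y = ∑ s : S, hsv (s.1.chr (-1)) (x s) (y s) := rfl

lemma VB_comm (S : Finset (Place F K)) (x y : VS S) : VB S x y = VB S y x := by
  rw [VB_apply, VB_apply]; exact Finset.sum_congr rfl fun s _ => hsv_comm _ _ _

lemma VB_refl (S : Finset (Place F K)) : (VB S).IsRefl := fun x y h => by rw [VB_comm]; exact h

lemma VB_single (S : Finset (Place F K)) (x : VS S) (s : S) (q : ZMod 2 × ZMod 2) [DecidableEq S] :
    VB S x (Pi.single s q) = hsv (s.1.chr (-1)) (x s) q := by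
  rw [VB_apply, Finset.sum_eq_single_of_mem s (Finset.mem_univ _)]
  · rw [Pi.single_eq_same]
  · intro t _ hts; rw [Pi.single_eq_of_ne hts, hsv_zero_right]

lemma VB_nondeg (S : Finset (Place F K)) : (VB S).Nondegenerate := by
  classical
  have key : ∀ x : VS S, (∀ y, VB S x y = 0) → x = 0 := by
    intro x h
    funext s
    apply hsv_nondeg (s.1.chr (-1))
    intro q
    rw [← VB_single S x s q]; exact h _
  refine ⟨fun x h => key x h, fun x h => key x fun y => ?_⟩
  rw [VB_comm]; exact h y

/-- coordinates of a unit -/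
noncomputable def phi (S : Finset (Place F K)) : Kˣ →* Multiplicative (VS S) where
  toFun u := Multiplicative.ofAdd fun s => s.1.cv (u : K)
  map_one' := by
    apply Multiplicative.toAdd.injective
    funext s
    change s.1.cv ((1 : Kˣ) : K) = 0
    rw [Units.val_one, s.1.cv_eq_zero]
    exact ⟨s.1.par_one, s.1.chr_one⟩
  map_mul' u v := by
    apply Multiplicative.toAdd.injective
    funext s
    change s.1.cv ((u * v : Kˣ) : K) = s.1.cv u + s.1.cv v
    rw [Units.val_mul, s.1.cv_mul u.ne_zero v.ne_zero]

noncomputable def img (S : Finset (Place F K)) (H : Subgroup Kˣ) : Submodule (ZMod 2) (VS S) :=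
  AddSubgroup.toZModSubmodule 2 (Subgroup.toAddSubgroup' (H.map (phi S)))

lemma mem_img {S : Finset (Place F K)} {H : Subgroup Kˣ} {v : VS S} :
    v ∈ img S H ↔ ∃ u ∈ H, ∀ s : S, s.1.cv (u : K) = v s := by
  constructor
  · rintro ⟨u, hu, h⟩
    exact ⟨u, hu, fun s => congrFun (congrArg Multiplicative.toAdd h) s⟩
  · rintro ⟨u, hu, h⟩
    exact ⟨u, hu, Multiplicative.toAdd.injective (funext h)⟩

/-- `S` detects squares -/
def Inj (S : Finset (Place F K)) : Prop := ∀ u ∈ SU S, (∀ s ∈ S, s.Nn (u : K)) → u ∈ SU2 S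

lemma card_img {S : Finset (Place F K)} (hS : Inj S) {H : Subgroup Kˣ} (hH : H ≤ SU S) :
    Nat.card (img S H) = (SU2 S).relIndex H := by
  have h1 : Nat.card (img S H) = Nat.card (H.map (phi S)) := rfl
  rw [h1, ← Subgroup.relIndex_ker, ← Subgroup.inf_relIndex_right, ← Subgroup.inf_relIndex_right (SU2 S)]
  congr 1
  ext u
  simp only [Subgroup.mem_inf, MonoidHom.mem_ker]
  constructor
  · rintro ⟨h, hu⟩
    refine ⟨hS u (hH hu) fun s hs => ?_, hu⟩
    rw [← s.cv_eq_zero]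
    exact congrFun (congrArg Multiplicative.toAdd h) ⟨s, hs⟩
  · rintro ⟨⟨t, ht, rfl⟩, hu⟩
    refine ⟨Multiplicative.toAdd.injective (funext fun s => ?_), hu⟩
    change s.1.cv (((t ^ 2 : Kˣ)) : K) = 0
    rw [Units.val_pow_eq_pow_val, s.1.cv_sq t.ne_zero]

lemma finrank_VS (S : Finset (Place F K)) : Module.finrank (ZMod 2) (VS S) = 2 * S.card := by
  rw [Module.finrank_pi_fintype]; simp [mul_comm]

lemma finrank_img (h2 : (2 : F) ≠ 0) {S : Finset (Place F K)} (hS : Inj S) (hSn : S.Nonempty) :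
    Module.finrank (ZMod 2) (img S (SU S)) = S.card := by
  have h := card_img hS le_rfl
  rw [unit_index h2 S hSn, Module.natCard_eq_pow_finrank (K := ZMod 2), Nat.card_zmod] at h
  exact Nat.pow_right_injective le_rfl h

lemma img_orth (h2 : (2 : F) ≠ 0) {S : Finset (Place F K)} (hS : Inj S) (hSn : S.Nonempty) :
    (VB S).orthogonal (img S (SU S)) = img S (SU S) := by
  symm
  apply Submodule.eq_of_le_of_finrank_le
  · intro v hv
    rw [LinearMap.BilinForm.mem_orthogonal_iff]
    intro v' hv'
    obtain ⟨u, hu, h⟩ := mem_img.mp hv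
    obtain ⟨u', hu', h'⟩ := mem_img.mp hv'
    change VB S v' v = 0
    have := recip u'.ne_zero u.ne_zero S fun w hw => ⟨hu' w hw, hu w hw⟩
    rw [← this, ← Finset.sum_coe_sort S, VB_apply]
    refine Finset.sum_congr rfl fun s _ => ?_
    rw [Place.hs_eq, h, h']
  · rw [LinearMap.BilinForm.finrank_orthogonal (VB_nondeg S), finrank_img h2 hS hSn, finrank_VS]
    omega

end
end NND

set_option linter.unusedSectionVars false
set_option linter.unusedVariables false
namespace NND
universe u

section
variable {F : Type*} {K : Type u} [Field F] [Field K] [Algebra F K] [Finite F] [GFF F K]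

lemma exists_reps (h2 : (2 : F) ≠ 0) (S : Finset (Place F K)) (hS : S.Nonempty) :
    ∃ R : Finset Kˣ, ∀ u ∈ SU S, ∃ r ∈ R, ∃ t : Kˣ, u = r * t ^ 2 := by
  classical
  have h := unit_index h2 S hS
  have h' : ((SU2 S).subgroupOf (SU S)).index ≠ 0 := by
    change (SU2 S).relIndex (SU S) ≠ 0
    rw [h]; positivity
  have : Finite (SU S ⧸ (SU2 S).subgroupOf (SU S)) := Nat.finite_of_card_ne_zero h'
  have := Fintype.ofFinite (SU S ⧸ (SU2 S).subgroupOf (SU S))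
  refine ⟨Finset.univ.image fun q : SU S ⧸ (SU2 S).subgroupOf (SU S) => ((Quotient.out q : SU S) : Kˣ), ?_⟩
  intro u hu
  refine ⟨_, Finset.mem_image_of_mem _ (Finset.mem_univ (QuotientGroup.mk ⟨u, hu⟩)), ?_⟩
  obtain ⟨⟨g, hg⟩, hq⟩ := QuotientGroup.mk_out_eq_mul ((SU2 S).subgroupOf (SU S)) ⟨u, hu⟩
  have hg' : (g : Kˣ) ∈ SU2 S := hg
  obtain ⟨t, ht, htg⟩ := mem_SU2.mp hg'
  refine ⟨t⁻¹, ?_⟩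
  have e := congrArg (Subtype.val) hq
  simp only [Subgroup.coe_mul] at e
  rw [e, ← htg]
  simp

lemma list_prod_ne {l : List K} (hl : ∀ a ∈ l, a ≠ 0) {l' : List K} (h : l'.Sublist l) : l'.prod ≠ 0 := by
  apply List.prod_ne_zero
  intro h0
  exact hl 0 (h.subset h0) rfl

lemma Place.Nn_prod (w : Place F K) {l : List K} (hl : ∀ a ∈ l, a ≠ 0) (h : ∀ a ∈ l, w.Nn a) {l' : List K}
    (hl' : l'.Sublist l) : w.Nn l'.prod := by
  induction l' with
  | nil => exact ⟨w.par_one, w.chr_one⟩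
  | cons a l' ih =>
    have h1 : l'.Sublist l := (List.sublist_cons_self a l').trans hl'
    have ha : a ∈ l := hl'.subset (by simp)
    rw [List.prod_cons, w.Nn_mul_iff (hl a ha) (list_prod_ne hl h1), (ih h1).1, (ih h1).2]
    exact h a ha

lemma exists_good (h2 : (2 : F) ≠ 0) (l : List K) (hl : ∀ a ∈ l, a ≠ 0) (S₁ : Finset (Place F K)) :
    ∃ S : Finset (Place F K), S₁ ⊆ S ∧ S.Nonempty ∧ Spid S ∧ (∀ a ∈ l, ∀ w, w ∉ S → w.ord a = 0) ∧ Inj S ∧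
      ∀ c ∈ SU S, (∀ s ∈ S, s ∉ S₁ → ∀ q, (∀ a ∈ l, hsv (s.chr (-1)) (s.cv a) q = 0) →
          hsv (s.chr (-1)) (s.cv (c : K)) q = 0) →
        ∃ l' : List K, l'.Sublist l ∧ IsSquare ((c : K) * l'.prod) := by
  classical
  obtain ⟨S0, hne, hS0⟩ := exists_Spid (F := F) (K := K)
  obtain ⟨w0, hw0⟩ := hne
  have hsq : ∀ l' : List K, ∃ w : Place F K, l'.Sublist l → ¬ IsSquare l'.prod → ¬ w.Nn l'.prod := by
    intro l'
    by_cases h : l'.Sublist l ∧ ¬ IsSquare l'.prod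
    · obtain ⟨w, -, hw⟩ := cheb0 h2 (list_prod_ne hl h.1) h.2 (∅ : Finset (Place F K))
      exact ⟨w, fun _ _ => hw⟩
    · exact ⟨w0, fun h1 h2 => absurd ⟨h1, h2⟩ h⟩
  choose v hv using hsq
  let S1 := S₁ ∪ (S0 ∪ ((l.toFinset.biUnion fun a => (finite_supp F a).toFinset) ∪ (l.sublists.toFinset.image v)))
  have hS1 : S1.Nonempty := ⟨w0, by simp [S1, hw0]⟩
  have hsp : Spid S1 := hS0 _ (by intro w hw; simp [S1, hw])
  obtain ⟨R, hR⟩ := exists_reps h2 S1 hS1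
  let P : Kˣ → Prop := fun r => ∀ l' : List K, l'.Sublist l → ¬ IsSquare ((r : K) * l'.prod)
  have hW : ∀ r : Kˣ, ∃ w : Place F K, P r → w ∉ S1 ∧ (∀ a ∈ l, w.Nn a) ∧ ¬ w.Nn (r : K) := by
    intro r
    by_cases h : P r
    · obtain ⟨w, hw⟩ := cheb h2 _ K l rfl hl (r : K) r.ne_zero h S1
      exact ⟨w, fun _ => hw⟩
    · exact ⟨w0, fun h' => absurd h' h⟩
  choose wp hwp using hW
  let S := S1 ∪ (R.filter P).image wp
  have hSS : S1 ⊆ S := Finset.subset_union_left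
  have hlS : ∀ a ∈ l, ∀ w, w ∉ S → w.ord a = 0 := by
    intro a ha w hw
    by_contra h
    apply hw
    apply hSS
    simp only [S1, Finset.mem_union, Finset.mem_biUnion, List.mem_toFinset, Set.Finite.mem_toFinset, Function.mem_support]
    exact Or.inr (Or.inr (Or.inl ⟨a, ha, h⟩))
  have hgood : ∀ c ∈ SU S, (∀ s ∈ S, s ∉ S₁ → ∀ q, (∀ a ∈ l, hsv (s.chr (-1)) (s.cv a) q = 0) →
          hsv (s.chr (-1)) (s.cv (c : K)) q = 0) →
        ∃ l' : List K, l'.Sublist l ∧ IsSquare ((c : K) * l'.prod) := by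
    intro c hc h
    have hN : ∀ r ∈ R, P r → (wp r).Nn (c : K) := by
      intro r hr hP
      have h3 := hwp r hP
      rw [← Place.cv_eq_zero]
      apply hsv_nondeg ((wp r).chr (-1))
      intro q
      apply h (wp r)
      · exact Finset.mem_union_right _ (Finset.mem_image_of_mem _ (Finset.mem_filter.mpr ⟨hr, hP⟩))
      · intro h'; exact h3.1 (Finset.mem_union_left _ h')
      · intro a ha
        rw [((wp r).cv_eq_zero a).mpr (h3.2.1 a ha), hsv_zero_left]
    have heven : ∀ w, w ∉ S1 → Even (w.ord (c : K)) := by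
      intro w hw
      by_cases hwS : w ∈ S
      · rcases Finset.mem_union.mp hwS with h' | h'
        · exact absurd h' hw
        · obtain ⟨r, hr, rfl⟩ := Finset.mem_image.mp h'
          rw [Finset.mem_filter] at hr
          exact ZMod.intCast_eq_zero_iff_even.mp (hN r hr.1 hr.2).1
      · rw [hc w hwS]; simp
    obtain ⟨r, hr0, hr⟩ := hsp ((dv F (c : K)).mapRange (fun n => n / 2) (by simp))
    have hcr : c * (Units.mk0 r hr0)⁻¹ ^ 2 ∈ SU S1 := by
      intro w hw
      have h1 := hr w hw
      rw [Finsupp.mapRange_apply] at h1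
      have h3 : w.ord r = w.ord (c : K) / 2 := h1
      push_cast
      rw [w.ord_mul _ _ c.ne_zero (by simp [hr0]), w.ord_pow, Units.val_mk0, w.ord_inv, h3]
      have := heven w hw
      obtain ⟨k, hk⟩ := this
      omega
    obtain ⟨ρ, hρ, t, ht⟩ := hR _ hcr
    have hce : (c : K) = ρ * (t * r) ^ 2 := by
      have h1 := congrArg (Units.val) ht
      push_cast at h1
      rw [Units.val_mk0] at h1
      field_simp at h1
      rw [h1]; ring
    have htr : (t : K) * r ≠ 0 := mul_ne_zero t.ne_zero hr0
    by_cases hP : P ρ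
    · exfalso
      have h1 := hN ρ hρ hP
      rw [hce, ← Place.cv_eq_zero, Place.cv_mul _ ρ.ne_zero (pow_ne_zero 2 htr), Place.cv_sq _ htr, add_zero,
        Place.cv_eq_zero] at h1
      exact (hwp ρ hP).2.2 h1
    · simp only [P] at hP
      push Not at hP
      obtain ⟨l', hl', z, hz⟩ := hP
      refine ⟨l', hl', z * (t * r), ?_⟩
      rw [hce]
      linear_combination (t * r : K) ^ 2 * hz
  refine ⟨S, Finset.subset_union_left.trans hSS, hS1.mono hSS, hS0 _ (by intro w hw; simp [S, S1, hw]), hlS, ?_, hgood⟩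
  intro u hu hN
  obtain ⟨l', hl', hsq⟩ := hgood u hu (by
    intro s hs _ q _
    rw [(s.cv_eq_zero _).mpr (hN s hs), hsv_zero_left])
  have hl0 := list_prod_ne hl hl'
  have h1 : IsSquare l'.prod := by
    by_contra hns
    have h3 := hv l' hl' hns
    apply h3
    have hvS : v l' ∈ S := hSS (by
      simp only [S1, Finset.mem_union]
      refine Or.inr (Or.inr (Or.inr (Finset.mem_image_of_mem _ ?_)))
      simpa using hl')
    obtain ⟨z, hz⟩ := hsq
    have hz0 : z ≠ 0 := by
      rintro rfl
      exact mul_ne_zero u.ne_zero hl0 (by rw [hz]; simp)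
    have h5 := (v l').cv_sq hz0
    rw [pow_two, ← hz, Place.cv_mul _ u.ne_zero hl0, ((v l').cv_eq_zero _).mpr (hN _ hvS), zero_add] at h5
    exact ((v l').cv_eq_zero _).mp h5
  obtain ⟨z, hz⟩ := hsq
  obtain ⟨y, hy⟩ := h1
  have hy0 : y ≠ 0 := by rintro rfl; simp [hy] at hl0
  have hz0 : z ≠ 0 := by
    rintro rfl
    exact mul_ne_zero u.ne_zero hl0 (by rw [hz]; simp)
  have huz : (u : K) = (z / y) ^ 2 := by
    rw [hy] at hz; field_simp; linear_combination hz
  refine mem_SU2.mpr ⟨Units.mk0 (z / y) (div_ne_zero hz0 hy0), ?_, ?_⟩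
  · intro w hw
    have h1 := hu w hw
    rw [huz, w.ord_pow] at h1
    rw [Units.val_mk0]
    simpa using h1
  · ext; push_cast; rw [Units.val_mk0, huz]

end
end NND

set_option linter.unusedSectionVars false
set_option linter.unusedVariables false
namespace NND
universe u

section
variable {F : Type*} {K : Type u} [Field F] [Field K] [Algebra F K] [Finite F] [GFF F K]

def XX (S T : Finset (Place F K)) (l : List K) : Submodule (ZMod 2) (VS S) where
  carrier := {v | ∀ s : S, (s.1 ∈ T → v s = 0) ∧ (s.1 ∉ T → ∀ a ∈ l, hsv (s.1.chr (-1)) (s.1.cv a) (v s) = 0)}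
  zero_mem' := fun s => ⟨fun _ => rfl, fun _ a _ => by rw [Pi.zero_apply, hsv_zero_right]⟩
  add_mem' := fun {v v'} h h' s => ⟨fun hs => by rw [Pi.add_apply, (h s).1 hs, (h' s).1 hs, add_zero],
    fun hs a ha => by
      have h1 := (h s).2 hs a ha
      have h2 := (h' s).2 hs a ha
      rw [hsv_comm] at h1 h2
      rw [Pi.add_apply, hsv_comm, hsv_add_left, h1, h2, add_zero]⟩
  smul_mem' := fun c v h s => ⟨fun hs => by rw [Pi.smul_apply, (h s).1 hs, smul_zero],
    fun hs a ha => by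
      have h1 := (h s).2 hs a ha
      rw [hsv_comm] at h1
      rw [Pi.smul_apply, hsv_comm, hsv_smul_left, h1, mul_zero]⟩

lemma mem_XX {S T : Finset (Place F K)} {l : List K} {v : VS S} : v ∈ XX S T l ↔
  ∀ s : S, (s.1 ∈ T → v s = 0) ∧ (s.1 ∉ T → ∀ a ∈ l, hsv (s.1.chr (-1)) (s.1.cv a) (v s) = 0) := Iff.rfl

lemma XX_orth {S T : Finset (Place F K)} {l : List K} {v : VS S} (hv : v ∈ (VB S).orthogonal (XX S T l)) (s : S)
    (hs : s.1 ∉ T) (q : ZMod 2 × ZMod 2) (hq : ∀ a ∈ l, hsv (s.1.chr (-1)) (s.1.cv a) q = 0) :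
    hsv (s.1.chr (-1)) (v s) q = 0 := by
  classical
  rw [← VB_single S v s q, VB_comm]
  refine LinearMap.BilinForm.mem_orthogonal_iff.mp hv _ ?_
  intro t
  by_cases ht : t = s
  · subst ht
    rw [Pi.single_eq_same]
    exact ⟨fun h => absurd h hs, fun _ => hq⟩
  · rw [Pi.single_eq_of_ne ht]
    exact ⟨fun _ => rfl, fun _ a _ => hsv_zero_right _ _⟩

lemma sum_prod_zero {l : List K} (hl : ∀ a ∈ l, a ≠ 0) {T : Finset (Place F K)} {b : Place F K → K}
    (h : ∀ a ∈ l, ∑ w ∈ T, w.hs a (b w) = 0) {l' : List K} (hl' : l'.Sublist l) :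
    ∑ w ∈ T, w.hs l'.prod (b w) = 0 := by
  induction l' with
  | nil =>
    apply Finset.sum_eq_zero
    intro w _
    rw [List.prod_nil, w.hs_comm, w.hs_one]
  | cons a l' ih =>
    have h1 : l'.Sublist l := (List.sublist_cons_self a l').trans hl'
    have ha : a ∈ l := hl'.subset (by simp)
    have : ∀ w ∈ T, w.hs (a :: l').prod (b w) = w.hs a (b w) + w.hs l'.prod (b w) := by
      intro w _
      rw [List.prod_cons, w.hs_mul_left _ (hl a ha) (list_prod_ne hl h1)]
    rw [Finset.sum_congr rfl this, Finset.sum_add_distrib, h a ha, ih h1, add_zero]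

theorem exists_gl (h2 : (2 : F) ≠ 0) (l : List K) (hl : ∀ a ∈ l, a ≠ 0) (T : Finset (Place F K))
    (b : Place F K → K) (hb : ∀ w ∈ T, b w ≠ 0) (h : ∀ a ∈ l, ∑ w ∈ T, w.hs a (b w) = 0) :
    ∃ x : K, x ≠ 0 ∧ (∀ w ∈ T, w.cv x = w.cv (b w)) ∧ ∀ w, w ∉ T → ∀ a ∈ l, w.hs a x = 0 := by
  classical
  obtain ⟨S, hTS, hSn, hsp, hlS, hinj, hgood⟩ := exists_good h2 l hl T
  let β : VS S := fun s => if s.1 ∈ T then s.1.cv (b s.1) else 0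
  have hβ : β ∈ img S (SU S) ⊔ XX S T l := by
    rw [← LinearMap.BilinForm.orthogonal_orthogonal (VB_nondeg S) (VB_refl S) (img S (SU S) ⊔ XX S T l),
      LinearMap.BilinForm.mem_orthogonal_iff]
    intro v hv
    have hv1 : v ∈ (VB S).orthogonal (img S (SU S)) := LinearMap.BilinForm.orthogonal_le le_sup_left hv
    have hv2 : v ∈ (VB S).orthogonal (XX S T l) := LinearMap.BilinForm.orthogonal_le le_sup_right hv
    rw [img_orth h2 hinj hSn] at hv1
    obtain ⟨u, hu, huv⟩ := mem_img.mp hv1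
    obtain ⟨l', hl', z, hz⟩ := hgood u hu (by
      intro s hs hsT q hq
      rw [huv ⟨s, hs⟩]
      exact XX_orth hv2 ⟨s, hs⟩ hsT q hq)
    have hl0 := list_prod_ne hl hl'
    have hz0 : z ≠ 0 := by
      rintro rfl
      exact mul_ne_zero u.ne_zero hl0 (by rw [hz]; simp)
    change VB S v β = 0
    rw [VB_apply, ← sum_prod_zero hl h hl']
    have e : ∑ s : S, hsv (s.1.chr (-1)) (v s) (β s) = ∑ s ∈ S, (if s ∈ T then s.hs l'.prod (b s) else 0) := by
      rw [← Finset.sum_coe_sort S]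
      refine Finset.sum_congr rfl fun s _ => ?_
      by_cases hs : s.1 ∈ T
      · simp only [β, if_pos hs]
        rw [Place.hs_eq, ← huv s]
        congr 1
        have h5 := s.1.cv_sq hz0
        rw [pow_two, ← hz, Place.cv_mul _ u.ne_zero hl0] at h5
        have : ∀ p q : ZMod 2 × ZMod 2, p + q = 0 → p = q := by decide
        exact this _ _ h5
      · simp only [β, if_neg hs, hsv_zero_right]
    rw [e, ← Finset.sum_filter]
    congr 1
    ext w
    rw [Finset.mem_filter]
    exact ⟨fun h => h.2, fun h => ⟨hTS h, h⟩⟩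
  obtain ⟨y, hy, x, hx, hyx⟩ := Submodule.mem_sup.mp hβ
  obtain ⟨u, hu, huy⟩ := mem_img.mp hy
  refine ⟨u, u.ne_zero, ?_, ?_⟩
  · intro w hw
    rw [huy ⟨w, hTS hw⟩]
    have h1 := congrFun hyx ⟨w, hTS hw⟩
    rw [Pi.add_apply, (hx ⟨w, hTS hw⟩).1 hw, add_zero] at h1
    rw [h1]
    simp [β, hw]
  · intro w hw a ha
    by_cases hwS : w ∈ S
    · have h1 := congrFun hyx ⟨w, hwS⟩
      have h3 := (hx ⟨w, hwS⟩).2 hw a ha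
      rw [Pi.add_apply] at h1
      have h4 : y ⟨w, hwS⟩ = x ⟨w, hwS⟩ := by
        simp only [β, if_neg hw] at h1
        have : ∀ p q : ZMod 2 × ZMod 2, p + q = 0 → p = q := by decide
        exact this _ _ h1
      rw [Place.hs_eq, huy ⟨w, hwS⟩, h4]
      exact h3
    · exact w.hs_unit (hlS a ha w hwS) (hu w hwS)

lemma card_XX (S : Finset (Place F K)) (a : K) (S' : Finset (Place F K)) (hS' : ∀ s, s ∈ S' ↔ s ∈ S ∧ ¬ s.Nn a) :
    Module.finrank (ZMod 2) (XX S ∅ [a]) + S'.card = 2 * S.card := by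
  classical
  have e : Nat.card (XX S ∅ [a]) = ∏ s : S, Fintype.card {q : ZMod 2 × ZMod 2 // hsv (s.1.chr (-1)) (s.1.cv a) q = 0} := by
    have e1 : (XX S ∅ [a]) ≃ {v : VS S // ∀ s : S, hsv (s.1.chr (-1)) (s.1.cv a) (v s) = 0} :=
      Equiv.subtypeEquivRight (by
        intro v
        rw [mem_XX]
        simp)
    rw [Nat.card_congr e1, Nat.card_congr (Equiv.subtypePiEquivPi
      (p := fun (s : S) (q : ZMod 2 × ZMod 2) => hsv (s.1.chr (-1)) (s.1.cv a) q = 0)), Nat.card_eq_fintype_card, Fintype.card_pi]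
  have e2 : ∀ s : S, Fintype.card {q : ZMod 2 × ZMod 2 // hsv (s.1.chr (-1)) (s.1.cv a) q = 0} *
      (if s.1 ∈ S' then 2 else 1) = 4 := by
    intro s
    by_cases hs : s.1.Nn a
    · have : s.1 ∉ S' := fun h => ((hS' _).mp h).2 hs
      rw [if_neg this]
      have h0 := (s.1.cv_eq_zero a).mpr hs
      simp only [h0, hsv_zero_left]
      rw [mul_one]
      decide
    · have : s.1 ∈ S' := (hS' _).mpr ⟨s.2, hs⟩
      rw [if_pos this, hsv_card _ _ (fun h => hs ((s.1.cv_eq_zero a).mp h))]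
  have e3 : Nat.card (XX S ∅ [a]) * 2 ^ S'.card = 4 ^ S.card := by
    have h4 : (2 : ℕ) ^ S'.card = ∏ s : S, (if s.1 ∈ S' then 2 else 1) := by
      rw [Finset.prod_coe_sort S (fun s => if s ∈ S' then 2 else 1), ← Finset.prod_filter, Finset.prod_const]
      congr 2
      ext w
      rw [Finset.mem_filter, hS']
      tauto
    rw [e, h4, ← Finset.prod_mul_distrib, Finset.prod_congr rfl (fun s _ => e2 s), Finset.prod_const]
    simp
  rw [Module.natCard_eq_pow_finrank (K := ZMod 2), Nat.card_zmod, ← pow_add, show 4 = 2 ^ 2 by norm_num, ← pow_mul] at e3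
  exact Nat.pow_right_injective le_rfl e3

theorem hasse (h2 : (2 : F) ≠ 0) {a b : K} (ha : a ≠ 0) (hb : b ≠ 0) (h : ∀ w : Place F K, w.hs a b = 0) :
    ∃ x y : K, b = x ^ 2 - a * y ^ 2 := by
  classical
  have h2K : (2 : K) ≠ 0 := by
    have : (2 : K) = algebraMap F K 2 := (map_ofNat _ 2).symm
    rw [this]; simpa using h2
  by_cases hsq : IsSquare a
  · obtain ⟨r, rfl⟩ := hsq
    have hr : r ≠ 0 := by rintro rfl; simp at ha
    refine ⟨(b + 1) / 2, (b - 1) / (2 * r), ?_⟩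
    field_simp; ring
  obtain ⟨S, hTS, hSn, hsp, hlS, hinj, hgood⟩ := exists_good h2 [a] (by simpa using ha) (finite_supp F b).toFinset
  have haS : ∀ w, w ∉ S → w.ord a = 0 := hlS a (by simp)
  have hbS : Units.mk0 b hb ∈ SU S := by
    intro w hw
    by_contra h
    exact hw (hTS (by simpa using h))
  let S' := S.filter (fun s => ¬ s.Nn a)
  have hS' : ∀ s, s ∈ S' ↔ s ∈ S ∧ ¬ s.Nn a := fun s => Finset.mem_filter
  have hX := card_XX S a S' hS'
  have hUC := UC h2 hsq S hSn hsp haS S' (Finset.filter_subset _ _) (by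
    intro s hs hs'
    by_contra h
    exact hs' ((hS' s).mpr ⟨hs, h⟩))
  have hNle : NU S a ≤ SU S := fun u hu => hu.1
  have hNU : img S (NU S a) ≤ img S (SU S) ⊓ XX S ∅ [a] := by
    intro v hv
    obtain ⟨u, hu, huv⟩ := mem_img.mp hv
    refine ⟨mem_img.mpr ⟨u, hNle hu, huv⟩, fun s => ⟨by simp, fun _ c hc => ?_⟩⟩
    obtain rfl := List.mem_singleton.mp hc
    rw [← huv s, ← Place.hs_eq, Place.hs_comm]
    obtain ⟨-, x, y, hxy⟩ := hu
    exact s.1.hs_norm u.ne_zero ha hxy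
  rw [← card_img hinj hNle, Module.natCard_eq_pow_finrank (K := ZMod 2), Nat.card_zmod, ← pow_add,
    Nat.pow_le_pow_iff_right (by norm_num)] at hUC
  have hU := finrank_img h2 hinj hSn
  have hsum := Submodule.finrank_sup_add_finrank_inf_eq (img S (SU S)) (XX S ∅ [a])
  have horth := LinearMap.BilinForm.finrank_orthogonal (VB_nondeg S) (img S (SU S) ⊔ XX S ∅ [a])
  have hspan : (VB S).orthogonal (img S (SU S) ⊔ XX S ∅ [a]) ≤ Submodule.span (ZMod 2) {(fun s => s.1.cv a : VS S)} := by
    intro v hv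
    have hv1 : v ∈ (VB S).orthogonal (img S (SU S)) := LinearMap.BilinForm.orthogonal_le le_sup_left hv
    have hv2 : v ∈ (VB S).orthogonal (XX S ∅ [a]) := LinearMap.BilinForm.orthogonal_le le_sup_right hv
    rw [img_orth h2 hinj hSn] at hv1
    obtain ⟨u, hu, huv⟩ := mem_img.mp hv1
    obtain ⟨l', hl', z, hz⟩ := hgood u hu (by
      intro s hs hsT q hq
      rw [huv ⟨s, hs⟩]
      exact XX_orth hv2 ⟨s, hs⟩ (by simp) q hq)
    have hl0 : l'.prod ≠ 0 := list_prod_ne (l := [a]) (by simpa using ha) hl'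
    have hz0 : z ≠ 0 := by
      rintro rfl
      exact mul_ne_zero u.ne_zero hl0 (by rw [hz]; simp)
    have hvs : ∀ s : S, v s = s.1.cv l'.prod := by
      intro s
      rw [← huv s]
      have h5 := s.1.cv_sq hz0
      rw [pow_two, ← hz, Place.cv_mul _ u.ne_zero hl0] at h5
      have : ∀ p q : ZMod 2 × ZMod 2, p + q = 0 → p = q := by decide
      exact this _ _ h5
    rcases List.sublist_singleton.mp hl' with rfl | rfl
    · have : v = 0 := by
        funext s
        rw [hvs s, List.prod_nil, Pi.zero_apply, Place.cv_eq_zero]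
        exact ⟨s.1.par_one, s.1.chr_one⟩
      rw [this]; exact zero_mem _
    · have : v = (fun s => s.1.cv a : VS S) := by
        funext s
        rw [hvs s, List.prod_singleton]
      rw [this]; exact Submodule.mem_span_singleton_self _
  have hle1 := (Submodule.finrank_mono hspan).trans (finrank_span_le_card _)
  simp only [Set.toFinset_singleton, Finset.card_singleton] at hle1
  rw [horth, finrank_VS] at hle1
  have heq := Submodule.eq_of_le_of_finrank_le hNU (by omega)
  have hbm : (fun s => s.1.cv b : VS S) ∈ img S (SU S) ⊓ XX S ∅ [a] := by
    refine ⟨mem_img.mpr ⟨_, hbS, fun s => rfl⟩, fun s => ⟨by simp, fun _ c hc => ?_⟩⟩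
    obtain rfl := List.mem_singleton.mp hc
    exact h s.1
  rw [← heq] at hbm
  obtain ⟨u, hu, hub⟩ := mem_img.mp hbm
  have h7 := hinj (Units.mk0 b hb * u) (mul_mem hbS hu.1) (by
    intro s hs
    rw [Units.val_mul, Units.val_mk0, ← Place.cv_eq_zero, Place.cv_mul _ hb u.ne_zero, hub ⟨s, hs⟩]
    have : ∀ p : ZMod 2 × ZMod 2, p + p = 0 := by decide
    exact this _)
  obtain ⟨t, -, ht⟩ := mem_SU2.mp h7
  obtain ⟨-, x, y, hxy⟩ := hu
  have h8 := congrArg Units.val ht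
  push_cast at h8
  rw [Units.val_mk0] at h8
  have hu0 := u.ne_zero
  refine ⟨x * (t / u), y * (t / u), ?_⟩
  have : b = (u : K) * (t / u) ^ 2 := by field_simp; rw [h8]
  rw [this]
  nth_rewrite 1 [hxy]
  ring

end
end NND

set_option linter.unusedSectionVars false
set_option linter.unusedVariables false
namespace NND
universe u

section defs
variable {K : Type u} [Field K]
def Ee (a b f e : K) : Prop := e ≠ 0 ∧ (∃ u, ∃ s, b * e = u ^ 2 - a * s ^ 2) ∧ ∃ u, ∃ s, a * f = u ^ 2 - e * s ^ 2
def EE (a b f : K) : Prop := ∃ e, Ee a b f e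
def Sq (a b f : K) : Prop := ∃ f2, ∃ f3, f2 ≠ 0 ∧ f3 ≠ 0 ∧ EE a b f2 ∧ EE a b f3 ∧ EE a b (f2 * f3) ∧
  EE a b (f * f2) ∧ EE a b (f * f3) ∧ EE a b (f * (f2 * f3))
def Cert (d1 d2 a0 b0 x y : K) : Prop := ∃ p, ∃ r, ∃ e, ∃ f, ∃ f', ∃ g, ∃ g',
  p ≠ 0 ∧ r ≠ 0 ∧ f ≠ 0 ∧ f' ≠ 0 ∧ g ≠ 0 ∧ g' ≠ 0 ∧ Sq d1 d2 p ∧ Sq d1 d2 r ∧ Ee d1 d2 (a0 * p) e ∧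
  x = (a0 * p) * (f * f') ∧ y = (b0 * r) * (g * g') ∧ Sq (a0 * p) (b0 * r) f ∧ Sq (a0 * p) (b0 * r) g ∧
  Sq (a0 * p) (b0 * r * e) f' ∧ Sq (a0 * p) (b0 * r * e) g'
end defs

section
variable {F : Type*} {K : Type u} [Field F] [Field K] [Algebra F K] [Finite F] [GFF F K]

lemma zadd : ∀ p q : ZMod 2, p + q = 0 → q = p := by decide

lemma Ee_sound {a b f e : K} (ha : a ≠ 0) (hb : b ≠ 0) (hf : f ≠ 0) (h : Ee a b f e) (w : Place F K) :
    w.hs a e = w.hs a b ∧ w.hs f e = w.hs a b := by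
  obtain ⟨he, ⟨u, s, h1⟩, u', s', h2⟩ := h
  have h3 := w.hs_norm (mul_ne_zero hb he) ha h1
  have h4 := w.hs_norm (mul_ne_zero ha hf) he h2
  rw [w.hs_mul_left _ hb he, w.hs_comm b, w.hs_comm e] at h3
  rw [w.hs_mul_left _ ha hf] at h4
  have h5 := zadd _ _ h3
  exact ⟨h5, by rw [zadd _ _ h4, h5]⟩

lemma exists_delta {a b : K} (ha : a ≠ 0) (hb : b ≠ 0) :
    ∃ T : Finset (Place F K), (∀ w, w ∈ T ↔ w.hs a b = 1) ∧ ∑ w ∈ T, (1 : ZMod 2) = 0 := by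
  classical
  let s' := (finite_supp F a).toFinset ∪ (finite_supp F b).toFinset
  have hs' : ∀ w, w ∉ s' → w.ord a = 0 ∧ w.ord b = 0 := by
    intro w hw
    simpa [s'] using hw
  let T := s'.filter fun w => w.hs a b = 1
  have hT : ∀ w, w ∈ T ↔ w.hs a b = 1 := by
    intro w
    rw [Finset.mem_filter]
    refine ⟨fun h => h.2, fun h => ⟨?_, h⟩⟩
    by_contra hw
    rw [w.hs_unit (hs' w hw).1 (hs' w hw).2] at h
    exact zero_ne_one h
  refine ⟨T, hT, ?_⟩
  have := recip' ha hb T (fun w hw => by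
    rcases zmod2_cases (w.hs a b) with h | h
    · exact h
    · exact absurd ((hT w).mpr h) hw)
  rw [← this]
  exact Finset.sum_congr rfl fun w hw => ((hT w).mp hw).symm

lemma both_aux : ∀ (κ : ZMod 2) (p q : ZMod 2 × ZMod 2), p ≠ 0 → q ≠ 0 → ∃ r, hsv κ p r = 1 ∧ hsv κ q r = 1 := by
  unfold hsv; decide

lemma Place.exists_cv (w : Place F K) (h2 : (2 : F) ≠ 0) (r : ZMod 2 × ZMod 2) : ∃ x : K, x ≠ 0 ∧ w.cv x = r := by
  obtain ⟨x, hx, h1, h3⟩ := w.exists_coord h2 r.1 r.2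
  exact ⟨x, hx, Prod.ext h1 h3⟩

lemma approx_cv (h2 : (2 : F) ≠ 0) (T : Finset (Place F K)) (r : Place F K → ZMod 2 × ZMod 2) :
    ∃ x : K, x ≠ 0 ∧ ∀ w ∈ T, w.cv x = r w := by
  choose x hx h using fun w : Place F K => w.exists_cv h2 (r w)
  obtain ⟨y, hy, h'⟩ := approx_coord T x (fun w _ => hx w)
  exact ⟨y, hy, fun w hw => by rw [← h w]; exact Prod.ext (h' w hw).2.1 (h' w hw).2.2⟩

/-- `exists_gl` in coordinates -/
lemma exists_gl' (h2 : (2 : F) ≠ 0) (l : List K) (hl : ∀ a ∈ l, a ≠ 0) (T : Finset (Place F K))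
    (r : Place F K → ZMod 2 × ZMod 2) (h : ∀ a ∈ l, ∑ w ∈ T, hsv (w.chr (-1)) (w.cv a) (r w) = 0) :
    ∃ x : K, x ≠ 0 ∧ (∀ w ∈ T, w.cv x = r w) ∧ ∀ w, w ∉ T → ∀ a ∈ l, w.hs a x = 0 := by
  choose b hb h' using fun w : Place F K => w.exists_cv h2 (r w)
  obtain ⟨x, hx, h3, h4⟩ := exists_gl h2 l hl T b (fun w _ => hb w) (by
    intro a ha
    rw [← h a ha]
    exact Finset.sum_congr rfl fun w _ => by rw [Place.hs_eq, h'])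
  exact ⟨x, hx, fun w hw => by rw [h3 w hw, h'], h4⟩

lemma Ee_complete (h2 : (2 : F) ≠ 0) {a b f : K} (ha : a ≠ 0) (hb : b ≠ 0) (hf : f ≠ 0)
    (h : ∀ w : Place F K, w.hs a b = 1 → ¬ w.Nn f) : ∃ e, Ee a b f e := by
  classical
  obtain ⟨T, hT, hsum⟩ := exists_delta (F := F) ha hb
  have hloc : ∀ w : Place F K, ∃ r, w ∈ T → hsv (w.chr (-1)) (w.cv a) r = 1 ∧ hsv (w.chr (-1)) (w.cv f) r = 1 := by
    intro w
    by_cases hw : w ∈ T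
    · have h1 := (hT w).mp hw
      obtain ⟨r, hr⟩ := both_aux (w.chr (-1)) (w.cv a) (w.cv f) (by
        intro h0
        rw [Place.hs_eq, h0, hsv_zero_left] at h1
        exact zero_ne_one h1) (fun h0 => h w h1 ((w.cv_eq_zero f).mp h0))
      exact ⟨r, fun _ => hr⟩
    · exact ⟨0, fun h => absurd h hw⟩
  choose r hr using hloc
  obtain ⟨e, he, h3, h4⟩ := exists_gl' h2 [a, f] (by simp [ha, hf]) T r (by
    intro c hc
    rw [← hsum]
    refine Finset.sum_congr rfl fun w hw => ?_
    simp only [List.mem_cons, List.not_mem_nil, or_false] at hc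
    rcases hc with rfl | rfl
    · exact (hr w hw).1
    · exact (hr w hw).2)
  have hab : ∀ w : Place F K, w.hs a b = w.hs a e ∧ w.hs a e = w.hs f e := by
    intro w
    by_cases hw : w ∈ T
    · rw [(hT w).mp hw, w.hs_eq, w.hs_eq, h3 w hw, (hr w hw).1, (hr w hw).2]
      exact ⟨rfl, rfl⟩
    · rw [h4 w hw a (by simp), h4 w hw f (by simp)]
      refine ⟨?_, rfl⟩
      rcases zmod2_cases (w.hs a b) with h | h
      · exact h
      · exact absurd ((hT w).mpr h) hw
  refine ⟨e, he, ?_, ?_⟩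
  · apply hasse h2 ha (mul_ne_zero hb he)
    intro w
    rw [w.hs_mul_right _ hb he, (hab w).1, zmod2_add_self]
  · apply hasse h2 he (mul_ne_zero ha hf)
    intro w
    rw [w.hs_mul_right _ ha hf, w.hs_comm e, w.hs_comm e, (hab w).2, zmod2_add_self]

lemma EE_iff (h2 : (2 : F) ≠ 0) {a b f : K} (ha : a ≠ 0) (hb : b ≠ 0) (hf : f ≠ 0) :
    EE a b f ↔ ∀ w : Place F K, w.hs a b = 1 → w.cv f ≠ 0 := by
  constructor
  · rintro ⟨e, he⟩ w hw h0
    have := (Ee_sound ha hb hf he w).2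
    rw [hw, w.hs_eq, h0, hsv_zero_left] at this
    exact zero_ne_one this
  · intro h
    exact Ee_complete h2 ha hb hf fun w hw h' => h w hw ((w.cv_eq_zero f).mpr h')

lemma Sq_iff (h2 : (2 : F) ≠ 0) {a b f : K} (ha : a ≠ 0) (hb : b ≠ 0) (hf : f ≠ 0) :
    Sq a b f ↔ ∀ w : Place F K, w.hs a b = 1 → w.cv f = 0 := by
  constructor
  · rintro ⟨f2, f3, n2, n3, h⟩ w hw
    have n23 := mul_ne_zero n2 n3
    rw [EE_iff h2 ha hb n2, EE_iff h2 ha hb n3, EE_iff h2 ha hb n23, EE_iff h2 ha hb (mul_ne_zero hf n2),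
      EE_iff h2 ha hb (mul_ne_zero hf n3), EE_iff h2 ha hb (mul_ne_zero hf n23)] at h
    obtain ⟨a1, a2, a3, a4, a5, a6⟩ := h
    have a1 := a1 w hw
    have a2 := a2 w hw
    have a3 := a3 w hw
    have a4 := a4 w hw
    have a5 := a5 w hw
    have a6 := a6 w hw
    rw [w.cv_mul hf n23] at a6
    rw [w.cv_mul n2 n3] at a3 a6
    rw [w.cv_mul hf n2] at a4
    rw [w.cv_mul hf n3] at a5
    have key : ∀ p q r : ZMod 2 × ZMod 2, (q = 0 ∨ r = 0 ∨ q + r = 0) ∨ (p + q = 0 ∨ p + r = 0 ∨ p + (q + r) = 0) ∨ p = 0 := by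
      decide
    have := key (w.cv f) (w.cv f2) (w.cv f3)
    tauto
  · intro h
    obtain ⟨T, hT, -⟩ := exists_delta (F := F) ha hb
    obtain ⟨f2, n2, e2⟩ := approx_cv h2 T fun _ => (0, 1)
    obtain ⟨f3, n3, e3⟩ := approx_cv h2 T fun _ => (1, 0)
    have n23 := mul_ne_zero n2 n3
    refine ⟨f2, f3, n2, n3, ?_⟩
    rw [EE_iff h2 ha hb n2, EE_iff h2 ha hb n3, EE_iff h2 ha hb n23, EE_iff h2 ha hb (mul_ne_zero hf n2),
      EE_iff h2 ha hb (mul_ne_zero hf n3), EE_iff h2 ha hb (mul_ne_zero hf n23)]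
    have h1 : ∀ w : Place F K, w.hs a b = 1 → w.cv f2 ≠ 0 := fun w hw => by
      rw [e2 w ((hT w).mpr hw)]; decide
    have h3 : ∀ w : Place F K, w.hs a b = 1 → w.cv f3 ≠ 0 := fun w hw => by
      rw [e3 w ((hT w).mpr hw)]; decide
    have h23 : ∀ w : Place F K, w.hs a b = 1 → w.cv (f2 * f3) ≠ 0 := fun w hw => by
      rw [w.cv_mul n2 n3, e2 w ((hT w).mpr hw), e3 w ((hT w).mpr hw)]; decide
    have hm : ∀ g : K, g ≠ 0 → (∀ w : Place F K, w.hs a b = 1 → w.cv g ≠ 0) → ∀ w : Place F K, w.hs a b = 1 → w.cv (f * g) ≠ 0 := by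
      intro g hg hh w hw
      rw [w.cv_mul hf hg, h w hw, zero_add]; exact hh w hw
    exact ⟨h1, h3, h23, hm _ n2 h1, hm _ n3 h3, hm _ n23 h23⟩

/-- admissible constants -/
structure Consts (v0 v1 : Place F K) (d1 d2 a0 b0 : K) : Prop where
  ne : v0 ≠ v1
  hd1 : d1 ≠ 0
  hd2 : d2 ≠ 0
  ha0 : a0 ≠ 0
  hb0 : b0 ≠ 0
  delta : ∀ w : Place F K, w.hs d1 d2 = 1 ↔ w = v0 ∨ w = v1
  a00 : v0.cv a0 ≠ 0
  a01 : v1.cv a0 ≠ 0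
  h0 : v0.hs a0 b0 = 1
  h1 : v1.hs a0 b0 = 0

lemma exists_consts (h2 : (2 : F) ≠ 0) {v0 v1 : Place F K} (hne : v0 ≠ v1) : ∃ d1 d2 a0 b0 : K, Consts v0 v1 d1 d2 a0 b0 := by
  classical
  obtain ⟨a0, ha0, ea⟩ := approx_cv (K := K) h2 {v0, v1} fun _ => (0, 1)
  obtain ⟨b0, hb0, eb⟩ := approx_cv (K := K) h2 {v0, v1} fun w => if w = v0 then (1, 0) else 0
  have hk : ∀ κ : ZMod 2, hsv κ (0, 1) (1, 0) = 1 := by unfold hsv; decide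
  obtain ⟨d2, hd2, e1, e2⟩ := exists_gl' h2 [a0] (by simpa using ha0) {v0, v1} (fun _ => (1, 0)) (by
    intro a ha
    obtain rfl := List.mem_singleton.mp ha
    rw [Finset.sum_pair hne, ea v0 (by simp), ea v1 (by simp), hk, hk]
    decide)
  refine ⟨a0, d2, a0, b0, hne, ha0, hd2, ha0, hb0, ?_, ?_, ?_, ?_, ?_⟩
  · intro w
    by_cases hw : w ∈ ({v0, v1} : Finset (Place F K))
    · rw [w.hs_eq, ea w hw, e1 w hw, hk]
      simpa using hw
    · rw [e2 w hw a0 (by simp)]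
      simpa using hw
  · rw [ea v0 (by simp)]; decide
  · rw [ea v1 (by simp)]; decide
  · rw [v0.hs_eq, ea v0 (by simp), eb v0 (by simp), if_pos rfl, hk]
  · rw [v1.hs_eq, eb v1 (by simp), if_neg hne.symm, hsv_zero_right]

lemma Cert_sound (h2 : (2 : F) ≠ 0) {v0 v1 : Place F K} {d1 d2 a0 b0 x y : K} (hC : Consts v0 v1 d1 d2 a0 b0)
    (h : Cert d1 d2 a0 b0 x y) : ∃ w : Place F K, w.hs x y = 1 := by
  classical
  obtain ⟨p, r, e, f, f', g, g', hp, hr, hf, hf', hg, hg', s1, s2, he, hx, hy, s3, s4, s5, s6⟩ := h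
  have ha := mul_ne_zero hC.ha0 hp
  have hb := mul_ne_zero hC.hb0 hr
  have hbe := mul_ne_zero hb he.1
  rw [Sq_iff h2 hC.hd1 hC.hd2 hp] at s1
  rw [Sq_iff h2 hC.hd1 hC.hd2 hr] at s2
  rw [Sq_iff h2 ha hb hf] at s3
  rw [Sq_iff h2 ha hb hg] at s4
  rw [Sq_iff h2 ha hbe hf'] at s5
  rw [Sq_iff h2 ha hbe hg'] at s6
  have hloc : ∀ w, w = v0 ∨ w = v1 → w.hs (a0 * p) (b0 * r) = w.hs a0 b0 := by
    intro w hw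
    have hd := (hC.delta w).mpr hw
    rw [w.hs_eq, w.cv_mul hC.ha0 hp, w.cv_mul hC.hb0 hr, s1 w hd, s2 w hd, add_zero, add_zero, w.hs_eq]
  have h0 : v0.hs (a0 * p) (b0 * r) = 1 := by rw [hloc v0 (Or.inl rfl), hC.h0]
  have h1 : v1.hs (a0 * p) (b0 * r) = 0 := by rw [hloc v1 (Or.inr rfl), hC.h1]
  obtain ⟨T, hT, hsum⟩ := exists_delta (F := F) ha hb
  have hw : ∃ w ∈ T, w ≠ v0 := by
    by_contra hcon
    push Not at hcon
    have : T = {v0} := by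
      ext w
      rw [Finset.mem_singleton]
      refine ⟨hcon w, ?_⟩
      rintro rfl
      exact (hT _).mpr h0
    rw [this, Finset.sum_singleton] at hsum
    exact one_ne_zero hsum
  obtain ⟨w, hwT, hw0⟩ := hw
  have hwab := (hT w).mp hwT
  have hw1 : w ≠ v1 := by
    rintro rfl
    rw [h1] at hwab
    exact zero_ne_one hwab
  have hd : w.hs d1 d2 = 0 := by
    rcases zmod2_cases (w.hs d1 d2) with h | h
    · exact h
    · exact absurd ((hC.delta w).mp h) (by simp [hw0, hw1])
  have hae : w.hs (a0 * p) e = 0 := by rw [(Ee_sound hC.hd1 hC.hd2 ha he w).2, hd]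
  have hwabe : w.hs (a0 * p) (b0 * r * e) = 1 := by rw [w.hs_mul_right _ hb he.1, hwab, hae, add_zero]
  refine ⟨w, ?_⟩
  rw [hx, hy, w.hs_eq, w.cv_mul ha (mul_ne_zero hf hf'), w.cv_mul hf hf', w.cv_mul hb (mul_ne_zero hg hg'), w.cv_mul hg hg',
    s3 w hwab, s4 w hwab, s5 w hwabe, s6 w hwabe, add_zero, add_zero, add_zero, ← w.hs_eq, hwab]

lemma Cert_complete (h2 : (2 : F) ≠ 0) {v0 v1 v : Place F K} {d1 d2 a0 b0 x y : K} (hC : Consts v0 v1 d1 d2 a0 b0)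
    (hx : x ≠ 0) (hy : y ≠ 0) (hv0 : v ≠ v0) (hv1 : v ≠ v1) (h : v.hs x y = 1) : Cert d1 d2 a0 b0 x y := by
  classical
  have hne := hC.ne
  let T : Finset (Place F K) := {v0, v1, v}
  obtain ⟨a, ha, ea⟩ := approx_cv (K := K) h2 T fun w => if w = v then w.cv x else w.cv a0
  have ea0 : v0.cv a = v0.cv a0 := by rw [ea v0 (by simp [T]), if_neg hv0.symm]
  have ea1 : v1.cv a = v1.cv a0 := by rw [ea v1 (by simp [T]), if_neg hv1.symm]
  have eav : v.cv a = v.cv x := by rw [ea v (by simp [T]), if_pos rfl]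
  obtain ⟨b, hb, eb, hab⟩ := exists_gl' (K := K) h2 [a] (by simpa using ha) T
    (fun w => if w = v then w.cv y else w.cv b0) (by
    intro c hc
    obtain rfl := List.mem_singleton.mp hc
    rw [Finset.sum_insert (by simp [hne, hv0.symm]), Finset.sum_pair hv1.symm, if_neg hv0.symm, if_neg hv1.symm, if_pos rfl,
      ea0, ea1, eav, ← Place.hs_eq, ← Place.hs_eq, ← Place.hs_eq, hC.h0, hC.h1, h]
    decide)
  have eb0 : v0.cv b = v0.cv b0 := by rw [eb v0 (by simp [T]), if_neg hv0.symm]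
  have eb1 : v1.cv b = v1.cv b0 := by rw [eb v1 (by simp [T]), if_neg hv1.symm]
  have ebv : v.cv b = v.cv y := by rw [eb v (by simp [T]), if_pos rfl]
  have hab0 : v0.hs a b = 1 := by rw [v0.hs_eq, ea0, eb0, ← v0.hs_eq, hC.h0]
  have hab1 : v1.hs a b = 0 := by rw [v1.hs_eq, ea1, eb1, ← v1.hs_eq, hC.h1]
  have habv : v.hs a b = 1 := by rw [v.hs_eq, eav, ebv, ← v.hs_eq, h]
  obtain ⟨e, he⟩ := Ee_complete h2 hC.hd1 hC.hd2 ha (by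
    intro w hw hN
    rw [← w.cv_eq_zero] at hN
    rcases (hC.delta w).mp hw with rfl | rfl
    · exact hC.a00 (by rw [← ea0, hN])
    · exact hC.a01 (by rw [← ea1, hN]))
  have hae : ∀ w : Place F K, w.hs a e = w.hs d1 d2 := fun w => (Ee_sound hC.hd1 hC.hd2 ha he w).2
  have hdv : v.hs d1 d2 = 0 := by
    rcases zmod2_cases (v.hs d1 d2) with h | h
    · exact h
    · exact absurd ((hC.delta v).mp h) (by simp [hv0, hv1])
  -- supports
  have D1 : ∀ w : Place F K, w.hs a b = 1 → w = v0 ∨ w = v := by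
    intro w hw
    by_cases hwT : w ∈ T
    · simp only [T, Finset.mem_insert, Finset.mem_singleton] at hwT
      rcases hwT with rfl | rfl | rfl
      · exact Or.inl rfl
      · rw [hab1] at hw; exact absurd hw zero_ne_one
      · exact Or.inr rfl
    · rw [hab w hwT a (by simp)] at hw; exact absurd hw zero_ne_one
  have D2 : ∀ w : Place F K, w.hs a (b * e) = 1 → w = v1 ∨ w = v := by
    intro w hw
    rw [w.hs_mul_right _ hb he.1, hae] at hw
    by_cases hwT : w ∈ T
    · simp only [T, Finset.mem_insert, Finset.mem_singleton] at hwT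
      rcases hwT with rfl | rfl | rfl
      · rw [hab0, (hC.delta _).mpr (Or.inl rfl)] at hw
        exact absurd hw (by decide)
      · exact Or.inl rfl
      · exact Or.inr rfl
    · rw [hab w hwT a (by simp), zero_add] at hw
      rcases (hC.delta w).mp hw with rfl | rfl
      · exact absurd (by simp [T]) hwT
      · exact Or.inl rfl
  have hbe := mul_ne_zero hb he.1
  have split : ∀ (z c : K), z ≠ 0 → c ≠ 0 → v.cv z = v.cv c → ∃ f f' : K, f ≠ 0 ∧ f' ≠ 0 ∧ z = c * (f * f') ∧
      Sq a b f ∧ Sq a (b * e) f' := by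
    intro z c hz hc hzc
    have hq : z / c ≠ 0 := div_ne_zero hz hc
    obtain ⟨f, hf, ef⟩ := approx_cv (K := K) h2 T fun w => if w = v1 then w.cv (z / c) else 0
    have hf' : z / c / f ≠ 0 := div_ne_zero hq hf
    have e' : ∀ w : Place F K, w.cv f + w.cv (z / c / f) = w.cv (z / c) := by
      intro w; rw [← w.cv_mul hf hf']; congr 1; field_simp
    have e'' : v.cv (z / c) = 0 := by
      have : v.cv c + v.cv (z / c) = v.cv z := by rw [← v.cv_mul hc hq]; congr 1; field_simp
      rw [hzc] at this
      exact add_eq_left.mp this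
    have efv : v.cv f = 0 := by rw [ef v (by simp [T]), if_neg hv1]
    refine ⟨f, z / c / f, hf, hf', by field_simp, ?_, ?_⟩
    · rw [Sq_iff h2 ha hb hf]
      intro w hw
      rcases D1 w hw with rfl | rfl
      · rw [ef _ (by simp [T]), if_neg hne]
      · exact efv
    · rw [Sq_iff h2 ha hbe hf']
      intro w hw
      rcases D2 w hw with rfl | rfl
      · have := e' w
        rw [ef _ (by simp [T]), if_pos rfl] at this
        exact add_eq_left.mp this
      · have := e' w
        rw [efv, zero_add] at this
        rw [this, e'']
  obtain ⟨f, f', hf, hf', exf, s3, s5⟩ := split x a hx ha eav.symm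
  obtain ⟨g, g', hg, hg', eyg, s4, s6⟩ := split y b hy hb ebv.symm
  have hp : a / a0 ≠ 0 := div_ne_zero ha hC.ha0
  have hr : b / b0 ≠ 0 := div_ne_zero hb hC.hb0
  have epa : a0 * (a / a0) = a := mul_div_cancel₀ a hC.ha0
  have epb : b0 * (b / b0) = b := mul_div_cancel₀ b hC.hb0
  refine ⟨a / a0, b / b0, e, f, f', g, g', hp, hr, hf, hf', hg, hg', ?_, ?_, ?_⟩
  · rw [Sq_iff h2 hC.hd1 hC.hd2 hp]
    intro w hw
    have h1 : w.cv a0 + w.cv (a / a0) = w.cv a := by rw [← w.cv_mul hC.ha0 hp, epa]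
    have h3 : w.cv a = w.cv a0 := by
      rcases (hC.delta w).mp hw with rfl | rfl
      · exact ea0
      · exact ea1
    rw [h3] at h1
    exact add_eq_left.mp h1
  · rw [Sq_iff h2 hC.hd1 hC.hd2 hr]
    intro w hw
    have h1 : w.cv b0 + w.cv (b / b0) = w.cv b := by rw [← w.cv_mul hC.hb0 hr, epb]
    have h3 : w.cv b = w.cv b0 := by
      rcases (hC.delta w).mp hw with rfl | rfl
      · exact eb0
      · exact eb1
    rw [h3] at h1
    exact add_eq_left.mp h1
  · rw [epa, epb]
    exact ⟨he, exf, eyg, s3, s4, s5, s6⟩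

end
end NND

set_option linter.unusedSectionVars false
set_option linter.unusedVariables false
namespace NND
universe u

section
variable {F : Type*} {K : Type u} [Field F] [Field K] [Algebra F K] [Finite F] [GFF F K]

lemma exists_nonsquare (F : Type*) (K : Type u) [Field F] [Field K] [Algebra F K] [Finite F] [GFF F K] : ∃ c : K, c ≠ 0 ∧ ¬ IsSquare c := by
  obtain ⟨w⟩ := exists_place F K
  obtain ⟨x, hx, h⟩ := w.ord_surj
  refine ⟨x, hx, ?_⟩
  rintro ⟨r, rfl⟩
  have hr : r ≠ 0 := by rintro rfl; simp at hx
  rw [w.ord_mul _ _ hr hr] at h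
  omega

theorem nonnorm_iff (F : Type*) (K : Type u) [Field F] [Field K] [Algebra F K] [Finite F] [GFF F K] (h2 : (2 : F) ≠ 0) : ∃ d1 d2 a0 b0 d1' d2' a0' b0' : K, ∀ x y : K,
    (¬ ∃ u v : K, x = u ^ 2 - y * v ^ 2) ↔ ∃ z, x ≠ 0 ∧ z ≠ 0 ∧ y * (y - z) = 0 ∧
      (Cert d1 d2 a0 b0 x z ∨ Cert d1' d2' a0' b0' x z) := by
  classical
  obtain ⟨c, hc0, hc⟩ := exists_nonsquare F K
  obtain ⟨v0, h0, -⟩ := cheb0 h2 hc0 hc (∅ : Finset (Place F K))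
  obtain ⟨v1, h1, -⟩ := cheb0 h2 hc0 hc ({v0} : Finset (Place F K))
  obtain ⟨v2, h3, -⟩ := cheb0 h2 hc0 hc ({v0, v1} : Finset (Place F K))
  obtain ⟨v3, h4, -⟩ := cheb0 h2 hc0 hc ({v0, v1, v2} : Finset (Place F K))
  simp only [Finset.mem_insert, Finset.mem_singleton, not_or] at h1 h3 h4
  obtain ⟨d1, d2, a0, b0, hC⟩ := exists_consts h2 (Ne.symm h1)
  obtain ⟨d1', d2', a0', b0', hC'⟩ := exists_consts h2 (Ne.symm h4.2.2)
  refine ⟨d1, d2, a0, b0, d1', d2', a0', b0', ?_⟩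
  have key : ∀ x z : K, x ≠ 0 → z ≠ 0 → ((Cert d1 d2 a0 b0 x z ∨ Cert d1' d2' a0' b0' x z) ↔ ∃ w : Place F K, w.hs x z = 1) := by
    intro x z hx hz
    constructor
    · rintro (h | h)
      · exact Cert_sound h2 hC h
      · exact Cert_sound h2 hC' h
    · rintro ⟨w, hw⟩
      by_cases hwv : w ≠ v0 ∧ w ≠ v1
      · exact Or.inl (Cert_complete h2 hC hx hz hwv.1 hwv.2 hw)
      · right
        have : w ≠ v2 ∧ w ≠ v3 := by
          have h5 : w = v0 ∨ w = v1 := by tauto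
          rcases h5 with rfl | rfl
          · exact ⟨fun h => h3.1 h.symm, fun h => h4.1 h.symm⟩
          · exact ⟨fun h => h3.2 h.symm, fun h => h4.2.1 h.symm⟩
        exact Cert_complete h2 hC' hx hz this.1 this.2 hw
  intro x y
  constructor
  · intro h
    have hx : x ≠ 0 := by rintro rfl; exact h ⟨0, 0, by simp⟩
    by_cases hy : y = 0
    · subst hy
      have hsq : ¬ IsSquare x := by
        rintro ⟨r, rfl⟩
        exact h ⟨r, 0, by ring⟩
      obtain ⟨w, -, hw⟩ := cheb0 h2 hx hsq (∅ : Finset (Place F K))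
      obtain ⟨z, hz, hwz⟩ := w.exists_hs h2 hw
      exact ⟨z, hx, hz, by simp, (key x z hx hz).mpr ⟨w, hwz⟩⟩
    · refine ⟨y, hx, hy, by simp, (key x y hx hy).mpr ?_⟩
      by_contra hcon
      apply h
      apply hasse (F := F) h2 hy hx
      intro w
      rw [w.hs_comm]
      rcases zmod2_cases (w.hs x y) with h | h
      · exact h
      · exact absurd ⟨w, h⟩ hcon
  · rintro ⟨z, hx, hz, hyz, hC⟩ ⟨u, v, huv⟩
    obtain ⟨w, hw⟩ := (key x z hx hz).mp hC
    have : w.hs x z = 0 := by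
      rcases mul_eq_zero.mp hyz with rfl | h
      · have hxu : x = u ^ 2 := by rw [huv]; ring
        exact w.hs_norm hx hz (u := u) (s := 0) (by rw [hxu]; ring)
      · obtain rfl := sub_eq_zero.mp h
        exact w.hs_norm hx hz huv
    rw [this] at hw
    exact zero_ne_one hw

end

/-! ### diophantine predicates -/
section dio
variable {K : Type u} [Field K] {σ : Type}

def IsPoly (t : (σ → K) → K) : Prop := ∃ f : MvPolynomial σ K, ∀ a, t a = MvPolynomial.eval a f

lemma IsPoly.var (i : σ) : IsPoly (fun a : σ → K => a i) := ⟨MvPolynomial.X i, fun a => by simp⟩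
lemma IsPoly.const (c : K) : IsPoly (fun _ : σ → K => c) := ⟨MvPolynomial.C c, fun a => by simp⟩
lemma IsPoly.mul {s t : (σ → K) → K} (hs : IsPoly s) (ht : IsPoly t) : IsPoly (fun a => s a * t a) := by
  obtain ⟨f, hf⟩ := hs
  obtain ⟨g, hg⟩ := ht
  exact ⟨f * g, fun a => by simp only [hf, hg, map_mul]⟩
lemma IsPoly.sub {s t : (σ → K) → K} (hs : IsPoly s) (ht : IsPoly t) : IsPoly (fun a => s a - t a) := by
  obtain ⟨f, hf⟩ := hs
  obtain ⟨g, hg⟩ := ht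
  exact ⟨f - g, fun a => by simp only [hf, hg, map_sub]⟩
lemma IsPoly.pow {s : (σ → K) → K} (hs : IsPoly s) (n : ℕ) : IsPoly (fun a => s a ^ n) := by
  obtain ⟨f, hf⟩ := hs
  exact ⟨f ^ n, fun a => by simp only [hf, map_pow]⟩
lemma IsPoly.shift {τ : Type} {s : (σ → K) → K} (hs : IsPoly s) (e : σ → τ) :
    IsPoly (fun b : τ → K => s (fun i => b (e i))) := by
  obtain ⟨f, hf⟩ := hs
  exact ⟨MvPolynomial.rename e f, fun a => by simp only [hf, MvPolynomial.eval_rename]; rfl⟩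

def Dio (P : (σ → K) → Prop) : Prop := ∃ (τ : Type) (_ : Finite τ) (f : MvPolynomial (σ ⊕ τ) K),
  ∀ a, P a ↔ ∃ x : τ → K, MvPolynomial.eval (Sum.elim a x) f = 0

lemma Dio.eq {s t : (σ → K) → K} (hs : IsPoly s) (ht : IsPoly t) : Dio (fun a => s a = t a) := by
  obtain ⟨f, hf⟩ := hs.sub ht
  refine ⟨Empty, inferInstance, MvPolynomial.rename Sum.inl f, fun a => ?_⟩
  have hf' : ∀ a, s a - t a = MvPolynomial.eval a f := hf
  beta_reduce
  rw [← sub_eq_zero, hf']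
  simp [MvPolynomial.eval_rename]

lemma Dio.ex {P : (σ → K) → K → Prop} (h : Dio (fun b : Option σ → K => P (fun i => b (some i)) (b none))) :
    Dio (fun a => ∃ z, P a z) := by
  obtain ⟨τ, _, f, hf⟩ := h
  let e : Option σ ⊕ τ → σ ⊕ Option τ := Sum.elim (fun o => o.elim (Sum.inr none) Sum.inl) (fun t => Sum.inr (some t))
  refine ⟨Option τ, inferInstance, MvPolynomial.rename e f, fun a => ?_⟩
  have key : ∀ (z : K) (x : τ → K), (Sum.elim a (fun o : Option τ => o.elim z x)) ∘ e =
      Sum.elim (fun o : Option σ => o.elim z a) x := by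
    intro z x
    funext i
    rcases i with (_ | i) | i <;> rfl
  constructor
  · rintro ⟨z, hz⟩
    obtain ⟨x, hx⟩ := (hf (fun o => o.elim z a)).mp hz
    refine ⟨fun o => o.elim z x, ?_⟩
    rw [MvPolynomial.eval_rename, key, hx]
  · rintro ⟨x, hx⟩
    refine ⟨x none, (hf (fun o => o.elim (x none) a)).mpr ⟨fun i => x (some i), ?_⟩⟩
    rw [← key, ← MvPolynomial.eval_rename]
    convert hx using 3
    funext o
    rcases o with o | (_ | o) <;> rfl

lemma Dio.or {P Q : (σ → K) → Prop} (hP : Dio P) (hQ : Dio Q) : Dio (fun a => P a ∨ Q a) := by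
  obtain ⟨τ, _, f, hf⟩ := hP
  obtain ⟨τ', _, g, hg⟩ := hQ
  refine ⟨τ ⊕ τ', inferInstance, MvPolynomial.rename (Sum.map id Sum.inl) f * MvPolynomial.rename (Sum.map id Sum.inr) g,
    fun a => ?_⟩
  have k1 : ∀ (x : τ ⊕ τ' → K), Sum.elim a x ∘ Sum.map id Sum.inl = Sum.elim a (x ∘ Sum.inl) := by
    intro x; funext i; cases i <;> rfl
  have k2 : ∀ (x : τ ⊕ τ' → K), Sum.elim a x ∘ Sum.map id Sum.inr = Sum.elim a (x ∘ Sum.inr) := by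
    intro x; funext i; cases i <;> rfl
  simp only [map_mul, MvPolynomial.eval_rename, k1, k2, mul_eq_zero]
  rw [hf, hg]
  constructor
  · rintro (⟨x, hx⟩ | ⟨x, hx⟩)
    · exact ⟨Sum.elim x 0, Or.inl (by simpa using hx)⟩
    · exact ⟨Sum.elim 0 x, Or.inr (by simpa using hx)⟩
  · rintro ⟨x, hx | hx⟩
    · exact Or.inl ⟨_, hx⟩
    · exact Or.inr ⟨_, hx⟩

lemma Dio.and {c : K} (hc : ¬ IsSquare c) {P Q : (σ → K) → Prop} (hP : Dio P) (hQ : Dio Q) : Dio (fun a => P a ∧ Q a) := by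
  obtain ⟨τ, _, f, hf⟩ := hP
  obtain ⟨τ', _, g, hg⟩ := hQ
  refine ⟨τ ⊕ τ', inferInstance, MvPolynomial.rename (Sum.map id Sum.inl) f ^ 2 -
    MvPolynomial.C c * MvPolynomial.rename (Sum.map id Sum.inr) g ^ 2, fun a => ?_⟩
  have k1 : ∀ (x : τ ⊕ τ' → K), Sum.elim a x ∘ Sum.map id Sum.inl = Sum.elim a (x ∘ Sum.inl) := by
    intro x; funext i; cases i <;> rfl
  have k2 : ∀ (x : τ ⊕ τ' → K), Sum.elim a x ∘ Sum.map id Sum.inr = Sum.elim a (x ∘ Sum.inr) := by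
    intro x; funext i; cases i <;> rfl
  have k3 : ∀ p q : K, p ^ 2 - c * q ^ 2 = 0 ↔ p = 0 ∧ q = 0 := by
    intro p q
    constructor
    · intro h
      have hq : q = 0 := by
        by_contra hq
        exact hc ⟨p / q, by field_simp; linear_combination -h⟩
      subst hq
      exact ⟨by simpa using h, rfl⟩
    · rintro ⟨rfl, rfl⟩; simp
  simp only [map_mul, map_sub, map_pow, MvPolynomial.eval_C, MvPolynomial.eval_rename, k1, k2, k3]
  rw [hf, hg]
  constructor
  · rintro ⟨⟨x, hx⟩, y, hy⟩
    exact ⟨Sum.elim x y, by simpa using hx, by simpa using hy⟩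
  · rintro ⟨x, hx, hx'⟩
    exact ⟨⟨_, hx⟩, ⟨_, hx'⟩⟩

lemma Dio.ne {s : (σ → K) → K} (hs : IsPoly s) : Dio (fun a => s a ≠ 0) := by
  have h : (fun a => s a ≠ 0) = fun a : σ → K => ∃ z, s a * z = 1 := by
    funext a
    apply propext
    constructor
    · intro h; exact ⟨(s a)⁻¹, mul_inv_cancel₀ h⟩
    · rintro ⟨z, hz⟩ h0
      rw [h0, zero_mul] at hz
      exact zero_ne_one hz
  rw [h]
  apply Dio.ex
  exact Dio.eq ((hs.shift _).mul (IsPoly.var _)) (IsPoly.const 1)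

lemma Dio.Ee {c : K} (hc : ¬ IsSquare c) {a b f e : (σ → K) → K} (ha : IsPoly a) (hb : IsPoly b) (hf : IsPoly f) (he : IsPoly e) :
    Dio (fun x => Ee (a x) (b x) (f x) (e x)) := by
  unfold NND.Ee
  refine Dio.and hc (Dio.ne he) (Dio.and hc ?_ ?_)
  · apply Dio.ex
    apply Dio.ex
    exact Dio.eq ((hb.shift _).mul (he.shift _)) (((IsPoly.var _).pow 2).sub ((ha.shift _).mul ((IsPoly.var _).pow 2)))
  · apply Dio.ex
    apply Dio.ex
    exact Dio.eq ((ha.shift _).mul (hf.shift _)) (((IsPoly.var _).pow 2).sub ((he.shift _).mul ((IsPoly.var _).pow 2)))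

lemma Dio.EE {c : K} (hc : ¬ IsSquare c) {a b f : (σ → K) → K} (ha : IsPoly a) (hb : IsPoly b) (hf : IsPoly f) :
    Dio (fun x => EE (a x) (b x) (f x)) := by
  unfold NND.EE
  apply Dio.ex
  exact Dio.Ee hc (ha.shift _) (hb.shift _) (hf.shift _) (IsPoly.var _)

lemma Dio.Sq {c : K} (hc : ¬ IsSquare c) {a b f : (σ → K) → K} (ha : IsPoly a) (hb : IsPoly b) (hf : IsPoly f) :
    Dio (fun x => Sq (a x) (b x) (f x)) := by
  unfold NND.Sq
  apply Dio.ex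
  apply Dio.ex
  have h2 : IsPoly (fun x : Option (Option σ) → K => x (some none)) := IsPoly.var _
  have h3 : IsPoly (fun x : Option (Option σ) → K => x none) := IsPoly.var _
  have a' := ha.shift (fun i : σ => some (some i))
  have b' := hb.shift (fun i : σ => some (some i))
  have f' := hf.shift (fun i : σ => some (some i))
  exact Dio.and hc (Dio.ne h2) <| Dio.and hc (Dio.ne h3) <| Dio.and hc (Dio.EE hc a' b' h2) <|
    Dio.and hc (Dio.EE hc a' b' h3) <| Dio.and hc (Dio.EE hc a' b' (h2.mul h3)) <|
    Dio.and hc (Dio.EE hc a' b' (f'.mul h2)) <| Dio.and hc (Dio.EE hc a' b' (f'.mul h3)) <|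
    Dio.EE hc a' b' (f'.mul (h2.mul h3))

lemma Dio.Cert {c : K} (hc : ¬ IsSquare c) (d1 d2 a0 b0 : K) {x y : (σ → K) → K} (hx : IsPoly x) (hy : IsPoly y) :
    Dio (fun t => Cert d1 d2 a0 b0 (x t) (y t)) := by
  unfold NND.Cert
  apply Dio.ex
  apply Dio.ex
  apply Dio.ex
  apply Dio.ex
  apply Dio.ex
  apply Dio.ex
  apply Dio.ex
  have hd1 := fun (σ : Type) => IsPoly.const (σ := σ) d1
  have hd2 := fun (σ : Type) => IsPoly.const (σ := σ) d2
  have ha := fun (σ : Type) (i : σ) => (IsPoly.const (σ := σ) a0).mul (IsPoly.var i)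
  have hb := fun (σ : Type) (i : σ) => (IsPoly.const (σ := σ) b0).mul (IsPoly.var i)
  refine Dio.and hc (Dio.ne (IsPoly.var _)) <| Dio.and hc (Dio.ne (IsPoly.var _)) <| Dio.and hc (Dio.ne (IsPoly.var _)) <|
    Dio.and hc (Dio.ne (IsPoly.var _)) <| Dio.and hc (Dio.ne (IsPoly.var _)) <| Dio.and hc (Dio.ne (IsPoly.var _)) <|
    Dio.and hc (Dio.Sq hc (hd1 _) (hd2 _) (IsPoly.var _)) <| Dio.and hc (Dio.Sq hc (hd1 _) (hd2 _) (IsPoly.var _)) <|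
    Dio.and hc (Dio.Ee hc (hd1 _) (hd2 _) (ha _ _) (IsPoly.var _)) <|
    Dio.and hc (Dio.eq (hx.shift _) ((ha _ _).mul ((IsPoly.var _).mul (IsPoly.var _)))) <|
    Dio.and hc (Dio.eq (hy.shift _) ((hb _ _).mul ((IsPoly.var _).mul (IsPoly.var _)))) <|
    Dio.and hc (Dio.Sq hc (ha _ _) (hb _ _) (IsPoly.var _)) <| Dio.and hc (Dio.Sq hc (ha _ _) (hb _ _) (IsPoly.var _)) <|
    Dio.and hc (Dio.Sq hc (ha _ _) ((hb _ _).mul (IsPoly.var _)) (IsPoly.var _)) <|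
    Dio.Sq hc (ha _ _) ((hb _ _).mul (IsPoly.var _)) (IsPoly.var _)

lemma Dio.final [Fintype σ] {P : (σ → K) → Prop} (h : Dio P) : ∃ (m : ℕ) (f : MvPolynomial (σ ⊕ Fin m) K),
    ∀ a : σ → K, P a ↔ ∃ x : Fin m → K, MvPolynomial.eval (Sum.elim a x) f = 0 := by
  obtain ⟨τ, _, f, hf⟩ := h
  obtain ⟨m, ⟨e⟩⟩ := Finite.exists_equiv_fin τ
  refine ⟨m, MvPolynomial.rename (Sum.map id e) f, fun a => ?_⟩
  rw [hf]
  have k : ∀ x : Fin m → K, Sum.elim a x ∘ Sum.map id e = Sum.elim a (x ∘ e) := by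
    intro x; funext i; cases i <;> rfl
  simp only [MvPolynomial.eval_rename, k]
  constructor
  · rintro ⟨x, hx⟩
    refine ⟨x ∘ e.symm, ?_⟩
    rw [Function.comp_assoc, e.symm_comp_self]; exact hx
  · rintro ⟨x, hx⟩; exact ⟨_, hx⟩

end dio

theorem main_aux (F : Type*) (K : Type u) [Field F] [Field K] [Algebra F K] [Finite F] [GFF F K] (h2 : (2 : F) ≠ 0) :
    Dio (fun p : Fin 2 → K => ¬ ∃ u v : K, p 0 = u ^ 2 - p 1 * v ^ 2) := by
  obtain ⟨c, hc0, hc⟩ := exists_nonsquare F K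
  obtain ⟨d1, d2, a0, b0, d1', d2', a0', b0', h⟩ := nonnorm_iff F K h2
  have e : (fun p : Fin 2 → K => ¬ ∃ u v : K, p 0 = u ^ 2 - p 1 * v ^ 2) = fun p : Fin 2 → K =>
      ∃ z, p 0 ≠ 0 ∧ z ≠ 0 ∧ p 1 * (p 1 - z) = 0 ∧
      (Cert d1 d2 a0 b0 (p 0) z ∨ Cert d1' d2' a0' b0' (p 0) z) := by
    funext p
    exact propext (h (p 0) (p 1))
  rw [e]
  apply Dio.ex
  exact Dio.and hc (Dio.ne (IsPoly.var _)) <| Dio.and hc (Dio.ne (IsPoly.var _)) <|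
    Dio.and hc (Dio.eq ((IsPoly.var _).mul ((IsPoly.var _).sub (IsPoly.var _))) (IsPoly.const 0)) <|
    Dio.or (Dio.Cert hc _ _ _ _ (IsPoly.var _) (IsPoly.var _)) (Dio.Cert hc _ _ _ _ (IsPoly.var _) (IsPoly.var _))

end NND

/-- Over a global function field `K` of odd characteristic, the set of pairs
`(x, y) ∈ K²` such that `x` is not a norm from `K(√y)` to `K` (i.e. not of the form
`u² − y·v²`) is diophantine over `K`. -/
theorem nonnorm_diophantine_functionField
    (Fq K : Type*) [Field Fq] [Fintype Fq] [Field K] [Algebra (RatFunc Fq) K]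
    [FunctionField Fq K] (hq : Odd (Fintype.card Fq)) :
    IsDiophantine {p : Fin 2 → K | ¬ ∃ u v : K, p 0 = u ^ 2 - p 1 * v ^ 2} := by
  let _ : Algebra Fq K := ((algebraMap (RatFunc Fq) K).comp (algebraMap Fq (RatFunc Fq))).toAlgebra
  have : IsScalarTower Fq (RatFunc Fq) K := IsScalarTower.of_algebraMap_eq fun _ => rfl
  have hfd : Module.Finite (RatFunc Fq) K := ‹FunctionField Fq K›
  have e1 : Algebra.EssFiniteType (Polynomial Fq) (RatFunc Fq) :=
    Algebra.EssFiniteType.of_isLocalization _ (nonZeroDivisors (Polynomial Fq))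
  have e2 : Algebra.EssFiniteType Fq (RatFunc Fq) :=
    Algebra.EssFiniteType.comp Fq (Polynomial Fq) (RatFunc Fq)
  have e3 : Algebra.EssFiniteType Fq K := Algebra.EssFiniteType.comp Fq (RatFunc Fq) K
  have a1 : Algebra.IsAlgebraic (Polynomial Fq) (RatFunc Fq) :=
    IsLocalization.isAlgebraic _ (nonZeroDivisors (Polynomial Fq))
  have a2 : Algebra.IsAlgebraic (RatFunc Fq) K := Algebra.IsAlgebraic.of_finite _ _
  have t1 : Algebra.trdeg Fq (RatFunc Fq) = 1 := by
    rw [← _root_.trdeg_add_eq Fq (Polynomial Fq) (A := RatFunc Fq), Polynomial.trdeg_of_isDomain,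
      _root_.trdeg_eq_zero, add_zero]
  have t2 : Algebra.trdeg Fq K = 1 := by
    have h := _root_.lift_trdeg_add_eq Fq (RatFunc Fq) K
    rw [t1, _root_.trdeg_eq_zero, Cardinal.lift_one, Cardinal.lift_zero, add_zero] at h
    exact (Cardinal.lift_eq_one.mp h.symm)
  have : NND.GFF Fq K := ⟨e3, t2⟩
  have h2 : (2 : Fq) ≠ 0 := by
    apply Ring.two_ne_zero
    intro h
    have := FiniteField.even_card_iff_char_two.mp h
    rw [Nat.odd_iff] at hq
    omega
  exact (NND.main_aux Fq K h2).final
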